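/- arXiv:1102.2493 — 2 statements merged into one kernel-verified Lean document; each statement's English description precedes it below -/
import Mathlib

section
/- Let K be a finite field with at least three elements, and let V be a maximal linear subspace of M_n(K) with a trivial spectrum. Then there exist matrices M_1,…,M_p, each either equal to the zero matrix of M_1(K) or belonging to M_2(K) with no eigenvalue in K, such that V is similar to K·M_1 ∨ ⋯ ∨ K·M_p; moreover each M_k is uniquely determined by V up to similarity and multiplication by a non-zero scalar. -/
open Matrix

/-- `V ∨ W`: block upper-triangular matrices with diagonal blocks in `V` and `W` and
arbitrary upper-right block. -/
def blockJoin {K : Type*} [Field K] {n p : ℕ}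
    (V : Set (Matrix (Fin n) (Fin n) K)) (W : Set (Matrix (Fin p) (Fin p) K)) :
    Set (Matrix (Fin (n + p)) (Fin (n + p)) K) :=
  {M | ∃ A ∈ V, ∃ C ∈ W, ∃ B : Matrix (Fin n) (Fin p) K,
    M = Matrix.reindex finSumFinEquiv finSumFinEquiv (Matrix.fromBlocks A B 0 C)}

/-- Sum of the sizes in a list of (size, matrix) pairs. -/
def sigSum {β : ℕ → Type*} : List (Σ m : ℕ, β m) → ℕ
  | [] => 0
  | x :: xs => x.1 + sigSum xs

/-- `K·M_1 ∨ ⋯ ∨ K·M_p` for a list of pairs `(n_k, M_k)`. -/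
def bdSetSpan {K : Type*} [Field K] :
    (l : List (Σ m : ℕ, Matrix (Fin m) (Fin m) K)) →
      Set (Matrix (Fin (sigSum l)) (Fin (sigSum l)) K)
  | [] => Set.univ
  | x :: xs => blockJoin (Set.range (fun c : K => c • x.2)) (bdSetSpan xs)

/-- Two subspaces of `M_n(K)` are similar if one is obtained from the other by conjugation. -/
def SimilarSets {K : Type*} [Field K] {n : ℕ}
    (V W : Set (Matrix (Fin n) (Fin n) K)) : Prop :=
  ∃ P : Matrix (Fin n) (Fin n) K, IsUnit P ∧ W = (fun M => P * M * P⁻¹) '' V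

/-- A linear subspace of matrices has a trivial spectrum if no matrix of it
possesses a non-zero invariant vector. -/
def TrivialSpectrum {K : Type*} [Field K] {n : ℕ} (V : Set (Matrix (Fin n) (Fin n) K)) : Prop :=
  ∀ M ∈ V, ∀ X : Fin n → K, M.mulVec X = X → X = 0

/-- Each block is either the zero matrix of `M_1(K)` or a `2 × 2` matrix without any
eigenvalue in `K`; and `V` is similar to `K·M_1 ∨ ⋯ ∨ K·M_p`. -/
def SpanRepresents {K : Type*} [Field K] {n : ℕ}
    (V : Submodule K (Matrix (Fin n) (Fin n) K))
    (l : List (Σ m : ℕ, Matrix (Fin m) (Fin m) K)) : Prop :=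
  (∀ x ∈ l, (x.1 = 1 ∧ x.2 = 0) ∨
    (x.1 = 2 ∧ ∀ (c : K) (X : Fin x.1 → K), x.2.mulVec X = c • X → X = 0)) ∧
  ∃ h : sigSum l = n,
    SimilarSets ((Matrix.reindex (finCongr h) (finCongr h)) '' bdSetSpan l)
      (V : Set (Matrix (Fin n) (Fin n) K))

/-- Same sizes and the matrices are similar up to a non-zero scalar multiple. -/
def simScalar {K : Type*} [Field K] (x y : Σ m : ℕ, Matrix (Fin m) (Fin m) K) : Prop :=
  ∃ h : x.1 = y.1, ∃ c : K, c ≠ 0 ∧ ∃ R : Matrix (Fin x.1) (Fin x.1) K, IsUnit R ∧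
    Matrix.reindex (finCongr h.symm) (finCongr h.symm) y.2 = c • (R * x.2 * R⁻¹)

namespace TrivSpec

open Module

section Basic

variable {K E : Type*} [Field K] [AddCommGroup E] [Module K E]

/-- No element of `V` has a nonzero fixed vector. -/
def IsTS (V : Submodule K (End K E)) : Prop := ∀ f ∈ V, ∀ x, f x = x → x = 0

/-- The linear forms `φ` such that the rank-one operator `v ↦ φ v • x` belongs to `V`. -/
def rankOne (V : Submodule K (End K E)) (x : E) : Submodule K (Dual K E) where
  carrier := {φ | φ.smulRight x ∈ V}
  add_mem' {a b} ha hb := by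
    have : (a + b).smulRight x = a.smulRight x + b.smulRight x := by ext; simp [add_smul]
    simpa [this] using V.add_mem ha hb
  zero_mem' := by
    have : (0 : Dual K E).smulRight x = 0 := by ext; simp
    simp [this]
  smul_mem' c a ha := by
    have : (c • a).smulRight x = c • a.smulRight x := by ext; simp [mul_smul]
    simpa [this] using V.smul_mem c ha

theorem mem_rankOne {V : Submodule K (End K E)} {x : E} {φ : Dual K E} :
    φ ∈ rankOne V x ↔ φ.smulRight x ∈ V := Iff.rfl

/-- The orbit space `{f x | f ∈ V}`. -/
def orbit (V : Submodule K (End K E)) (x : E) : Submodule K E := V.map (LinearMap.applyₗ x)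

theorem mem_orbit {V : Submodule K (End K E)} {x y : E} :
    y ∈ orbit V x ↔ ∃ f ∈ V, f x = y := by simp [orbit]

/-- The operators of `V` annihilating `x`. -/
def stab (V : Submodule K (End K E)) (x : E) : Submodule K (End K E) :=
  V ⊓ LinearMap.ker (LinearMap.applyₗ x : End K E →ₗ[K] E)

theorem mem_stab {V : Submodule K (End K E)} {x : E} {f : End K E} :
    f ∈ stab V x ↔ f ∈ V ∧ f x = 0 := by simp [stab]

/-- Every operator of `V` maps `G` into itself. -/
def Invariant (V : Submodule K (End K E)) (G : Submodule K E) : Prop :=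
  ∀ f ∈ V, ∀ x ∈ G, f x ∈ G

/-- Operators induced by `V` on the subspace `G`. -/
def res (V : Submodule K (End K E)) (G : Submodule K E) : Submodule K (End K G) where
  carrier := {g | ∃ f ∈ V, ∀ x : G, (g x : E) = f x}
  add_mem' := by
    rintro a b ⟨f, hf, h⟩ ⟨f', hf', h'⟩
    exact ⟨f + f', V.add_mem hf hf', fun x => by simp [h, h']⟩
  zero_mem' := ⟨0, V.zero_mem, by simp⟩
  smul_mem' := by
    rintro c a ⟨f, hf, h⟩
    exact ⟨c • f, V.smul_mem c hf, fun x => by simp [h]⟩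

/-- Operators induced by `V` on the quotient by `G`. -/
def quo (V : Submodule K (End K E)) (G : Submodule K E) : Submodule K (End K (E ⧸ G)) where
  carrier := {g | ∃ f ∈ V, ∀ x : E, g (G.mkQ x) = G.mkQ (f x)}
  add_mem' := by
    rintro a b ⟨f, hf, h⟩ ⟨f', hf', h'⟩
    exact ⟨f + f', V.add_mem hf hf', fun x => by
      rw [LinearMap.add_apply, h, h', LinearMap.add_apply, map_add]⟩
  zero_mem' := ⟨0, V.zero_mem, by simp⟩
  smul_mem' := by
    rintro c a ⟨f, hf, h⟩
    exact ⟨c • f, V.smul_mem c hf, fun x => by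
      rw [LinearMap.smul_apply, h, LinearMap.smul_apply, map_smul]⟩

/-- Operators vanishing on `G` with image in `G`. -/
def nilp (G : Submodule K E) : Submodule K (End K E) where
  carrier := {f | (∀ x ∈ G, f x = 0) ∧ ∀ x, f x ∈ G}
  add_mem' := by
    rintro a b ⟨h1, h2⟩ ⟨h3, h4⟩
    exact ⟨fun x hx => by simp [h1 x hx, h3 x hx], fun x => G.add_mem (h2 x) (h4 x)⟩
  zero_mem' := by simp
  smul_mem' := by
    rintro c a ⟨h1, h2⟩
    exact ⟨fun x hx => by simp [h1 x hx], fun x => G.smul_mem c (h2 x)⟩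

theorem IsTS.mono {V W : Submodule K (End K E)} (hV : IsTS V) (h : W ≤ V) : IsTS W :=
  fun f hf => hV f (h hf)

theorem IsTS.notMem_orbit {V : Submodule K (End K E)} (hV : IsTS V) {x : E} (hx : x ≠ 0) :
    x ∉ orbit V x := by
  rw [mem_orbit]
  rintro ⟨f, hf, h⟩
  exact hx (hV f hf x h)

theorem IsTS.res {V : Submodule K (End K E)} (hV : IsTS V) (G : Submodule K E) :
    IsTS (res V G) := by
  rintro g ⟨f, hf, h⟩ x hx
  have := hV f hf x (by rw [← h, hx])
  exact_mod_cast this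

/-- Among finitely many vectors, one of them is a sink of the graph given by rank-one operators. -/
theorem IsTS.exists_sink {V : Submodule K (End K E)} (hV : IsTS V) (S : Finset E)
    (hS : S.Nonempty) : ∃ x ∈ S, ∀ φ ∈ rankOne V x, ∀ y ∈ S, φ y = 0 := by
  classical
  induction S using Finset.strongInduction with
  | H S ih =>
    by_contra! hcon
    choose! φ hφ s hs hne using hcon
    have himg : ∀ s' : E → E, (∀ x ∈ S, s' x ∈ S) → (∀ x ∈ S, φ x (s' x) ≠ 0) →
        S.image s' = S := by
      intro s' h1 h2
      by_contra hne'
      have hsub : S.image s' ⊂ S :=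
        (Finset.image_subset_iff.2 h1).ssubset_of_ne hne'
      obtain ⟨x, hx, hx'⟩ := ih _ hsub (hS.image s')
      have hxS := hsub.1 hx
      exact h2 x hxS (hx' _ (hφ x hxS) _ (Finset.mem_image_of_mem _ hxS))
    have hinj : Set.InjOn s S := Finset.card_image_iff.1 (by rw [himg s hs hne])
    have huniq : ∀ x ∈ S, ∀ y ∈ S, y ≠ s x → φ x y = 0 := by
      intro x hx y hy hys
      by_contra hxy
      have h1 := himg (Function.update s x y)
        (fun z hz => by
          by_cases hzx : z = x
          · subst hzx; simpa using hy
          · simpa [hzx] using hs z hz)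
        (fun z hz => by
          by_cases hzx : z = x
          · subst hzx; simpa using hxy
          · simpa [hzx] using hne z hz)
      have h2 : s x ∈ S.image (Function.update s x y) := by rw [h1]; exact hs x hx
      obtain ⟨z, hz, hzs⟩ := Finset.mem_image.1 h2
      by_cases hzx : z = x
      · subst hzx; simp at hzs; exact hys hzs
      · simp [hzx] at hzs
        exact hzx (hinj hz hx hzs)
    have hsum : ∀ x ∈ S, φ x (∑ y ∈ S, y) = φ x (s x) := by
      intro x hx
      rw [map_sum]
      exact Finset.sum_eq_single_of_mem _ (hs x hx) (fun y hy h => huniq x hx y hy h)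
    have hfix := hV (∑ x ∈ S, (φ x (s x))⁻¹ • (φ x).smulRight x)
      (V.sum_mem fun x hx => V.smul_mem _ (hφ x hx)) (∑ y ∈ S, y) (by
        rw [LinearMap.sum_apply]
        refine Finset.sum_congr rfl fun x hx => ?_
        rw [LinearMap.smul_apply, LinearMap.smulRight_apply, hsum x hx, smul_smul,
          inv_mul_cancel₀ (hne x hx), one_smul])
    obtain ⟨x, hx⟩ := hS
    exact hne x hx (by rw [← hsum x hx, hfix, map_zero])

theorem finrank_map_add_finrank_inf_ker {M N : Type*} [AddCommGroup M] [Module K M]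
    [AddCommGroup N] [Module K N] [FiniteDimensional K M] (L : M →ₗ[K] N) (V : Submodule K M) :
    finrank K (V.map L) + finrank K (V ⊓ LinearMap.ker L : Submodule K M) = finrank K V := by
  have h := LinearMap.finrank_range_add_finrank_ker (L.domRestrict V)
  rw [LinearMap.range_domRestrict, LinearMap.ker_domRestrict] at h
  rw [← h]
  congr 1
  rw [inf_comm]
  exact ((Submodule.equivSubtypeMap V _).finrank_eq.trans
    (by rw [Submodule.map_comap_subtype, inf_comm])).symm

theorem finrank_orbit_add_stab [FiniteDimensional K E] (V : Submodule K (End K E)) (x : E) :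
    finrank K (orbit V x) + finrank K (stab V x) = finrank K V :=
  finrank_map_add_finrank_inf_ker _ V

theorem finrank_nilp_le [FiniteDimensional K E] (G : Submodule K E) :
    finrank K (nilp G) ≤ (finrank K E - finrank K G) * finrank K G := by
  have h1 : finrank K ((E ⧸ G) →ₗ[K] G) = (finrank K E - finrank K G) * finrank K G := by
    rw [Module.finrank_linearMap, Submodule.finrank_quotient]
  rw [← h1]
  let L : nilp G →ₗ[K] ((E ⧸ G) →ₗ[K] G) :=
    { toFun := fun f => G.liftQ (f.1.codRestrict G f.2.2) (fun x hx => by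
        simpa using f.2.1 x hx)
      map_add' := fun f g => by ext; simp
      map_smul' := fun c f => by ext; simp }
  refine LinearMap.finrank_le_finrank_of_injective (f := L) ?_
  rw [injective_iff_map_eq_zero]
  intro f hf
  ext x
  have := congrArg (fun g => ((g (G.mkQ x) : G) : E)) hf
  simpa [L] using this

theorem finrank_le_add_ker {W A B : Type*} [AddCommGroup W] [Module K W] [AddCommGroup A]
    [Module K A] [AddCommGroup B] [Module K B] [FiniteDimensional K W] [FiniteDimensional K A]
    [FiniteDimensional K B] (ρ : W →ₗ[K] A) (σ : W →ₗ[K] B) :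
    finrank K W ≤ finrank K A + finrank K B +
      finrank K (LinearMap.ker ρ ⊓ LinearMap.ker σ : Submodule K W) := by
  have h1 := LinearMap.finrank_range_add_finrank_ker (ρ.prod σ)
  have h2 := Submodule.finrank_le (LinearMap.range (ρ.prod σ))
  rw [Module.finrank_prod] at h2
  rw [LinearMap.ker_prod] at h1
  omega

theorem finrank_le_res_add_quo [FiniteDimensional K E] {V : Submodule K (End K E)}
    {G : Submodule K E} (h : Invariant V G) :
    finrank K V ≤ finrank K (res V G) + finrank K (quo V G) +
      finrank K (V ⊓ nilp G : Submodule K (End K E)) := by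
  let ρ : V →ₗ[K] res V G :=
    { toFun := fun f => ⟨f.1.restrict (h f.1 f.2), f.1, f.2, fun x => rfl⟩
      map_add' := fun f g => by ext; simp
      map_smul' := fun c f => by ext; simp }
  let σ : V →ₗ[K] quo V G :=
    { toFun := fun f => ⟨G.mapQ G f.1 (h f.1 f.2), f.1, f.2, fun x => by simp⟩
      map_add' := fun f g => by ext; simp
      map_smul' := fun c f => by ext; simp }
  have h1 := finrank_le_add_ker (A := res V G) (B := quo V G) ρ σ
  have h3 : finrank K (LinearMap.ker ρ ⊓ LinearMap.ker σ : Submodule K V) ≤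
      finrank K (V ⊓ nilp G : Submodule K (End K E)) := by
    let L : (LinearMap.ker ρ ⊓ LinearMap.ker σ : Submodule K V) →ₗ[K]
        (V ⊓ nilp G : Submodule K (End K E)) :=
      (V.subtype ∘ₗ (LinearMap.ker ρ ⊓ LinearMap.ker σ : Submodule K V).subtype).codRestrict _ (by
        rintro ⟨⟨f, hf⟩, hk⟩
        rw [Submodule.mem_inf, LinearMap.mem_ker, LinearMap.mem_ker] at hk
        refine ⟨hf, fun x hx => ?_, fun x => ?_⟩
        · have := congrArg (fun g : res V G => ((g.1 ⟨x, hx⟩ : G) : E)) hk.1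
          simpa [ρ] using this
        · have := congrArg (fun g : quo V G => g.1 (G.mkQ x)) hk.2
          simpa [σ] using this)
    refine LinearMap.finrank_le_finrank_of_injective (f := L) ?_
    rintro ⟨⟨f, hf⟩, hk⟩ ⟨⟨f', hf'⟩, hk'⟩ h
    have := congrArg Subtype.val h
    simpa [L] using this
  omega

theorem IsTS.quo {V : Submodule K (End K E)} (hV : IsTS V) {G : Submodule K E}
    [FiniteDimensional K E] (hG : Invariant V G) : IsTS (quo V G) := by
  rintro g ⟨f, hf, h⟩ x hx
  obtain ⟨x, rfl⟩ := G.mkQ_surjective x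
  rw [h, ← sub_eq_zero, ← map_sub, ← LinearMap.mem_ker, Submodule.ker_mkQ] at hx
  have hmap : ∀ y ∈ G, (f - 1 : End K E) y ∈ G := fun y hy => by
    simpa using G.sub_mem (hG f hf y hy) hy
  have hinj : Function.Injective ((f - 1 : End K E).restrict hmap) := by
    rw [injective_iff_map_eq_zero]
    intro y hy
    have h1 := congrArg Subtype.val hy
    simp [sub_eq_zero] at h1
    exact_mod_cast hV f hf y h1
  obtain ⟨y, hy⟩ := (LinearMap.injective_iff_surjective.1 hinj) ⟨f x - x, hx⟩
  have h1 := congrArg Subtype.val hy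
  have h2 : x - y = 0 := hV f hf _ (by
    simp only [LinearMap.coe_restrict_apply, LinearMap.sub_apply, Module.End.one_apply] at h1
    rw [map_sub, ← sub_eq_zero, sub_sub_sub_comm, h1, sub_self])
  rw [← LinearMap.mem_ker, Submodule.ker_mkQ, sub_eq_zero.1 h2]
  exact y.2

theorem finrank_inf_nilp_span_le [FiniteDimensional K E] {V : Submodule K (End K E)} {x : E}
    (hx : x ≠ 0) :
    finrank K (V ⊓ nilp (K ∙ x) : Submodule K (End K E)) ≤ finrank K (rankOne V x) := by
  obtain ⟨l, hl⟩ := Projective.exists_dual_eq_one K hx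
  have key : ∀ f ∈ nilp (K ∙ x), (l ∘ₗ f).smulRight x = f := by
    rintro f ⟨-, h⟩
    ext v
    obtain ⟨c, hc⟩ := Submodule.mem_span_singleton.1 (h v)
    simp [← hc, hl]
  let L : (V ⊓ nilp (K ∙ x) : Submodule K (End K E)) →ₗ[K] rankOne V x :=
    { toFun := fun f => ⟨l ∘ₗ f.1, by
        rw [mem_rankOne, key _ f.2.2]; exact f.2.1⟩
      map_add' := fun f g => by ext; simp
      map_smul' := fun c f => by ext; simp }
  refine LinearMap.finrank_le_finrank_of_injective (f := L) ?_
  intro f g h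
  have h1 : l ∘ₗ f.1 = l ∘ₗ g.1 := congrArg Subtype.val h
  ext1
  rw [← key _ f.2.2, ← key _ g.2.2, h1]

theorem invariant_stab_span (V : Submodule K (End K E)) (x : E) :
    Invariant (stab V x) (K ∙ x) := by
  rintro f hf y hy
  obtain ⟨c, rfl⟩ := Submodule.mem_span_singleton.1 hy
  simp [(mem_stab.1 hf).2]

theorem res_stab_span (V : Submodule K (End K E)) (x : E) : res (stab V x) (K ∙ x) = ⊥ := by
  rw [eq_bot_iff]
  rintro g ⟨f, hf, h⟩
  rw [Submodule.mem_bot]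
  ext ⟨y, hy⟩
  obtain ⟨c, rfl⟩ := Submodule.mem_span_singleton.1 hy
  rw [h]
  simp [(mem_stab.1 hf).2]

theorem rankOne_mono {V W : Submodule K (End K E)} (h : V ≤ W) (x : E) :
    rankOne V x ≤ rankOne W x := fun _ hφ => h hφ

theorem finrank_quotient_span [FiniteDimensional K E] {x : E} (hx : x ≠ 0) :
    finrank K (E ⧸ (K ∙ x)) = finrank K E - 1 := by
  rw [Submodule.finrank_quotient, finrank_span_singleton hx]

theorem finrank_stab_le [FiniteDimensional K E] (V : Submodule K (End K E)) {x : E}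
    (hx : x ≠ 0) : finrank K (stab V x) ≤ finrank K (quo (stab V x) (K ∙ x)) +
      finrank K (rankOne V x) := by
  have h1 := finrank_le_res_add_quo (invariant_stab_span V x)
  rw [res_stab_span, finrank_bot, zero_add] at h1
  have h2 := finrank_inf_nilp_span_le (V := stab V x) hx
  have h3 := Submodule.finrank_mono (rankOne_mono (V := stab V x) (W := V) inf_le_left x)
  omega

theorem finrank_orbit_lt [FiniteDimensional K E] {V : Submodule K (End K E)} (hV : IsTS V)
    {x : E} (hx : x ≠ 0) : finrank K (orbit V x) < finrank K E := by
  refine Submodule.finrank_lt fun h => hV.notMem_orbit hx ?_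
  rw [h]; trivial

theorem IsTS.quo_stab [FiniteDimensional K E] {V : Submodule K (End K E)} (hV : IsTS V)
    (x : E) : IsTS (TrivSpec.quo (stab V x) (K ∙ x)) :=
  (hV.mono inf_le_left).quo (invariant_stab_span V x)

theorem IsTS.exists_rankOne_eq_bot [FiniteDimensional K E] {V : Submodule K (End K E)}
    (hV : IsTS V) (hE : 0 < finrank K E) : ∃ x ≠ 0, rankOne V x = ⊥ := by
  classical
  let b := Module.finBasis K E
  obtain ⟨x, hx, hx'⟩ := hV.exists_sink (Finset.univ.image b) ⟨b ⟨0, hE⟩, by simp⟩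
  obtain ⟨i, -, rfl⟩ := Finset.mem_image.1 hx
  refine ⟨b i, b.ne_zero i, ?_⟩
  rw [eq_bot_iff]
  intro φ hφ
  rw [Submodule.mem_bot]
  exact b.ext fun j => by simpa using hx' φ hφ (b j) (by simp)

theorem choose_two_succ (n : ℕ) : (n + 1).choose 2 = n + n.choose 2 := by
  rw [Nat.choose_succ_succ' n 1, Nat.choose_one_right]

theorem IsTS.finrank_le [FiniteDimensional K E] {V : Submodule K (End K E)} (hV : IsTS V) :
    finrank K V ≤ (finrank K E).choose 2 := by
  obtain ⟨n, hn⟩ : ∃ n, finrank K E = n := ⟨_, rfl⟩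
  induction n generalizing E with
  | zero =>
    have := Submodule.finrank_le V
    rw [Module.finrank_linearMap, hn] at this
    omega
  | succ n ih =>
    obtain ⟨x, h0, hR⟩ := hV.exists_rankOne_eq_bot (by omega)
    have h1 := finrank_orbit_lt hV h0
    have h2 := finrank_stab_le V h0
    have h3 : finrank K (E ⧸ (K ∙ x)) = n := by rw [finrank_quotient_span h0, hn]; rfl
    have h4 := ih (hV.quo_stab x) h3
    have h5 := finrank_orbit_add_stab V x
    rw [hR, finrank_bot] at h2
    rw [h3] at h4
    rw [hn] at h1 ⊢
    rw [choose_two_succ]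
    omega

/-- A trivial spectrum space of the largest possible dimension. -/
def IsMax (V : Submodule K (End K E)) : Prop :=
  IsTS V ∧ finrank K V = (finrank K E).choose 2

theorem IsMax.le_orbit_add_rankOne [FiniteDimensional K E] {V : Submodule K (End K E)}
    (hV : IsMax V) {x : E} (hx : x ≠ 0) :
    finrank K E ≤ finrank K (orbit V x) + finrank K (rankOne V x) + 1 := by
  have h2 := finrank_stab_le V hx
  have h3 := finrank_quotient_span (K := K) hx
  have h4 := (hV.1.quo_stab x).finrank_le
  have h5 := finrank_orbit_add_stab V x
  rw [hV.2] at h5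
  rw [h3] at h4
  obtain hn | ⟨n, hn⟩ : finrank K E = 0 ∨ ∃ n, finrank K E = n + 1 := by
    cases finrank K E <;> simp
  · omega
  · rw [hn, choose_two_succ] at h5
    rw [hn] at h4
    simp only [Nat.add_sub_cancel] at h4
    omega

theorem choose_two_add (a b : ℕ) :
    (a + b).choose 2 = a.choose 2 + b.choose 2 + b * a := by
  induction b with
  | zero => simp
  | succ b ih =>
    rw [← add_assoc, choose_two_succ, choose_two_succ, ih]
    ring

theorem IsMax.of_invariant [FiniteDimensional K E] {V : Submodule K (End K E)}
    (hV : IsMax V) {G : Submodule K E} (hG : Invariant V G) :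
    nilp G ≤ V ∧ IsMax (res V G) ∧ IsMax (quo V G) := by
  have h1 := (hV.1.res G).finrank_le
  have h2 := (hV.1.quo hG).finrank_le
  have h3 := finrank_nilp_le G
  have h4 := finrank_le_res_add_quo hG
  have h5 : finrank K (V ⊓ nilp G : Submodule K (End K E)) ≤ finrank K (nilp G) :=
    Submodule.finrank_mono inf_le_right
  have h6 := Submodule.finrank_quotient_add_finrank G
  have h7 := choose_two_add (finrank K G) (finrank K (E ⧸ G))
  rw [add_comm, h6, ← hV.2] at h7
  have h8 : finrank K E - finrank K G = finrank K (E ⧸ G) := by omega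
  rw [h8] at h3
  refine ⟨?_, ⟨hV.1.res G, by omega⟩, hV.1.quo hG, by omega⟩
  have h9 : V ⊓ nilp G = nilp G :=
    Submodule.eq_of_le_of_finrank_le inf_le_right (by omega)
  exact inf_eq_right.1 h9

end Basic

section Counting

variable {K E : Type*} [Field K] [AddCommGroup E] [Module K E]

theorem IsTS.one_add_injective {V : Submodule K (End K E)} (hV : IsTS V) {f : End K E}
    (hf : f ∈ V) : Function.Injective (1 + f : End K E) := by
  rw [injective_iff_map_eq_zero]
  intro x hx
  refine hV (-f) (V.neg_mem hf) x ?_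
  simp only [LinearMap.add_apply, Module.End.one_apply] at hx
  rw [LinearMap.neg_apply, eq_comm]
  exact eq_neg_of_add_eq_zero_left hx

/-- The invertible operator `1 + f`. -/
noncomputable def oneAdd [FiniteDimensional K E] {V : Submodule K (End K E)} (hV : IsTS V)
    {f : End K E} (hf : f ∈ V) : E ≃ₗ[K] E :=
  LinearEquiv.ofInjectiveEndo (1 + f) (hV.one_add_injective hf)

theorem oneAdd_apply [FiniteDimensional K E] {V : Submodule K (End K E)} (hV : IsTS V)
    {f : End K E} (hf : f ∈ V) (x : E) : oneAdd hV hf x = x + f x := by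
  change (1 + f : End K E) x = _
  simp

theorem IsMax.le_orbit_add_rankOne_translate [FiniteDimensional K E]
    {V : Submodule K (End K E)} (hV : IsMax V) {f : End K E} (hf : f ∈ V) {x : E} (hx : x ≠ 0) :
    finrank K E ≤ finrank K (orbit V x) + finrank K (rankOne V (x + f x)) + 1 := by
  set g := oneAdd hV.1 hf with hg
  have hgx : ∀ y, g y = y + f y := oneAdd_apply hV.1 hf
  let T : End K E ≃ₗ[K] End K E := g.arrowCongr (LinearEquiv.refl K E)
  have hT : ∀ h y, T h (g y) = h y := fun h y => by simp [T, LinearEquiv.arrowCongr_apply]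
  let W : Submodule K (End K E) := V.map (T : End K E →ₗ[K] End K E)
  have hW : IsMax W := by
    refine ⟨?_, ?_⟩
    · rintro _ ⟨h, hh, rfl⟩ y hy
      obtain ⟨y, rfl⟩ := g.surjective y
      have h1 : h y = y + f y := by rw [← hT h y, ← hgx]; exact hy
      have h2 := hV.1 _ (V.sub_mem hh hf) y (by rw [LinearMap.sub_apply, h1]; abel)
      rw [h2, map_zero]
    · rw [← hV.2]
      exact LinearEquiv.finrank_map_eq T V
  have h1 := hW.le_orbit_add_rankOne (x := g x) (by simpa using hx)
  have h2 : orbit W (g x) = orbit V x := by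
    ext y
    rw [mem_orbit, mem_orbit]
    constructor
    · rintro ⟨_, ⟨h, hh, rfl⟩, rfl⟩
      exact ⟨h, hh, (hT h x).symm⟩
    · rintro ⟨h, hh, rfl⟩
      exact ⟨T h, ⟨h, hh, rfl⟩, hT h x⟩
  have h3 : finrank K (rankOne W (g x)) ≤ finrank K (rankOne V (x + f x)) := by
    rw [← hgx]
    let L : rankOne W (g x) →ₗ[K] rankOne V (g x) :=
      { toFun := fun φ => ⟨φ.1 ∘ₗ g, by
          obtain ⟨h, hh, hφ⟩ := φ.2
          rw [mem_rankOne]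
          have h5 : (φ.1 ∘ₗ (g : E →ₗ[K] E)).smulRight (g x) = h := by
            ext y
            rw [← hT h y]
            exact (congrArg (fun k => k (g y)) hφ).symm
          rw [h5]
          exact hh⟩
        map_add' := fun f g => by ext; simp
        map_smul' := fun c f => by ext; simp }
    refine LinearMap.finrank_le_finrank_of_injective (f := L) ?_
    rintro ⟨φ, hφ⟩ ⟨ψ, hψ⟩ h
    have h4 : φ ∘ₗ (g : E →ₗ[K] E) = ψ ∘ₗ (g : E →ₗ[K] E) := congrArg Subtype.val h
    ext y
    obtain ⟨y, rfl⟩ := g.surjective y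
    exact congrArg (fun k => k y) h4
  rw [h2] at h1
  omega

variable [FiniteDimensional K E]

theorem card_stab_mul (V : Submodule K (End K E)) (v : E) :
    Nat.card (stab V v) * Nat.card K ^ finrank K (orbit V v) = Nat.card V := by
  rw [Module.natCard_eq_pow_finrank (K := K) (V := stab V v),
    Module.natCard_eq_pow_finrank (K := K) (V := V), ← pow_add, add_comm,
    finrank_orbit_add_stab]

omit [FiniteDimensional K E] in
theorem card_filter_ne_zero [Fintype E] (G : Submodule K E)
    [DecidablePred fun v : E => v ≠ 0 ∧ v ∈ G] [Module.Finite K G] :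
    (Finset.univ.filter fun v : E => v ≠ 0 ∧ v ∈ G).card + 1 = Nat.card K ^ finrank K G := by
  classical
  rw [← Module.natCard_eq_pow_finrank (K := K) (V := G)]
  have h1 : insert 0 (Finset.univ.filter fun v : E => v ≠ 0 ∧ v ∈ G) =
      Finset.univ.filter fun v => v ∈ G := by
    ext v
    by_cases hv : v = 0 <;> simp [hv]
  have h2 : (0 : E) ∉ Finset.univ.filter fun v : E => v ≠ 0 ∧ v ∈ G := by simp
  rw [← Finset.card_insert_of_notMem h2, h1, ← Fintype.card_subtype, ← Nat.card_eq_fintype_card]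

variable [Finite K]

theorem IsTS.card_le_sum_stab {V : Submodule K (End K E)} (hV : IsTS V) {x : E} (hx : x ≠ 0)
    (S : Finset E) (hS : ∀ v, v ∈ S ↔ v ≠ 0 ∧ ∀ φ ∈ rankOne V x, φ v = 0) :
    (Nat.card K - 1) * Nat.card V ≤ ∑ v ∈ S, Nat.card (stab V v) := by
  classical
  have : Finite E := Module.finite_of_finite K
  have : Finite (End K E) := Module.finite_of_finite K
  have : Fintype K := Fintype.ofFinite K
  have : Fintype V := Fintype.ofFinite V
  let Ψ : Kˣ × V → E := fun p => (oneAdd hV p.2.2).symm ((p.1 : K) • x)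
  have hΨ : ∀ p v, Ψ p = v → v + p.2.1 v = (p.1 : K) • x := by
    rintro p v rfl
    rw [← oneAdd_apply hV p.2.2, LinearEquiv.apply_symm_apply]
  have hno : ∀ p v, Ψ p = v → v ≠ 0 ∧ x ∉ orbit V v := by
    intro p v hp
    have h1 := hΨ p v hp
    have hv : v ≠ 0 := by
      rintro rfl
      rw [map_zero, zero_add, eq_comm, smul_eq_zero] at h1
      exact h1.elim p.1.ne_zero hx
    refine ⟨hv, fun h => ?_⟩
    obtain ⟨f, hf, hfx⟩ := mem_orbit.1 h
    refine hv (hV ((p.1 : K) • f - p.2.1) (V.sub_mem (V.smul_mem _ hf) p.2.2) v ?_)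
    rw [LinearMap.sub_apply, LinearMap.smul_apply, hfx, ← h1]
    abel
  have hmaps : ∀ p ∈ (Finset.univ : Finset (Kˣ × V)), Ψ p ∈ S := by
    intro p _
    obtain ⟨h1, h2⟩ := hno p _ rfl
    refine (hS _).2 ⟨h1, fun φ hφ => ?_⟩
    by_contra h
    refine h2 (mem_orbit.2 ⟨(φ (Ψ p))⁻¹ • φ.smulRight x, V.smul_mem _ hφ, ?_⟩)
    simp [smul_smul, h]
  have hcard := Finset.card_eq_sum_card_fiberwise hmaps
  have hl : (Finset.univ : Finset (Kˣ × V)).card = (Nat.card K - 1) * Nat.card V := by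
    rw [Finset.card_univ, Fintype.card_prod, Fintype.card_units, Nat.card_eq_fintype_card,
      Nat.card_eq_fintype_card]
  rw [← hl, hcard]
  refine Finset.sum_le_sum fun v _ => ?_
  by_cases hne : ∃ p, Ψ p = v
  · obtain ⟨p, hp⟩ := hne
    have hc : ∀ p', Ψ p' = v → p'.1 = p.1 := by
      intro p' hp'
      by_contra hcc
      have h3 := hΨ p v hp
      have h4 := hΨ p' v hp'
      have hcc' : (p'.1 : K) - p.1 ≠ 0 := sub_ne_zero.2 fun h => hcc (Units.ext h)
      refine (hno p v hp).2 (mem_orbit.2 ⟨((p'.1 : K) - p.1)⁻¹ • (p'.2.1 - p.2.1),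
        V.smul_mem _ (V.sub_mem p'.2.2 p.2.2), ?_⟩)
      rw [LinearMap.smul_apply, LinearMap.sub_apply, inv_smul_eq_iff₀ hcc', sub_smul, ← h3, ← h4]
      abel
    rw [← Nat.card_eq_finsetCard]
    refine Nat.card_le_card_of_injective
      (fun p' => (⟨p'.1.2.1 - p.2.1, ?_⟩ : stab V v)) ?_
    · have hp' := (Finset.mem_filter.1 p'.2).2
      refine mem_stab.2 ⟨V.sub_mem p'.1.2.2 p.2.2, ?_⟩
      have h3 := hΨ p v hp
      have h4 := hΨ p'.1 v hp'
      rw [hc _ hp', ← h3] at h4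
      rw [LinearMap.sub_apply, sub_eq_zero]
      exact add_left_cancel h4
    · intro p₁ p₂ h
      have h1 := congrArg Subtype.val h
      ext1
      refine Prod.ext ?_ (Subtype.ext (sub_left_injective h1))
      rw [hc _ (Finset.mem_filter.1 p₁.2).2, hc _ (Finset.mem_filter.1 p₂.2).2]
  · have : Finset.filter (fun a => Ψ a = v) Finset.univ = ∅ := by
      rw [Finset.filter_eq_empty_iff]
      exact fun p _ h => hne ⟨p, h⟩
    rw [this]
    simp

theorem counting_aux {q e a b : ℕ} (hq : 3 ≤ q) (h1 : (q - 1) * q ^ (e + 1) ≤ q * a + b)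
    (h2 : a + b + 1 = q ^ (e + 1)) : q ^ e < a + 1 := by
  by_contra! h
  obtain ⟨s, rfl⟩ : ∃ s, q = s + 3 := ⟨q - 3, by omega⟩
  have h3 : s + 3 - 1 = s + 2 := by omega
  rw [h3] at h1
  rw [pow_succ] at h1 h2
  nlinarith [Nat.zero_le (s * (s + 3) ^ e), Nat.zero_le (s * a), Nat.zero_le (s * s * (s + 3) ^ e)]

theorem IsMax.exists_invariant_of_rankOne_ne_bot (hK : 3 ≤ Nat.card K)
    {V : Submodule K (End K E)} (hV : IsMax V) (h : ∃ x ≠ 0, rankOne V x ≠ ⊥) :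
    ∃ G : Submodule K E, Invariant V G ∧ G ≠ ⊥ ∧ G ≠ ⊤ := by
  classical
  have : Finite E := Module.finite_of_finite K
  have : Finite (End K E) := Module.finite_of_finite K
  have : Fintype E := Fintype.ofFinite E
  have : Nonempty V := ⟨0⟩
  obtain ⟨y, hy, hyR⟩ := h
  obtain ⟨x₀, hx₀, hmax⟩ := Set.exists_max_image {x : E | x ≠ 0}
    (fun x => finrank K (rankOne V x)) (Set.toFinite _) ⟨y, hy⟩
  set r := finrank K (rankOne V x₀) with hr
  have hr0 : 0 < r :=
    (Nat.pos_of_ne_zero fun h => hyR (Submodule.finrank_eq_zero.1 h)).trans_le (hmax y hy)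
  let D : Finset E := Finset.univ.filter fun v => v ≠ 0 ∧ finrank K (rankOne V v) = r
  have hD : ∀ v, v ∈ D ↔ v ≠ 0 ∧ finrank K (rankOne V v) = r := fun v => by simp [D]
  obtain ⟨x, hxD, hxs⟩ := hV.1.exists_sink D ⟨x₀, (hD _).2 ⟨hx₀, rfl⟩⟩
  obtain ⟨hx, hxr⟩ := (hD x).1 hxD
  set G := (rankOne V x).dualCoannihilator with hG
  have hGmem : ∀ v, v ∈ G ↔ ∀ φ ∈ rankOne V x, φ v = 0 := fun v =>
    Submodule.mem_dualCoannihilator v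
  have hGr : r + finrank K G = finrank K E := by
    rw [← hxr]; exact Subspace.finrank_add_finrank_dualCoannihilator_eq _
  have hDG : ∀ v ∈ D, v ∈ G := fun v hv => (hGmem v).2 fun φ hφ => hxs φ hφ v hv
  have hGne : G ≠ ⊥ := fun h => hx ((Submodule.eq_bot_iff _).1 h x (hDG x hxD))
  have hGtop : G ≠ ⊤ := fun h => by
    rw [h, finrank_top] at hGr
    omega
  obtain ⟨e, he⟩ : ∃ e, finrank K G = e + 1 := by
    have : finrank K G ≠ 0 := fun h => hGne (Submodule.finrank_eq_zero.1 h)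
    exact ⟨finrank K G - 1, by omega⟩
  have horb : ∀ v, v ≠ 0 → e ≤ finrank K (orbit V v) := by
    intro v hv
    have h1 := hV.le_orbit_add_rankOne hv
    have h2 : finrank K (rankOne V v) ≤ r := hmax v hv
    omega
  let S : Finset E := Finset.univ.filter fun v => v ≠ 0 ∧ v ∈ G
  let C : Finset E := S.filter fun v => finrank K (orbit V v) = e
  have hS : ∀ v, v ∈ S ↔ v ≠ 0 ∧ v ∈ G := fun v => by simp [S]
  have hC : ∀ v, v ∈ C ↔ (v ≠ 0 ∧ v ∈ G) ∧ finrank K (orbit V v) = e := fun v => by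
    simp only [C, Finset.mem_filter, hS]
  have hcount := hV.1.card_le_sum_stab hx S (fun v => by rw [hS, hGmem])
  have hScard : S.card + 1 = Nat.card K ^ (e + 1) := by
    rw [← he]; exact card_filter_ne_zero G
  have hsplit : C.card +
      (S.filter fun v => ¬ finrank K (orbit V v) = e).card = S.card :=
    Finset.card_filter_add_card_filter_not _
  set q := Nat.card K with hq
  have hineq : (q - 1) * q ^ (e + 1) ≤ q * C.card +
      (S.filter fun v => ¬ finrank K (orbit V v) = e).card := by
    have hVpos : 0 < Nat.card V := Nat.card_pos
    refine Nat.le_of_mul_le_mul_right (c := Nat.card V) ?_ hVpos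
    calc (q - 1) * q ^ (e + 1) * Nat.card V = (q - 1) * Nat.card V * q ^ (e + 1) := by ring
      _ ≤ (∑ v ∈ S, Nat.card (stab V v)) * q ^ (e + 1) := Nat.mul_le_mul_right _ hcount
      _ = ∑ v ∈ S, Nat.card (stab V v) * q ^ (e + 1) := Finset.sum_mul _ _ _
      _ ≤ ∑ v ∈ S, (if finrank K (orbit V v) = e then q * Nat.card V else Nat.card V) := by
          refine Finset.sum_le_sum fun v hv => ?_
          have h1 := card_stab_mul V v
          split_ifs with h
          · rw [h] at h1
            rw [← h1, pow_succ]
            exact le_of_eq (by ring)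
          · have h2 := horb v ((hS v).1 hv).1
            rw [← h1]
            exact Nat.mul_le_mul_left _ (Nat.pow_le_pow_right (by omega) (by omega))
      _ = _ := by
          rw [Finset.sum_ite, Finset.sum_const, Finset.sum_const, smul_eq_mul, smul_eq_mul]
          ring
  have hCcard := counting_aux hK hineq (by omega)
  have hspan : Submodule.span K (C : Set E) = G := by
    have hle : Submodule.span K (C : Set E) ≤ G :=
      Submodule.span_le.2 fun v hv => ((hC v).1 hv).1.2
    refine Submodule.eq_of_le_of_finrank_le hle ?_
    by_contra! hlt
    have h1 : C.card + 1 ≤ Nat.card (Submodule.span K (C : Set E)) := by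
      have h2 : (0 : E) ∉ C := by simp [hC]
      rw [← Finset.card_insert_of_notMem h2, ← Nat.card_eq_finsetCard]
      refine Nat.card_le_card_of_injective
        (fun v => (⟨v.1, ?_⟩ : Submodule.span K (C : Set E))) ?_
      · rcases Finset.mem_insert.1 v.2 with h | h
        · rw [h]; exact zero_mem _
        · exact Submodule.subset_span h
      · intro v w h
        exact Subtype.ext (congrArg (fun z : Submodule.span K (C : Set E) => (z : E)) h)
    rw [Module.natCard_eq_pow_finrank (K := K), ← hq] at h1
    have h3 : q ^ finrank K (Submodule.span K (C : Set E)) ≤ q ^ e :=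
      Nat.pow_le_pow_right (by omega) (by omega)
    omega
  refine ⟨G, ?_, hGne, hGtop⟩
  intro f hf v hv
  rw [← hspan] at hv
  induction hv using Submodule.span_induction with
  | mem v hv =>
    obtain ⟨⟨hv0, hvG⟩, hve⟩ := (hC v).1 hv
    have h1 := hV.le_orbit_add_rankOne_translate hf hv0
    have h2 : v + f v ≠ 0 := by
      rw [← oneAdd_apply hV.1 hf]
      simpa using hv0
    have h3 : finrank K (rankOne V (v + f v)) ≤ r := hmax _ h2
    have h4 := hDG _ ((hD _).2 ⟨h2, by omega⟩)
    simpa using G.sub_mem h4 hvG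
  | zero => simp
  | add v w _ _ h1 h2 => rw [map_add]; exact G.add_mem h1 h2
  | smul c v _ h => rw [map_smul]; exact G.smul_mem c h

end Counting

section Three

theorem det_add_smul_fin_three {K : Type*} [CommRing K] (M N : Matrix (Fin 3) (Fin 3) K) (s : K) :
    (M + s • N).det = M.det + s * (M.adjugate * N).trace + s ^ 2 * (N.adjugate * M).trace +
      s ^ 3 * N.det := by
  simp only [det_fin_three, adjugate_fin_three, trace_fin_three, mul_apply, Fin.sum_univ_three,
    Matrix.add_apply, Matrix.smul_apply, smul_eq_mul, of_apply, cons_val]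
  ring

theorem adjugate_eq_fin_three {K : Type*} [CommRing K] (M : Matrix (Fin 3) (Fin 3) K) :
    M.adjugate = M * M - M.trace • M + M.adjugate.trace • 1 := by
  ext i j
  fin_cases i <;> fin_cases j <;>
  simp [adjugate_fin_three, trace_fin_three, mul_apply, Fin.sum_univ_three] <;> ring

theorem trace_adjugate_fin_three {K : Type*} [CommRing K] (M : Matrix (Fin 3) (Fin 3) K) :
    M.adjugate.trace = M 1 1 * M 2 2 - M 1 2 * M 2 1 + (M 0 0 * M 2 2 - M 0 2 * M 2 0) +
      (M 0 0 * M 1 1 - M 0 1 * M 1 0) := by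
  simp [adjugate_fin_three, trace_fin_three]

open MvPolynomial in
theorem exists_trace_adjugate_eq_zero {K : Type*} [Field K] [Finite K]
    (W : Submodule K (Matrix (Fin 3) (Fin 3) K)) (hW : finrank K W = 3) :
    ∃ M ∈ W, M ≠ 0 ∧ M.adjugate.trace = 0 := by
  classical
  have : Fintype K := Fintype.ofFinite K
  let b := Module.finBasisOfFinrankEq K W hW
  let A : Fin 3 → Fin 3 → MvPolynomial (Fin 3) K := fun i j =>
    ∑ k, C ((b k : Matrix (Fin 3) (Fin 3) K) i j) * X k
  have hA : ∀ i j, (A i j).totalDegree ≤ 1 := by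
    refine fun i j => totalDegree_finsetSum_le fun k _ => (totalDegree_mul _ _).trans ?_
    rw [totalDegree_C, totalDegree_X]
  have hmul : ∀ i j i' j', (A i j * A i' j').totalDegree ≤ 2 := fun i j i' j' =>
    (totalDegree_mul _ _).trans (Nat.add_le_add (hA i j) (hA i' j'))
  have hminor : ∀ i j i' j' k l k' l',
      (A i j * A i' j' - A k l * A k' l').totalDegree ≤ 2 := fun i j i' j' k l k' l' =>
    (totalDegree_sub _ _).trans (max_le (hmul _ _ _ _) (hmul _ _ _ _))
  let f : MvPolynomial (Fin 3) K := A 1 1 * A 2 2 - A 1 2 * A 2 1 +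
    (A 0 0 * A 2 2 - A 0 2 * A 2 0) + (A 0 0 * A 1 1 - A 0 1 * A 1 0)
  have hf : f.totalDegree ≤ 2 := (totalDegree_add _ _).trans (max_le
    ((totalDegree_add _ _).trans (max_le (hminor ..) (hminor ..))) (hminor ..))
  have heval : ∀ t : Fin 3 → K, eval t f =
      ((b.equivFun.symm t : W) : Matrix (Fin 3) (Fin 3) K).adjugate.trace := by
    intro t
    have hAt : ∀ i j, eval t (A i j) =
        ((b.equivFun.symm t : W) : Matrix (Fin 3) (Fin 3) K) i j := by
      intro i j
      simp only [A, map_sum, map_mul, eval_C, eval_X, Basis.equivFun_symm_apply,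
        Submodule.coe_sum, Submodule.coe_smul, Matrix.sum_apply, Matrix.smul_apply, smul_eq_mul]
      exact Finset.sum_congr rfl fun k _ => mul_comm _ _
    rw [trace_adjugate_fin_three]
    simp only [f, map_add, map_sub, map_mul, hAt]
  obtain ⟨p, hp⟩ := CharP.exists K
  have hdvd := char_dvd_card_solutions p (f := f) (by rw [Fintype.card_fin]; omega)
  have hp2 := CharP.char_is_prime K p
  let z : { x // (eval x) f = 0 } := ⟨0, by rw [heval]; simp⟩
  have h1 : 1 < Fintype.card { x // (eval x) f = 0 } :=
    hp2.one_lt.trans_le (Nat.le_of_dvd (Fintype.card_pos_iff.2 ⟨z⟩) hdvd)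
  obtain ⟨t, ht⟩ := Fintype.exists_ne_of_one_lt_card h1 z
  refine ⟨(b.equivFun.symm t.1 : W), (b.equivFun.symm t.1).2, ?_, by rw [← heval, t.2]⟩
  intro h
  refine ht (Subtype.ext ?_)
  exact b.equivFun.symm.map_eq_zero_iff.1 (Subtype.ext h)

theorem exists_ne_zero_ne_one {K : Type*} [Field K] (hK : 3 ≤ Nat.card K) :
    ∃ c : K, c ≠ 0 ∧ c ≠ 1 := by
  classical
  have : Finite K := Nat.finite_of_card_ne_zero (by omega)
  have : Fintype K := Fintype.ofFinite K
  obtain ⟨c, hc⟩ : ∃ c : K, c ∉ ({0, 1} : Finset K) := by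
    by_contra! h
    have h1 := Finset.card_le_card (fun x _ => h x : (Finset.univ : Finset K) ⊆ {0, 1})
    rw [Finset.card_univ, ← Nat.card_eq_fintype_card] at h1
    have h2 := Finset.card_le_two (a := (0 : K)) (b := 1)
    omega
  exact ⟨c, by simpa only [Finset.mem_insert, Finset.mem_singleton, not_or] using hc⟩

theorem trace_adjugate_mul_eq_zero {K : Type*} [Field K] (hK : 3 ≤ Nat.card K)
    (W : Submodule K (Matrix (Fin 3) (Fin 3) K)) (hdet : ∀ M ∈ W, M.det = 0)
    {M N : Matrix (Fin 3) (Fin 3) K} (hM : M ∈ W) (hN : N ∈ W) :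
    (M.adjugate * N).trace = 0 := by
  obtain ⟨c, hc⟩ := exists_ne_zero_ne_one hK
  have key : ∀ s : K, s * (M.adjugate * N).trace + s ^ 2 * (N.adjugate * M).trace = 0 := by
    intro s
    have := det_add_smul_fin_three M N s
    rw [hdet _ hM, hdet _ hN, hdet _ (W.add_mem hM (W.smul_mem s hN))] at this
    linear_combination -this
  have h1 := key 1
  have h2 := key c
  have h3 : (c * (1 - c)) * (M.adjugate * N).trace = 0 := by
    linear_combination h2 - c ^ 2 * h1
  exact (mul_eq_zero.1 h3).resolve_left (mul_ne_zero hc.1 (sub_ne_zero.2 (Ne.symm hc.2)))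

variable {K E : Type*} [Field K] [AddCommGroup E] [Module K E] [FiniteDimensional K E]

theorem exists_smulRight_of_range_le {f : End K E} {G : Submodule K E}
    (hG : finrank K G ≤ 1) (hf : LinearMap.range f ≤ G) (hf0 : f ≠ 0) :
    ∃ x ∈ G, x ≠ 0 ∧ ∃ φ : Dual K E, φ ≠ 0 ∧ f = φ.smulRight x := by
  obtain ⟨x, hx⟩ := finrank_le_one_iff.1 hG
  have hx0 : (x : E) ≠ 0 := by
    intro h
    apply hf0
    ext v
    obtain ⟨c, hc⟩ := hx ⟨f v, hf ⟨v, rfl⟩⟩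
    have := congrArg Subtype.val hc
    simpa [h] using this.symm
  obtain ⟨l, hl⟩ := Projective.exists_dual_eq_one K hx0
  have hfl : f = (l ∘ₗ f).smulRight (x : E) := by
    ext v
    obtain ⟨c, hc⟩ := hx ⟨f v, hf ⟨v, rfl⟩⟩
    have h1 : c • (x : E) = f v := congrArg Subtype.val hc
    simp [← h1, hl]
  refine ⟨x, x.2, hx0, l ∘ₗ f, ?_, hfl⟩
  intro h
  rw [h] at hfl
  exact hf0 (hfl.trans (by ext; simp))

theorem finrank_ker_le_one_of_three {V : Submodule K (End K E)}
    (hn : finrank K E = 3) (h : ∀ x ≠ 0, rankOne V x = ⊥) {f : End K E} (hf : f ∈ V)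
    (hf0 : f ≠ 0) : finrank K (LinearMap.ker f) ≤ 1 := by
  by_contra! hlt
  have h1 := LinearMap.finrank_range_add_finrank_ker f
  obtain ⟨x, -, hx, φ, hφ, rfl⟩ := exists_smulRight_of_range_le (f := f)
    (G := LinearMap.range f) (by omega) le_rfl hf0
  have h2 : φ ∈ rankOne V x := hf
  rw [h x hx] at h2
  exact hφ h2

variable [Finite K]

theorem IsMax.ker_ne_bot_of_three {V : Submodule K (End K E)}
    (hV : IsMax V) (hn : finrank K E = 3) (h : ∀ x ≠ 0, rankOne V x = ⊥) {f : End K E}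
    (hf : f ∈ V) : LinearMap.ker f ≠ ⊥ := by
  classical
  have : Finite E := Module.finite_of_finite K
  have : Finite (End K E) := Module.finite_of_finite K
  have : Fintype E := Fintype.ofFinite E
  have : Fintype (End K E) := Fintype.ofFinite _
  intro hf0
  have hVdim : finrank K V = 3 := by rw [hV.2, hn]; rfl
  have hstab : ∀ x : E, x ≠ 0 → finrank K (stab V x) = 1 := by
    intro x hx
    have h1 := hV.le_orbit_add_rankOne hx
    rw [h x hx, finrank_bot] at h1
    have h2 := finrank_orbit_lt hV.1 hx
    have h3 := finrank_orbit_add_stab V x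
    omega
  set q := Nat.card K with hq
  have hq1 : 1 < q := Finite.one_lt_card
  let SE : Finset E := Finset.univ.filter fun x => x ≠ 0 ∧ x ∈ (⊤ : Submodule K E)
  let SV : Finset (End K E) := Finset.univ.filter fun g => g ≠ 0 ∧ g ∈ V
  have hSE : SE.card + 1 = q ^ 3 := by
    rw [← hn, ← finrank_top K E]; exact card_filter_ne_zero _
  have hSV : SV.card + 1 = q ^ 3 := by rw [← hVdim]; exact card_filter_ne_zero _
  have habove : ∀ x ∈ SE, (Finset.bipartiteAbove (fun x g => g x = 0) SV x).card = q - 1 := by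
    intro x hx
    have h1 := card_filter_ne_zero (stab V x)
    rw [hstab x (Finset.mem_filter.1 hx).2.1, pow_one] at h1
    have h2 : Finset.bipartiteAbove (fun x g => g x = 0) SV x =
        Finset.univ.filter fun g : End K E => g ≠ 0 ∧ g ∈ stab V x := by
      ext g
      simp [Finset.bipartiteAbove, SV, mem_stab, and_assoc]
    rw [h2]
    omega
  have hbelow : ∀ g : End K E, (Finset.bipartiteBelow (fun x g => g x = 0) SE g).card + 1 =
      q ^ finrank K (LinearMap.ker g) := by
    intro g
    rw [hq, ← card_filter_ne_zero (LinearMap.ker g)]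
    congr 2
    ext x
    simp [Finset.bipartiteBelow, SE]
  have hfne : f ≠ 0 := by
    rintro rfl
    rw [LinearMap.ker_zero] at hf0
    have h1 := finrank_top K E
    rw [hf0, finrank_bot] at h1
    omega
  have hsum := Finset.sum_card_bipartiteAbove_eq_sum_card_bipartiteBelow
    (fun (x : E) (g : End K E) => g x = 0) (s := SE) (t := SV)
  rw [Finset.sum_congr rfl habove, Finset.sum_const] at hsum
  have hlt : ∑ g ∈ SV, (Finset.bipartiteBelow (fun x g => g x = 0) SE g).card <
      ∑ g ∈ SV, (q - 1) := by
    refine Finset.sum_lt_sum (fun g hg => ?_) ⟨f, by simp [SV, hfne, hf], ?_⟩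
    · have h1 := hbelow g
      obtain ⟨-, hg0, hgV⟩ := Finset.mem_filter.1 hg
      have h2 := finrank_ker_le_one_of_three hn h hgV hg0
      have h3 : q ^ finrank K (LinearMap.ker g) ≤ q ^ 1 := Nat.pow_le_pow_right (by omega) h2
      rw [pow_one] at h3
      omega
    · have h1 := hbelow f
      rw [hf0, finrank_bot, pow_zero] at h1
      omega
  rw [Finset.sum_const, ← hsum] at hlt
  have : SE.card = SV.card := by omega
  rw [this] at hlt
  exact lt_irrefl _ hlt

theorem IsMax.exists_rankOne_ne_bot_of_three (hK : 3 ≤ Nat.card K) {V : Submodule K (End K E)}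
    (hV : IsMax V) (hn : finrank K E = 3) : ∃ x ≠ 0, rankOne V x ≠ ⊥ := by
  by_contra! h
  have hVdim : finrank K V = 3 := by rw [hV.2, hn]; rfl
  have hker : ∀ f ∈ V, f ≠ 0 → finrank K (LinearMap.ker f) ≤ 1 :=
    fun f hf hf0 => finrank_ker_le_one_of_three hn h hf hf0
  let b := Module.finBasisOfFinrankEq K E hn
  let T := LinearMap.toMatrixAlgEquiv b
  let W : Submodule K (Matrix (Fin 3) (Fin 3) K) := V.map (T.toLinearEquiv : End K E →ₗ[K] _)
  have hTW : ∀ f ∈ V, T f ∈ W := fun f hf => ⟨f, hf, rfl⟩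
  have hWdim : finrank K W = 3 := by
    exact (LinearEquiv.finrank_map_eq T.toLinearEquiv V).trans hVdim
  have hdet : ∀ M ∈ W, M.det = 0 := by
    rintro _ ⟨f, hf, rfl⟩
    have h1 := LinearMap.det_eq_zero_iff_ker_ne_bot.2 (hV.ker_ne_bot_of_three hn h hf)
    rw [← LinearMap.det_toMatrix b] at h1
    exact h1
  obtain ⟨_, ⟨f, hf, rfl⟩, hM0, hM⟩ := exists_trace_adjugate_eq_zero W hWdim
  have hf0 : f ≠ 0 := by rintro rfl; simp at hM0
  change (T f).adjugate.trace = 0 at hM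
  set a : End K E := f * f - (T f).trace • f with ha
  have hTa : T a = (T f).adjugate := by
    rw [adjugate_eq_fin_three, hM, ha]
    simp
  have hfa : f * a = 0 := by
    apply T.injective
    rw [map_mul, hTa, Matrix.mul_adjugate, hdet _ (hTW f hf), zero_smul, map_zero]
  have htr : ∀ g : End K E, LinearMap.trace K E g = (T g).trace := fun g =>
    LinearMap.trace_eq_matrix_trace K b g
  have hrange : LinearMap.range a ≤ LinearMap.ker f := by
    rintro _ ⟨v, rfl⟩
    exact congrArg (fun g : End K E => g v) hfa
  have ha0 : a ≠ 0 := by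
    intro ha0
    rw [ha, sub_eq_zero] at ha0
    by_cases ht : (T f).trace = 0
    · rw [ht, zero_smul] at ha0
      have h1 : LinearMap.range f ≤ LinearMap.ker f := by
        rintro _ ⟨v, rfl⟩
        exact congrArg (fun g : End K E => g v) ha0
      have h2 := Submodule.finrank_mono h1
      have h3 := LinearMap.finrank_range_add_finrank_ker f
      have h4 := hker f hf hf0
      omega
    · apply hf0
      ext v
      refine hV.1 _ (V.smul_mem (T f).trace⁻¹ hf) (f v) ?_
      have h1 : f (f v) = (T f).trace • f v := congrArg (fun g : End K E => g v) ha0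
      rw [LinearMap.smul_apply, h1, smul_smul, inv_mul_cancel₀ ht, one_smul]
  obtain ⟨x, -, hx, φ, hφ, hax⟩ := exists_smulRight_of_range_le (hker f hf hf0) hrange ha0
  have hφx : φ x = 0 := by
    rw [← LinearMap.trace_smulRight, ← hax, htr, hTa, hM]
  have hφV : orbit V x ≤ LinearMap.ker φ := by
    intro y hy
    obtain ⟨g, hg, rfl⟩ := mem_orbit.1 hy
    have h1 := trace_adjugate_mul_eq_zero hK W hdet (hTW f hf) (hTW g hg)
    rw [← hTa, ← map_mul, ← htr, hax] at h1
    have h2 : φ.smulRight x * g = (φ ∘ₗ g).smulRight x := by ext; simp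
    rw [h2, LinearMap.trace_smulRight] at h1
    exact h1
  have h1 := hV.le_orbit_add_rankOne hx
  rw [h x hx, finrank_bot] at h1
  have h2 := Module.Dual.finrank_ker_add_one_of_ne_zero hφ
  have h3 := Submodule.eq_of_le_of_finrank_le hφV (by omega)
  exact hV.1.notMem_orbit hx (h3 ▸ hφx)

end Three

section RankOneFree

variable {K E : Type*} [Field K] [AddCommGroup E] [Module K E] [FiniteDimensional K E]

theorem IsMax.mem_span_of_dual {V : Submodule K (End K E)} (hV : IsMax V)
    (h : ∀ x ≠ 0, rankOne V x = ⊥) {θ : Dual K E} (hθ : θ ≠ 0) {v w : E} (hv0 : v ≠ 0)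
    (hv : ∀ f ∈ V, θ (f v) = 0) (hw : ∀ f ∈ V, θ (f w) = 0) : w ∈ K ∙ v := by
  let L : End K E →ₗ[K] Dual K E :=
    { toFun := fun f => θ ∘ₗ f
      map_add' := fun f g => by ext; simp
      map_smul' := fun c f => by ext; simp }
  set B : Submodule K (End K E) := V ⊓ LinearMap.ker L with hB
  have hdim : finrank K (V.map L) + finrank K B = finrank K V :=
    finrank_map_add_finrank_inf_ker L V
  have hBθ : ∀ f ∈ B, ∀ y, θ (f y) = 0 := fun f hf y =>
    congrArg (fun φ : Dual K E => φ y) (LinearMap.mem_ker.1 hf.2)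
  have hinv : Invariant B (LinearMap.ker θ) := fun f hf y _ => hBθ f hf y
  have hker := Module.Dual.finrank_ker_add_one_of_ne_zero hθ
  have h1 := finrank_le_res_add_quo hinv
  have h2 : finrank K (res B (LinearMap.ker θ)) ≤ (finrank K (LinearMap.ker θ)).choose 2 :=
    ((hV.1.mono (inf_le_left : B ≤ V)).res (LinearMap.ker θ)).finrank_le
  have h3 : quo B (LinearMap.ker θ) = ⊥ := by
    rw [eq_bot_iff]
    rintro g ⟨f, hf, hg⟩
    rw [Submodule.mem_bot]
    ext y
    have h4 : f y ∈ LinearMap.ker θ := hBθ f hf y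
    rw [← Submodule.ker_mkQ (LinearMap.ker θ), LinearMap.mem_ker] at h4
    rw [LinearMap.comp_apply, hg, h4]
    simp
  have h4 : B ⊓ nilp (LinearMap.ker θ) = ⊥ := by
    rw [eq_bot_iff]
    rintro f ⟨hf, hf1, hf2⟩
    rw [Submodule.mem_bot]
    by_contra hf0
    have h5 := LinearMap.finrank_range_add_finrank_ker f
    have h6 : finrank K (LinearMap.ker θ) ≤ finrank K (LinearMap.ker f) :=
      Submodule.finrank_mono fun y hy => hf1 y hy
    obtain ⟨x, -, hx, φ, hφ, rfl⟩ := exists_smulRight_of_range_le (f := f)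
      (G := LinearMap.range f) (by omega) le_rfl hf0
    have h7 : φ ∈ rankOne V x := hf.1
    rw [h x hx] at h7
    exact hφ h7
  rw [h3, h4, finrank_bot, finrank_bot] at h1
  rw [hV.2, ← hker, choose_two_succ] at hdim
  have h5 : V.map L ≤ (Submodule.span K {v, w}).dualAnnihilator := by
    rintro _ ⟨f, hf, rfl⟩
    rw [Submodule.mem_dualAnnihilator]
    intro y hy
    have h6 : Submodule.span K {v, w} ≤ LinearMap.ker (θ ∘ₗ f) := by
      rw [Submodule.span_le]
      rintro y (rfl | rfl)
      · exact hv f hf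
      · exact hw f hf
    exact h6 hy
  have h6 := Submodule.finrank_mono h5
  have h7 := Subspace.finrank_add_finrank_dualAnnihilator_eq (Submodule.span K {v, w})
  have h8 : (K ∙ v) = Submodule.span K {v, w} := by
    refine Submodule.eq_of_le_of_finrank_le (Submodule.span_mono (by simp)) ?_
    rw [finrank_span_singleton hv0]
    omega
  rw [h8]
  exact Submodule.subset_span (by simp)

theorem IsMax.exists_normal {V : Submodule K (End K E)} (hV : IsMax V)
    (h : ∀ x ≠ 0, rankOne V x = ⊥) :
    ∃ ν : E → Dual K E, Function.Injective ν ∧ ν 0 = 0 ∧ (∀ v ≠ 0, ν v v = 1) ∧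
      ∀ v, ∀ f ∈ V, ν v (f v) = 0 := by
  have hex : ∀ v : E, ∃ φ : Dual K E, (v = 0 → φ = 0) ∧ (v ≠ 0 → φ v = 1) ∧
      ∀ f ∈ V, φ (f v) = 0 := by
    intro v
    by_cases hv : v = 0
    · exact ⟨0, by simp [hv]⟩
    obtain ⟨φ, hφ, hφV⟩ := Submodule.exists_dual_map_eq_bot_of_notMem
      (hV.1.notMem_orbit hv) inferInstance
    refine ⟨(φ v)⁻¹ • φ, fun h => absurd h hv, fun _ => by simp [hφ], fun f hf => ?_⟩
    have h1 : φ (f v) ∈ (orbit V v).map φ := ⟨f v, mem_orbit.2 ⟨f, hf, rfl⟩, rfl⟩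
    rw [hφV, Submodule.mem_bot] at h1
    simp [h1]
  choose ν h0 h1 hf using hex
  refine ⟨ν, ?_, h0 0 rfl, h1, hf⟩
  have hne : ∀ v, v ≠ 0 → ν v ≠ 0 := fun v hv h2 => by
    have := h1 v hv
    simp [h2] at this
  intro v w hvw
  by_cases hv : v = 0
  · subst hv
    by_contra hw
    exact hne w (Ne.symm hw) (by rw [← hvw, h0 0 rfl])
  have hw : w ≠ 0 := by
    rintro rfl
    exact hne v hv (by rw [hvw, h0 0 rfl])
  obtain ⟨c, rfl⟩ := Submodule.mem_span_singleton.1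
    (hV.mem_span_of_dual h (hne v hv) hv (hf v) (by rw [hvw]; exact hf w))
  have h2 := h1 _ hw
  rw [← hvw, map_smul, h1 v hv, smul_eq_mul, mul_one] at h2
  rw [h2, one_smul]

theorem IsMax.quo_stab {V : Submodule K (End K E)} (hV : IsMax V) {x : E} (hx : x ≠ 0)
    (h : rankOne V x = ⊥) : IsMax (quo (stab V x) (K ∙ x)) := by
  have h1 := (hV.1.quo_stab x)
  have h2 := h1.finrank_le
  refine ⟨h1, le_antisymm h2 ?_⟩
  have h3 := finrank_stab_le V hx
  rw [h, finrank_bot] at h3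
  have h4 := finrank_orbit_add_stab V x
  have h5 := finrank_orbit_lt hV.1 hx
  rw [finrank_quotient_span hx]
  obtain ⟨n, hn⟩ : ∃ n, finrank K E = n + 1 := ⟨finrank K E - 1, by omega⟩
  rw [hV.2, hn, choose_two_succ] at h4
  rw [hn, Nat.add_sub_cancel]
  omega

theorem IsMax.normal_vanish {V : Submodule K (End K E)} (hV : IsMax V) {x : E} (hx : x ≠ 0)
    (h : rankOne V x = ⊥) {H : Submodule K (E ⧸ (K ∙ x))}
    (hH : Invariant (quo (stab V x) (K ∙ x)) H) {v : E} {φ : Dual K E}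
    (hφ : ∀ f ∈ V, φ (f v) = 0) (hφx : φ x = 0) (hv : v ∉ H.comap (K ∙ x).mkQ) {z : E}
    (hz : z ∈ H.comap (K ∙ x).mkQ) : φ z = 0 := by
  obtain ⟨α, hα, hαH⟩ := Submodule.exists_dual_map_eq_bot_of_notMem
    (p := H) (x := (K ∙ x).mkQ v) hv inferInstance
  have hαH' : ∀ y ∈ H, α y = 0 := fun y hy => by
    have : α y ∈ H.map α := ⟨y, hy, rfl⟩
    rwa [hαH, Submodule.mem_bot] at this
  have h1 : α.smulRight ((K ∙ x).mkQ z) ∈ nilp H :=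
    ⟨fun y hy => by simp [hαH' y hy], fun y => H.smul_mem _ hz⟩
  obtain ⟨f, hf, hfv⟩ := ((hV.quo_stab hx h).of_invariant hH).1 h1
  have h2 := hfv v
  rw [LinearMap.smulRight_apply, ← map_smul, ← sub_eq_zero, ← map_sub, ← LinearMap.mem_ker,
    Submodule.ker_mkQ] at h2
  obtain ⟨c, hc⟩ := Submodule.mem_span_singleton.1 h2
  have h3 := congrArg φ hc
  rw [map_smul, hφx, map_sub, hφ f (mem_stab.1 hf).1, map_smul, smul_zero, sub_zero, eq_comm,
    smul_eq_zero] at h3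
  exact h3.resolve_left hα

theorem pow_aux {q n f : ℕ} (hq : 3 ≤ q) (hf2 : 2 ≤ f) (hfn : f + 1 ≤ n)
    (h : q ^ (n - 1) + q ≤ q ^ f + q ^ (n - f)) : f + 1 = n := by
  by_contra hne
  have h1 : q ^ f ≤ q ^ (n - 2) := Nat.pow_le_pow_right (by omega) (by omega)
  have h2 : q ^ (n - f) ≤ q ^ (n - 2) := Nat.pow_le_pow_right (by omega) (by omega)
  have h3 : q ^ (n - 1) = q ^ (n - 2) * q := by
    rw [← pow_succ]
    congr 1
    omega
  rw [h3] at h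
  have h4 := Nat.mul_le_mul_left (q ^ (n - 2)) hq
  omega

theorem IsMax.exists_hyperplane [Finite K] (hK : 3 ≤ Nat.card K) {V : Submodule K (End K E)}
    (hV : IsMax V) (h : ∀ x ≠ 0, rankOne V x = ⊥) {ν : E → Dual K E}
    (hinj : Function.Injective ν) (hν0 : ν 0 = 0) (hν1 : ∀ v ≠ 0, ν v v = 1)
    (hν : ∀ v, ∀ f ∈ V, ν v (f v) = 0) {x : E} (hx : x ≠ 0)
    {H : Submodule K (E ⧸ (K ∙ x))} (hH : Invariant (quo (stab V x) (K ∙ x)) H)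
    (hbot : H ≠ ⊥) (htop : H ≠ ⊤) :
    ∃ G : Submodule K E, finrank K G + 1 = finrank K E ∧ x ∈ G ∧
      (∀ v ∈ G, v ∉ (K ∙ x) → ν v x = 0) ∧
      (∀ v ∉ G, ν v x = 0 → ∀ z ∈ G, ν v z = 0) := by
  classical
  have : Finite E := Module.finite_of_finite K
  have : Fintype E := Fintype.ofFinite E
  have : Finite (Dual K E) := Module.finite_of_finite K
  have : Fintype (Dual K E) := Fintype.ofFinite _
  set F := H.comap (K ∙ x).mkQ with hF
  have hxF : x ∈ F := by
    have h1 : (K ∙ x).mkQ x = 0 := by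
      rw [← LinearMap.mem_ker, Submodule.ker_mkQ]; exact Submodule.mem_span_singleton_self x
    rw [hF, Submodule.mem_comap, h1]
    exact H.zero_mem
  have hvan : ∀ v ∉ F, ν v x = 0 → ∀ z ∈ F, ν v z = 0 := fun v hv hvx z hz =>
    hV.normal_vanish hx (h x hx) hH (hν v) hvx hv hz
  have hFlt : F < ⊤ := by
    refine lt_top_iff_ne_top.2 fun hFt => htop ?_
    rw [← Submodule.map_comap_eq_of_surjective (K ∙ x).mkQ_surjective H, ← hF, hFt,
      Submodule.map_top, Submodule.range_mkQ]
  have hFgt : (K ∙ x) < F := by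
    refine lt_of_le_of_ne ((Submodule.span_singleton_le_iff_mem _ _).2 hxF) fun hFe => hbot ?_
    rw [← Submodule.map_comap_eq_of_surjective (K ∙ x).mkQ_surjective H, ← hF, ← hFe,
      Submodule.mkQ_map_self]
  have hf1 := Submodule.finrank_lt_finrank_of_lt hFgt
  have hf2 := Submodule.finrank_lt hFlt.ne
  rw [finrank_span_singleton hx] at hf1
  have hbij : Function.Bijective ν := by
    refine hinj.bijective_of_nat_card_le ?_
    rw [Module.natCard_eq_pow_finrank (K := K) (V := E),
      Module.natCard_eq_pow_finrank (K := K) (V := Dual K E), Subspace.dual_finrank_eq]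
  have hcount : ∀ A : Submodule K E,
      (Finset.univ.filter fun v : E => v ≠ 0 ∧ ν v ∈ A.dualAnnihilator).card + 1 =
      Nat.card K ^ (finrank K E - finrank K A) := by
    intro A
    have h1 := Subspace.finrank_add_finrank_dualAnnihilator_eq A
    have h2 : finrank K E - finrank K A = finrank K A.dualAnnihilator := by omega
    rw [h2, ← card_filter_ne_zero A.dualAnnihilator]
    congr 1
    refine Finset.card_bij (fun v _ => ν v) ?_ (fun v _ w _ h => hinj h) ?_
    · intro v hv
      simp only [Finset.mem_filter, Finset.mem_univ, true_and] at hv ⊢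
      exact ⟨fun h3 => hv.1 (hinj (h3.trans hν0.symm)), hv.2⟩
    · intro φ hφ
      obtain ⟨v, rfl⟩ := hbij.2 φ
      simp only [Finset.mem_filter, Finset.mem_univ, true_and] at hφ
      refine ⟨v, ?_, rfl⟩
      simp only [Finset.mem_filter, Finset.mem_univ, true_and]
      refine ⟨?_, hφ.2⟩
      rintro rfl
      exact hφ.1 hν0
  set q := Nat.card K with hq
  have hT := hcount (K ∙ x)
  rw [finrank_span_singleton hx] at hT
  have hTF := hcount F
  set T : Finset E := Finset.univ.filter fun v : E => v ≠ 0 ∧ ν v ∈ (K ∙ x).dualAnnihilator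
    with hTdef
  set T' : Finset E := Finset.univ.filter fun v : E => v ≠ 0 ∧ ν v ∈ F.dualAnnihilator
  have hmemT : ∀ v, v ∈ T ↔ v ≠ 0 ∧ ν v x = 0 := by
    intro v
    simp only [hTdef, Finset.mem_filter, Finset.mem_univ, true_and,
      Submodule.mem_dualAnnihilator]
    refine and_congr_right fun _ => ⟨fun h => h x (Submodule.mem_span_singleton_self x), ?_⟩
    intro h w hw
    obtain ⟨c, rfl⟩ := Submodule.mem_span_singleton.1 hw
    rw [map_smul, h, smul_zero]
  have hFc := card_filter_ne_zero F
  have hxc := card_filter_ne_zero (K ∙ x)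
  rw [finrank_span_singleton hx, pow_one] at hxc
  rw [← hq] at hFc hxc
  set SF : Finset E := Finset.univ.filter fun v : E => v ≠ 0 ∧ v ∈ F with hSF
  set Sx : Finset E := Finset.univ.filter fun v : E => v ≠ 0 ∧ v ∈ (K ∙ x) with hSx
  set B : Finset E := Finset.univ.filter fun v : E => (v ∈ F ∧ v ∉ (K ∙ x)) ∧ ν v x ≠ 0 with hB
  have hc1 : (T.filter fun v => v ∈ F).card + (T.filter fun v => v ∉ F).card = T.card :=
    Finset.card_filter_add_card_filter_not _
  have hc2 : (T.filter fun v => v ∉ F).card ≤ T'.card := by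
    refine Finset.card_le_card fun v hv => ?_
    obtain ⟨hvT, hvF⟩ := Finset.mem_filter.1 hv
    obtain ⟨hv0, hvx⟩ := (hmemT v).1 hvT
    exact Finset.mem_filter.2 ⟨Finset.mem_univ _, hv0,
      (Submodule.mem_dualAnnihilator _).2 fun z hz => hvan v hvF hvx z hz⟩
  have hd1 : Disjoint (T.filter fun v => v ∈ F) Sx := by
    rw [Finset.disjoint_left]
    intro v hv hvx
    obtain ⟨hv0, hvx0⟩ := (hmemT v).1 (Finset.mem_filter.1 hv).1
    obtain ⟨c, hc⟩ := Submodule.mem_span_singleton.1 (Finset.mem_filter.1 hvx).2.2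
    have h1 := hν1 v hv0
    rw [← hc, map_smul, hc, hvx0, smul_zero] at h1
    exact zero_ne_one h1
  have hd2 : Disjoint ((T.filter fun v => v ∈ F) ∪ Sx) B := by
    rw [Finset.disjoint_left]
    intro v hv hvB
    obtain ⟨-, ⟨-, hvx⟩, hvx0⟩ := Finset.mem_filter.1 hvB
    rcases Finset.mem_union.1 hv with hv | hv
    · exact hvx0 ((hmemT v).1 (Finset.mem_filter.1 hv).1).2
    · exact hvx (Finset.mem_filter.1 hv).2.2
  have hc3 : (T.filter fun v => v ∈ F).card + Sx.card + B.card ≤ SF.card := by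
    rw [← Finset.card_union_of_disjoint hd1, ← Finset.card_union_of_disjoint hd2]
    refine Finset.card_le_card fun v hv => ?_
    rw [hSF, Finset.mem_filter]
    refine ⟨Finset.mem_univ _, ?_⟩
    rcases Finset.mem_union.1 hv with hv | hv
    · rcases Finset.mem_union.1 hv with hv | hv
      · exact ⟨((hmemT v).1 (Finset.mem_filter.1 hv).1).1, (Finset.mem_filter.1 hv).2⟩
      · exact ⟨(Finset.mem_filter.1 hv).2.1, hFgt.le (Finset.mem_filter.1 hv).2.2⟩
    · obtain ⟨-, ⟨hvF, hvx⟩, -⟩ := Finset.mem_filter.1 hv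
      exact ⟨fun h0 => hvx (h0 ▸ zero_mem _), hvF⟩
  have hfn : finrank K F + 1 = finrank K E := pow_aux hK hf1 hf2 (by omega)
  refine ⟨F, hfn, hxF, fun v hvF hvx => ?_, hvan⟩
  by_contra hvx0
  have hBpos : 0 < B.card := Finset.card_pos.2 ⟨v, by simp [hB, hvF, hvx, hvx0]⟩
  have he1 : finrank K E - finrank K F = 1 := by omega
  have he2 : finrank K E - 1 = finrank K F := by omega
  rw [he1, pow_one] at hTF
  rw [he2] at hT
  omega

theorem not_exists_hyperplane_family (hK : 3 ≤ Nat.card K) [Finite K] (hn : 4 ≤ finrank K E)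
    {V : Submodule K (End K E)} (hV : IsMax V) (h : ∀ x ≠ 0, rankOne V x = ⊥)
    {ν : E → Dual K E} (hν1 : ∀ v ≠ 0, ν v v = 1)
    (hν : ∀ v, ∀ f ∈ V, ν v (f v) = 0) {G : E → Submodule K E}
    (hG : ∀ x ≠ 0, finrank K (G x) + 1 = finrank K E ∧ x ∈ G x ∧
      (∀ v ∈ G x, v ∉ (K ∙ x) → ν v x = 0) ∧
      (∀ v ∉ G x, ν v x = 0 → ∀ z ∈ G x, ν v z = 0)) : False := by
  classical
  have hself : ∀ x ≠ 0, x ∈ G x := fun x hx => (hG x hx).2.1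
  have hexists : ∀ (A : Submodule K E) (y : E), 2 ≤ finrank K A → ∃ z ∈ A, z ∉ (K ∙ y) := by
    intro A y hA
    by_contra! hc
    have h1 := Submodule.finrank_mono (show A ≤ (K ∙ y) from hc)
    have h2 := finrank_span_le_card (R := K) ({y} : Set E)
    simp at h2
    omega
  have h5 : ∀ x ≠ 0, ∀ y ∈ G x, y ∉ (K ∙ x) → ∀ s : K, s ≠ 0 → y ∉ G (x + s • y) := by
    intro x hx y hy hyx s hs hyG
    have hy0 : y ≠ 0 := fun h0 => hyx (h0 ▸ zero_mem _)
    have hxs : x + s • y ≠ 0 := by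
      intro h0
      apply hyx
      rw [← inv_smul_smul₀ hs y, eq_neg_of_add_eq_zero_right h0]
      exact Submodule.smul_mem _ _ (neg_mem (Submodule.mem_span_singleton_self (R := K) x))
    have hyxs : y ∉ (K ∙ (x + s • y)) := by
      intro hmem
      obtain ⟨c, hc⟩ := Submodule.mem_span_singleton.1 hmem
      have h1 : c • x = (1 - c * s) • y := by
        rw [sub_smul, one_smul, mul_smul, eq_sub_iff_add_eq, ← smul_add, hc]
      by_cases h2 : 1 - c * s = 0
      · rw [h2, zero_smul, smul_eq_zero] at h1
        rcases h1 with h1 | h1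
        · simp [h1] at h2
        · exact hx h1
      · apply hyx
        rw [← inv_smul_smul₀ h2 y, ← h1]
        exact Submodule.smul_mem _ _ (Submodule.smul_mem _ _
          (Submodule.mem_span_singleton_self x))
    have h1 := (hG _ hxs).2.2.1 y hyG hyxs
    rw [map_add, (hG x hx).2.2.1 y hy hyx, map_smul, hν1 y hy0, smul_eq_mul, mul_one,
      zero_add] at h1
    exact hs h1
  obtain ⟨x, y, hx, hyx, hyG, hxG⟩ : ∃ x y : E, x ≠ 0 ∧ y ∉ (K ∙ x) ∧ y ∈ G x ∧ x ∉ G y := by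
    have : Nontrivial E := Module.nontrivial_of_finrank_pos (R := K) (by omega)
    obtain ⟨x, hx⟩ := exists_ne (0 : E)
    have hd := (hG x hx).1
    obtain ⟨y, hy, hyx⟩ := hexists (G x) x (by omega)
    have hy0 : y ≠ 0 := fun h0 => hyx (h0 ▸ zero_mem _)
    by_cases hxy : x ∈ G y
    · refine ⟨x, y + x, hx, ?_, (G x).add_mem hy (hself x hx), ?_⟩
      · intro hm
        exact hyx (by simpa using sub_mem hm (Submodule.mem_span_singleton_self (R := K) x))
      · have hxy' : x ∉ (K ∙ y) := by
          intro hm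
          obtain ⟨c, rfl⟩ := Submodule.mem_span_singleton.1 hm
          have hc : c ≠ 0 := by
            rintro rfl
            simp at hx
          exact hyx (Submodule.mem_span_singleton.2 ⟨c⁻¹, inv_smul_smul₀ hc y⟩)
        have := h5 y hy0 x hxy hxy' 1 one_ne_zero
        rwa [one_smul] at this
    · exact ⟨x, y, hx, hyx, hy, hxy⟩
  have hy0 : y ≠ 0 := fun h0 => hyx (h0 ▸ zero_mem _)
  have hxy0 : x + y ≠ 0 := fun h0 => hyx (by
    rw [eq_neg_of_add_eq_zero_right h0]
    exact neg_mem (Submodule.mem_span_singleton_self (R := K) x))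
  have hyGxy : y ∉ G (x + y) := by
    have := h5 x hx y hyG hyx 1 one_ne_zero
    rwa [one_smul] at this
  obtain ⟨z, ⟨hzx, hzy⟩, hz⟩ := hexists (G x ⊓ G y) y (by
    have h1 := Submodule.finrank_sup_add_finrank_inf_eq (G x) (G y)
    have h2 := (hG x hx).1
    have h3 := (hG y hy0).1
    have h4 := Submodule.finrank_le (G x ⊔ G y)
    omega)
  have hzt : ∀ t : K, z + t • y ∉ (K ∙ y) := fun t hm => hz (by
    simpa using sub_mem hm (Submodule.smul_mem _ t (Submodule.mem_span_singleton_self y)))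
  have hztx : ∀ t : K, z + t • y ∉ (K ∙ x) := by
    intro t hm
    obtain ⟨c, hc⟩ := Submodule.mem_span_singleton.1 hm
    by_cases hc0 : c = 0
    · apply hzt t
      rw [← hc, hc0, zero_smul]
      exact zero_mem _
    · apply hxG
      rw [← inv_smul_smul₀ hc0 x, hc]
      exact (G y).smul_mem _ ((G y).add_mem hzy ((G y).smul_mem _ (hself y hy0)))
  have hzt0 : ∀ t : K, z + t • y ≠ 0 := fun t h0 => hzt t (h0 ▸ zero_mem _)
  have hνt : ∀ t : K, ν (z + t • y) (x + y) = 0 := by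
    intro t
    rw [map_add, (hG x hx).2.2.1 _ ((G x).add_mem hzx ((G x).smul_mem _ hyG)) (hztx t),
      (hG y hy0).2.2.1 _ ((G y).add_mem hzy ((G y).smul_mem _ (hself y hy0))) (hzt t), add_zero]
  have hgood : ∀ t t' : K, t ≠ t' → z + t • y ∈ G (x + y) → z + t' • y ∉ G (x + y) := by
    intro t t' htt h1 h2
    apply hyGxy
    have h3 := (G (x + y)).sub_mem h1 h2
    rw [add_sub_add_left_eq_sub, ← sub_smul] at h3
    have h4 := (G (x + y)).smul_mem (t - t')⁻¹ h3
    rwa [inv_smul_smul₀ (sub_ne_zero.2 htt)] at h4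
  have hbad : ∀ t t' : K, t ≠ t' → z + t • y ∉ G (x + y) → z + t' • y ∈ G (x + y) := by
    intro t t' htt h1
    by_contra h2
    have hk1 := (hG _ hxy0).2.2.2 _ h1 (hνt t)
    have hk2 := (hG _ hxy0).2.2.2 _ h2 (hνt t')
    have hne : ν (z + t • y) ≠ 0 := fun h0 => by
      have := hν1 _ (hzt0 t)
      simp [h0] at this
    have hdim : finrank K (G (x + y)).dualAnnihilator = 1 := by
      have h3 := Subspace.finrank_add_finrank_dualAnnihilator_eq (G (x + y))
      have h4 := (hG _ hxy0).1
      omega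
    have hm1 : ν (z + t • y) ∈ (G (x + y)).dualAnnihilator :=
      (Submodule.mem_dualAnnihilator _).2 hk1
    have hm2 : ν (z + t' • y) ∈ (G (x + y)).dualAnnihilator :=
      (Submodule.mem_dualAnnihilator _).2 hk2
    obtain ⟨c, hc⟩ := (finrank_eq_one_iff_of_nonzero'
      (⟨ν (z + t' • y), hm2⟩ : (G (x + y)).dualAnnihilator) (by
        intro h0
        have h3 := hν1 _ (hzt0 t')
        have h4 : ν (z + t' • y) = 0 := congrArg Subtype.val h0
        simp [h4] at h3)).1 hdim ⟨ν (z + t • y), hm1⟩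
    have hc' : c • ν (z + t' • y) = ν (z + t • y) := congrArg Subtype.val hc
    obtain ⟨d, hd⟩ := Submodule.mem_span_singleton.1 (hV.mem_span_of_dual h hne (hzt0 t)
      (hν _) (w := z + t' • y) (fun f hf => by
        rw [← hc', LinearMap.smul_apply, hν _ f hf, smul_zero]))
    have h3 : (d - 1) • z = (t' - d * t) • y := by
      rw [sub_smul, sub_smul, mul_smul, one_smul, sub_eq_sub_iff_add_eq_add, ← smul_add, hd,
        add_comm]
    by_cases hd1 : d - 1 = 0
    · rw [hd1, zero_smul, eq_comm, smul_eq_zero] at h3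
      have h4 := h3.resolve_right hy0
      rw [sub_eq_zero.1 hd1, one_mul] at h4
      exact htt (sub_eq_zero.1 h4).symm
    · apply hz
      rw [← inv_smul_smul₀ hd1 z, h3]
      exact Submodule.smul_mem _ _ (Submodule.smul_mem _ _ (Submodule.mem_span_singleton_self y))
  obtain ⟨c, hc0, hc1⟩ := exists_ne_zero_ne_one hK
  by_cases h0 : z + (0 : K) • y ∈ G (x + y)
  · exact hgood 0 c hc0.symm h0 (hbad 1 c hc1.symm (hgood 0 1 zero_ne_one h0))
  · exact hgood 1 c hc1.symm (hbad 0 1 zero_ne_one h0) (hbad 0 c hc0.symm h0)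

end RankOneFree

section Reducible

universe u v

theorem IsMax.exists_invariant {K : Type u} [Field K] [Finite K] (hK : 3 ≤ Nat.card K)
    {E : Type v} [AddCommGroup E] [Module K E] [FiniteDimensional K E] (hn : 3 ≤ finrank K E)
    {V : Submodule K (End K E)} (hV : IsMax V) :
    ∃ G : Submodule K E, Invariant V G ∧ G ≠ ⊥ ∧ G ≠ ⊤ := by
  obtain ⟨n, hn'⟩ : ∃ n, finrank K E = n := ⟨_, rfl⟩
  induction n generalizing E with
  | zero => omega
  | succ n ih =>
    refine hV.exists_invariant_of_rankOne_ne_bot hK ?_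
    obtain rfl | hn4 : n = 2 ∨ 3 ≤ n := by omega
    · exact hV.exists_rankOne_ne_bot_of_three hK hn'
    by_contra! h
    obtain ⟨ν, hinj, hν0, hν1, hν⟩ := hV.exists_normal h
    have hG : ∀ x : E, ∃ G : Submodule K E, x ≠ 0 → finrank K G + 1 = finrank K E ∧ x ∈ G ∧
        (∀ v ∈ G, v ∉ (K ∙ x) → ν v x = 0) ∧ (∀ v ∉ G, ν v x = 0 → ∀ z ∈ G, ν v z = 0) := by
      intro x
      by_cases hx : x = 0
      · exact ⟨⊥, fun h => absurd hx h⟩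
      have hq : finrank K (E ⧸ (K ∙ x)) = n := by rw [finrank_quotient_span hx, hn']; rfl
      obtain ⟨H, hH, hbot, htop⟩ := ih (by omega) (hV.quo_stab hx (h x hx)) hq
      obtain ⟨G, hG⟩ := hV.exists_hyperplane hK h hinj hν0 hν1 hν hx hH hbot htop
      exact ⟨G, fun _ => hG⟩
    choose G hG using hG
    exact not_exists_hyperplane_family hK (by omega) hV h hν1 hν hG

end Reducible

section Blocks

variable {K E : Type*} [Field K] [AddCommGroup E] [Module K E]

theorem repr_inr_eq {m k : Type*} {G : Submodule K E} {b : Basis (m ⊕ k) K E} {bG : Basis m K G}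
    {bQ : Basis k K (E ⧸ G)} (h1 : ∀ i, b (Sum.inl i) = bG i)
    (h2 : ∀ j, G.mkQ (b (Sum.inr j)) = bQ j) (v : E) (j : k) :
    b.repr v (Sum.inr j) = bQ.repr (G.mkQ v) j := by
  classical
  have : b.coord (Sum.inr j) = bQ.coord j ∘ₗ G.mkQ := by
    refine b.ext fun i => ?_
    rcases i with i | i
    · have : G.mkQ (b (Sum.inl i)) = 0 := by rw [h1]; simp
      simp [this, -Submodule.mkQ_apply]
    · simp [h2, Finsupp.single_apply, -Submodule.mkQ_apply]
  exact LinearMap.congr_fun this v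

theorem repr_inl_eq {m k : Type*} {G : Submodule K E} {b : Basis (m ⊕ k) K E} {bG : Basis m K G}
    (h1 : ∀ i, b (Sum.inl i) = bG i) (v : G) (i : m) :
    b.repr v (Sum.inl i) = bG.repr v i := by
  classical
  have : b.coord (Sum.inl i) ∘ₗ G.subtype = bG.coord i := by
    refine bG.ext fun i => ?_
    simp [← h1, Finsupp.single_apply]
  exact LinearMap.congr_fun this v

/-- Block triangular matrices represent the endomorphisms stabilizing a subspace. -/
theorem toMatrix_eq_fromBlocks_iff {m k : Type*} [Fintype m] [Fintype k] [DecidableEq m]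
    [DecidableEq k] {G : Submodule K E} {b : Basis (m ⊕ k) K E} {bG : Basis m K G}
    {bQ : Basis k K (E ⧸ G)} (h1 : ∀ i, b (Sum.inl i) = bG i)
    (h2 : ∀ j, G.mkQ (b (Sum.inr j)) = bQ j) (S : Set (Matrix m m K)) (T : Set (Matrix k k K))
    (f : End K E) :
    (∃ A ∈ S, ∃ C ∈ T, ∃ B, LinearMap.toMatrix b b f = fromBlocks A B 0 C) ↔
      ∃ hf : ∀ v ∈ G, f v ∈ G, LinearMap.toMatrix bG bG (f.restrict hf) ∈ S ∧
        LinearMap.toMatrix bQ bQ (G.mapQ G f hf) ∈ T := by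
  have key : ∀ hf : ∀ v ∈ G, f v ∈ G, LinearMap.toMatrix b b f =
      fromBlocks (LinearMap.toMatrix bG bG (f.restrict hf))
        (Matrix.of fun i j => b.repr (f (b (Sum.inr j))) (Sum.inl i)) 0
        (LinearMap.toMatrix bQ bQ (G.mapQ G f hf)) := by
    intro hf
    ext i j
    rcases i with i | i <;> rcases j with j | j
    · rw [fromBlocks_apply₁₁, LinearMap.toMatrix_apply, LinearMap.toMatrix_apply,
        ← repr_inl_eq h1, LinearMap.coe_restrict_apply, h1]
    · rw [fromBlocks_apply₁₂, LinearMap.toMatrix_apply, of_apply]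
    · have h0 : G.mkQ (f (bG j)) = 0 := (Submodule.Quotient.mk_eq_zero G).2 (hf _ (bG j).2)
      rw [fromBlocks_apply₂₁, LinearMap.toMatrix_apply, repr_inr_eq h1 h2, h1, h0]
      simp
    · rw [fromBlocks_apply₂₂, LinearMap.toMatrix_apply, LinearMap.toMatrix_apply,
        repr_inr_eq h1 h2, ← h2]
      rfl
  constructor
  · rintro ⟨A, hA, C, hC, B, h⟩
    have hf : ∀ v ∈ G, f v ∈ G := by
      have h3 : G ≤ G.comap f := by
        have h4 : G = Submodule.span K (Set.range fun i => (bG i : E)) := by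
          rw [show (fun i => (bG i : E)) = G.subtype ∘ bG from rfl, Set.range_comp,
            ← Submodule.map_span, bG.span_eq, Submodule.map_top, Submodule.range_subtype]
        conv_lhs => rw [h4]
        rw [Submodule.span_le]
        rintro _ ⟨i, rfl⟩
        rw [SetLike.mem_coe, Submodule.mem_comap, ← Submodule.Quotient.mk_eq_zero]
        refine bQ.ext_elem fun j => ?_
        have h5 := congrFun (congrFun h (Sum.inr j)) (Sum.inl i)
        rw [fromBlocks_apply₂₁, LinearMap.toMatrix_apply, repr_inr_eq h1 h2, h1] at h5
        rw [map_zero]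
        exact h5
      exact h3
    refine ⟨hf, ?_⟩
    rw [key hf, fromBlocks_inj] at h
    rw [h.1, h.2.2.2]
    exact ⟨hA, hC⟩
  · rintro ⟨hf, hA, hC⟩
    exact ⟨_, hA, _, hC, _, key hf⟩

/-- In a suitable basis, `V` is the space `K·M_1 ∨ ⋯ ∨ K·M_p`. -/
def Rep (V : Submodule K (End K E)) (l : List (Σ m : ℕ, Matrix (Fin m) (Fin m) K)) : Prop :=
  ∃ b : Basis (Fin (sigSum l)) K E, ∀ f, f ∈ V ↔ LinearMap.toMatrix b b f ∈ bdSetSpan l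

theorem toMatrix_reindex_mem_blockJoin_iff {n p : ℕ} (b : Basis (Fin n ⊕ Fin p) K E)
    (S : Set (Matrix (Fin n) (Fin n) K)) (T : Set (Matrix (Fin p) (Fin p) K)) (f : End K E) :
    LinearMap.toMatrix (b.reindex finSumFinEquiv) (b.reindex finSumFinEquiv) f ∈ blockJoin S T ↔
      ∃ A ∈ S, ∃ C ∈ T, ∃ B, LinearMap.toMatrix b b f = fromBlocks A B 0 C := by
  have h : LinearMap.toMatrix (b.reindex finSumFinEquiv) (b.reindex finSumFinEquiv) f =
      Matrix.reindex finSumFinEquiv finSumFinEquiv (LinearMap.toMatrix b b f) := by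
    ext i j
    simp [LinearMap.toMatrix_apply]
  simp only [blockJoin, Set.mem_ofPred_eq, h, EmbeddingLike.apply_eq_iff_eq]

theorem exists_reindex_eq {ι κ : Type*} (e : ι ≃ κ) (b : Basis κ K E) :
    ∃ b' : Basis ι K E, b = b'.reindex e :=
  ⟨b.reindex e.symm, by ext; simp⟩

/-- A basis indexed by a disjoint sum induces bases of a subspace and of its quotient. -/
theorem exists_basis_of_sum {m k : Type*} [Fintype m] [Fintype k] (b : Basis (m ⊕ k) K E) :
    ∃ (G : Submodule K E) (bG : Basis m K G) (bQ : Basis k K (E ⧸ G)),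
      (∀ i, b (Sum.inl i) = bG i) ∧ ∀ j, G.mkQ (b (Sum.inr j)) = bQ j := by
  classical
  let π : E →ₗ[K] (k → K) := LinearMap.pi fun j => b.coord (Sum.inr j)
  have hπ : ∀ j, π (b (Sum.inr j)) = Pi.single j 1 := by
    intro j
    ext i
    simp [π, Finsupp.single_apply, Pi.single_apply, eq_comm]
  have hsurj : Function.Surjective π := by
    rw [← LinearMap.range_eq_top, eq_top_iff, ← (Pi.basisFun K k).span_eq, Submodule.span_le]
    rintro _ ⟨j, rfl⟩
    exact ⟨b (Sum.inr j), by rw [hπ, Pi.basisFun_apply]⟩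
  have hker : ∀ i, b (Sum.inl i) ∈ LinearMap.ker π := by
    intro i
    ext j
    simp [π]
  refine ⟨LinearMap.ker π,
    Basis.mk (v := fun i => (⟨b (Sum.inl i), hker i⟩ : LinearMap.ker π)) ?_ ?_,
    Basis.ofEquivFun (π.quotKerEquivOfSurjective hsurj), ?_, ?_⟩
  · refine LinearIndependent.of_comp (LinearMap.ker π).subtype ?_
    exact b.linearIndependent.comp Sum.inl Sum.inl_injective
  · rintro ⟨v, hv⟩ -
    have hv' : (⟨v, hv⟩ : LinearMap.ker π) =
        ∑ i, b.repr v (Sum.inl i) • ⟨b (Sum.inl i), hker i⟩ := by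
      ext
      have h : ∀ j, b.repr v (Sum.inr j) = 0 := fun j => congrFun hv j
      have h' := b.sum_repr v
      rw [Fintype.sum_sum_type] at h'
      simpa [h] using h'.symm
    rw [hv']
    exact Submodule.sum_mem _ fun i _ =>
      Submodule.smul_mem _ _ (Submodule.subset_span (Set.mem_range_self i))
  · intro i
    simp
  · intro j
    rw [Basis.coe_ofEquivFun, LinearEquiv.eq_symm_apply]
    exact hπ j

theorem rep_cons_iff {V : Submodule K (End K E)} {x : Σ m : ℕ, Matrix (Fin m) (Fin m) K}
    {xs : List (Σ m : ℕ, Matrix (Fin m) (Fin m) K)} :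
    Rep V (x :: xs) ↔ ∃ (G : Submodule K E) (bG : Basis (Fin x.1) K G)
      (bQ : Basis (Fin (sigSum xs)) K (E ⧸ G)), ∀ f : End K E, f ∈ V ↔
        ∃ hf : ∀ v ∈ G, f v ∈ G,
          LinearMap.toMatrix bG bG (f.restrict hf) ∈ Set.range (fun c : K => c • x.2) ∧
          LinearMap.toMatrix bQ bQ (G.mapQ G f hf) ∈ bdSetSpan xs := by
  constructor
  · rintro ⟨b, hb⟩
    obtain ⟨b, rfl⟩ := exists_reindex_eq (finSumFinEquiv (m := x.1) (n := sigSum xs)) b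
    obtain ⟨G, bG, bQ, h1, h2⟩ := exists_basis_of_sum b
    refine ⟨G, bG, bQ, fun f => ?_⟩
    rw [← toMatrix_eq_fromBlocks_iff h1 h2, hb]
    exact toMatrix_reindex_mem_blockJoin_iff b _ _ f
  · rintro ⟨G, bG, bQ, h⟩
    refine ⟨(bG.sumQuot bQ).reindex finSumFinEquiv, fun f => ?_⟩
    rw [h, ← toMatrix_eq_fromBlocks_iff (b := bG.sumQuot bQ) (by simp) (by simp)]
    exact (toMatrix_reindex_mem_blockJoin_iff _ _ _ f).symm

theorem zero_mem_bdSetSpan (l : List (Σ m : ℕ, Matrix (Fin m) (Fin m) K)) :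
    0 ∈ bdSetSpan l := by
  induction l with
  | nil => trivial
  | cons x xs ih =>
    refine ⟨0, ⟨0, by simp⟩, 0, ih, 0, ?_⟩
    rw [fromBlocks_zero]
    rfl

end Blocks

section Existence

universe u v

variable {K : Type u} [Field K] {E : Type v} [AddCommGroup E] [Module K E]

/-- The blocks allowed on the diagonal. -/
def IsBlock (x : Σ m : ℕ, Matrix (Fin m) (Fin m) K) : Prop :=
  (x.1 = 1 ∧ x.2 = 0) ∨
    (x.1 = 2 ∧ ∀ (c : K) (X : Fin x.1 → K), x.2.mulVec X = c • X → X = 0)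

theorem IsMax.mem_iff [FiniteDimensional K E] {V : Submodule K (End K E)} (hV : IsMax V)
    {G : Submodule K E} (hG : Invariant V G) (f : End K E) :
    f ∈ V ↔ ∃ hf : ∀ v ∈ G, f v ∈ G, f.restrict hf ∈ res V G ∧ G.mapQ G f hf ∈ quo V G := by
  let W : Submodule K (End K E) :=
    { carrier := {f | ∃ hf : ∀ v ∈ G, f v ∈ G, f.restrict hf ∈ res V G ∧
        G.mapQ G f hf ∈ quo V G}
      add_mem' := by
        rintro a b ⟨ha, ha1, ha2⟩ ⟨hb, hb1, hb2⟩
        refine ⟨fun v hv => G.add_mem (ha v hv) (hb v hv), ?_, ?_⟩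
        · convert! (res V G).add_mem ha1 hb1 using 1
        · convert! (quo V G).add_mem ha2 hb2 using 1
          ext
          simp
      zero_mem' := by
        refine ⟨fun v hv => G.zero_mem, ?_, ?_⟩
        · convert! (res V G).zero_mem using 1
        · convert! (quo V G).zero_mem using 1
          ext
          simp
      smul_mem' := by
        rintro c a ⟨ha, ha1, ha2⟩
        refine ⟨fun v hv => G.smul_mem c (ha v hv), ?_, ?_⟩
        · convert! (res V G).smul_mem c ha1 using 1
        · convert! (quo V G).smul_mem c ha2 using 1
          ext
          simp }
  have hVW : V ≤ W := fun f hf =>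
    ⟨hG f hf, ⟨f, hf, fun x => rfl⟩, f, hf, fun x => rfl⟩
  have hW : IsTS W := by
    rintro f ⟨hf, h1, h2⟩ x hx
    have h3 := (hV.1.quo hG) _ h2 (G.mkQ x) (by
      rw [Submodule.mkQ_apply, Submodule.mapQ_apply, hx])
    have h4 : x ∈ G := (Submodule.Quotient.mk_eq_zero G).1 h3
    have h5 := (hV.1.res G) _ h1 ⟨x, h4⟩ (Subtype.ext hx)
    exact congrArg Subtype.val h5
  have h := Submodule.eq_of_le_of_finrank_le hVW (hW.finrank_le.trans hV.2.ge)
  exact SetLike.ext_iff.1 h f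

theorem exists_minimal_invariant [FiniteDimensional K E] [Nontrivial E]
    (V : Submodule K (End K E)) :
    ∃ G : Submodule K E, Invariant V G ∧ G ≠ ⊥ ∧
      ∀ H : Submodule K G, Invariant (res V G) H → H = ⊥ ∨ H = ⊤ := by
  obtain ⟨G, ⟨hG, hbot⟩, hmin⟩ := (wellFounded_lt (α := Submodule K E)).has_min
    {G | Invariant V G ∧ G ≠ ⊥} ⟨⊤, fun f _ x _ => trivial, top_ne_bot⟩
  refine ⟨G, hG, hbot, fun H hH => ?_⟩
  by_contra! h
  refine hmin (H.map G.subtype) ⟨?_, ?_⟩ ?_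
  · rintro f hf _ ⟨v, hv, rfl⟩
    exact ⟨f.restrict (hG f hf) v, hH _ ⟨f, hf, fun x => rfl⟩ v hv, rfl⟩
  · intro h1
    exact h.1 (Submodule.map_injective_of_injective G.subtype_injective
      (h1.trans (Submodule.map_bot _).symm))
  · refine lt_of_le_of_ne (Submodule.map_subtype_le G H) fun h1 => h.2 ?_
    exact Submodule.map_injective_of_injective G.subtype_injective
      (h1.trans (Submodule.map_subtype_top G).symm)

/-- An irreducible maximal trivial spectrum space is a line spanned by an allowed block. -/
theorem IsMax.exists_isBlock [Finite K] (hK : 3 ≤ Nat.card K) [FiniteDimensional K E]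
    [Nontrivial E] {V : Submodule K (End K E)} (hV : IsMax V)
    (h : ∀ H : Submodule K E, Invariant V H → H = ⊥ ∨ H = ⊤) :
    ∃ x : Σ m : ℕ, Matrix (Fin m) (Fin m) K, IsBlock x ∧ ∃ b : Basis (Fin x.1) K E,
      ∀ f, f ∈ V ↔ LinearMap.toMatrix b b f ∈ Set.range (fun c : K => c • x.2) := by
  have hpos := finrank_pos (R := K) (M := E)
  have hlt : finrank K E < 3 := by
    by_contra! hn
    obtain ⟨G, hG, h1, h2⟩ := hV.exists_invariant hK hn
    exact (h G hG).elim h1 h2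
  obtain hn | hn : finrank K E = 1 ∨ finrank K E = 2 := by omega
  · refine ⟨⟨1, 0⟩, Or.inl ⟨rfl, rfl⟩, finBasisOfFinrankEq K E hn, fun f => ?_⟩
    have h1 : V = ⊥ := by
      rw [← Submodule.finrank_eq_zero, hV.2, hn]
      rfl
    simp [h1]
  · have h1 : finrank K V = 1 := by rw [hV.2, hn]; rfl
    obtain ⟨g, -, hg⟩ := finrank_eq_one_iff'.1 h1
    let b := finBasisOfFinrankEq K E hn
    refine ⟨⟨2, LinearMap.toMatrix b b g.1⟩, Or.inr ⟨rfl, fun c X hX => ?_⟩, b, fun f => ?_⟩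
    · by_contra hX0
      let x := b.equivFun.symm X
      have hx0 : x ≠ 0 := (LinearEquiv.map_ne_zero_iff _).2 hX0
      have hgx : g.1 x = c • x := by
        have h2 : ⇑(b.repr x) = X := b.equivFun.apply_symm_apply X
        refine b.ext_elem fun i => ?_
        rw [← LinearMap.toMatrix_mulVec_repr b b g.1 x, h2, map_smul, Finsupp.smul_apply, h2]
        exact congrFun hX i
      have h2 := h (K ∙ x) (by
        intro f hf y hy
        obtain ⟨d, rfl⟩ := Submodule.mem_span_singleton.1 hy
        obtain ⟨e, he⟩ := hg ⟨f, hf⟩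
        rw [show f = e • g.1 from (congrArg Subtype.val he).symm, LinearMap.smul_apply, map_smul,
          hgx]
        exact Submodule.smul_mem _ _ (Submodule.smul_mem _ _ (Submodule.smul_mem _ _
          (Submodule.mem_span_singleton_self x))))
      have h3 := finrank_span_singleton (K := K) hx0
      rcases h2 with h2 | h2
      · exact hx0 (Submodule.span_singleton_eq_bot.1 h2)
      · rw [h2, finrank_top] at h3
        omega
    · constructor
      · intro hf
        obtain ⟨e, he⟩ := hg ⟨f, hf⟩
        refine ⟨e, ?_⟩
        rw [show f = e • g.1 from (congrArg Subtype.val he).symm, map_smul]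
      · rintro ⟨e, he⟩
        simp only [← map_smul, EmbeddingLike.apply_eq_iff_eq] at he
        rw [← he]
        exact V.smul_mem _ g.2

theorem IsMax.exists_rep [Finite K] (hK : 3 ≤ Nat.card K) [FiniteDimensional K E]
    {V : Submodule K (End K E)} (hV : IsMax V) :
    ∃ l : List (Σ m : ℕ, Matrix (Fin m) (Fin m) K), (∀ x ∈ l, IsBlock x) ∧ Rep V l := by
  obtain ⟨n, hn⟩ : ∃ n, finrank K E = n := ⟨_, rfl⟩
  induction n using Nat.strong_induction_on generalizing E with
  | _ n ih =>
    obtain h0 | hpos := Nat.eq_zero_or_pos n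
    · subst h0
      refine ⟨[], by simp, finBasisOfFinrankEq K E hn, fun f => ⟨fun _ => trivial, fun _ => ?_⟩⟩
      have := finrank_zero_iff.1 hn
      rw [Subsingleton.elim f 0]
      exact V.zero_mem
    have : Nontrivial E := nontrivial_of_finrank_pos (R := K) (hn ▸ hpos)
    obtain ⟨G, hG, hbot, hmin⟩ := exists_minimal_invariant V
    have : Nontrivial G := (Submodule.nontrivial_iff_ne_bot).2 hbot
    obtain ⟨-, h1, h2⟩ := hV.of_invariant hG
    obtain ⟨x, hx, bG, hbG⟩ := h1.exists_isBlock hK hmin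
    have h3 := Submodule.finrank_quotient_add_finrank G
    have h4 := finrank_pos (R := K) (M := G)
    obtain ⟨xs, hxs, b, hb⟩ := ih _ (by omega) h2 rfl
    refine ⟨x :: xs, List.forall_mem_cons.2 ⟨hx, hxs⟩, rep_cons_iff.2 ⟨G, bG, b, fun f => ?_⟩⟩
    simp only [hV.mem_iff hG, hbG, hb]

end Existence

section Uniqueness

variable {K E : Type*} [Field K] [AddCommGroup E] [Module K E]

/-- The first term of a composition series adapted to a block triangular space. -/
structure IsHead (V : Submodule K (End K E)) (x : Σ m : ℕ, Matrix (Fin m) (Fin m) K)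
    (xs : List (Σ m : ℕ, Matrix (Fin m) (Fin m) K)) (G : Submodule K E)
    (bG : Basis (Fin x.1) K G) (bQ : Basis (Fin (sigSum xs)) K (E ⧸ G)) : Prop where
  mem_iff : ∀ f : End K E, f ∈ V ↔ ∃ hf : ∀ v ∈ G, f v ∈ G,
    LinearMap.toMatrix bG bG (f.restrict hf) ∈ Set.range (fun c : K => c • x.2) ∧
    LinearMap.toMatrix bQ bQ (G.mapQ G f hf) ∈ bdSetSpan xs

namespace IsHead

variable {V : Submodule K (End K E)} {x : Σ m : ℕ, Matrix (Fin m) (Fin m) K}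
  {xs : List (Σ m : ℕ, Matrix (Fin m) (Fin m) K)} {G : Submodule K E}
  {bG : Basis (Fin x.1) K G} {bQ : Basis (Fin (sigSum xs)) K (E ⧸ G)}

theorem invariant (h : IsHead V x xs G bG bQ) : Invariant V G :=
  fun f hf => ((h.mem_iff f).1 hf).1

theorem mem_res_iff (h : IsHead V x xs G bG bQ) (g : End K G) :
    g ∈ res V G ↔ LinearMap.toMatrix bG bG g ∈ Set.range (fun c : K => c • x.2) := by
  constructor
  · rintro ⟨f, hf, hfg⟩
    obtain ⟨hf', h1, -⟩ := (h.mem_iff f).1 hf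
    convert! h1
    ext v
    exact hfg v
  · intro hg
    obtain ⟨p, hp⟩ := G.subtype.exists_leftInverse_of_injective G.ker_subtype
    have hp' : ∀ v : G, p v = v := LinearMap.congr_fun hp
    refine ⟨G.subtype ∘ₗ g ∘ₗ p, (h.mem_iff _).2 ⟨fun v _ => (g (p v)).2, ?_, ?_⟩, fun v => ?_⟩
    · convert! hg
      exact LinearMap.ext fun v => congrArg g (hp' v)
    · convert! zero_mem_bdSetSpan xs
      rw [LinearEquiv.map_eq_zero_iff]
      ext v
      exact (Submodule.Quotient.mk_eq_zero G).2 (g (p v)).2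
    · simp [hp']

theorem mem_quo_iff (h : IsHead V x xs G bG bQ) (g : End K (E ⧸ G)) :
    g ∈ quo V G ↔ LinearMap.toMatrix bQ bQ g ∈ bdSetSpan xs := by
  constructor
  · rintro ⟨f, hf, hfg⟩
    obtain ⟨hf', -, h1⟩ := (h.mem_iff f).1 hf
    convert! h1
    ext v
    exact hfg v
  · intro hg
    obtain ⟨s, hs⟩ := G.mkQ.exists_rightInverse_of_surjective G.range_mkQ
    have hs' : ∀ v, G.mkQ (s v) = v := LinearMap.congr_fun hs
    refine ⟨s ∘ₗ g ∘ₗ G.mkQ, (h.mem_iff _).2 ⟨fun v hv => ?_, ⟨0, ?_⟩, ?_⟩, fun v => ?_⟩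
    · simp [(Submodule.Quotient.mk_eq_zero G).2 hv]
    · simp only [zero_smul]
      rw [eq_comm, LinearEquiv.map_eq_zero_iff]
      ext v
      simp [(Submodule.Quotient.mk_eq_zero G).2 v.2]
    · convert! hg
      ext v
      exact hs' _
    · exact (hs' _).symm

theorem nilp_le (h : IsHead V x xs G bG bQ) : nilp G ≤ V := by
  rintro f ⟨h1, h2⟩
  refine (h.mem_iff f).2 ⟨fun v _ => h2 v, ⟨0, ?_⟩, ?_⟩
  · simp only [zero_smul]
    rw [eq_comm, LinearEquiv.map_eq_zero_iff]
    ext v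
    simp [h1 v v.2]
  · convert! zero_mem_bdSetSpan xs
    rw [LinearEquiv.map_eq_zero_iff]
    ext v
    simpa using h2 v

/-- The subspace attached to the first block is the least nonzero invariant subspace. -/
theorem le (h : IsHead V x xs G bG bQ) (hx : IsBlock x) {H : Submodule K E}
    (hH : Invariant V H) (hbot : H ≠ ⊥) : G ≤ H := by
  by_cases hHG : H ≤ G
  · have hfin : FiniteDimensional K G := bG.finiteDimensional_of_finite
    have hG : finrank K G = x.1 := by rw [finrank_eq_card_basis bG, Fintype.card_fin]
    have hpos : finrank K H ≠ 0 := by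
      have := Submodule.finiteDimensional_of_le hHG
      rwa [Ne, Submodule.finrank_eq_zero]
    by_contra hGH
    have hlt : finrank K H < finrank K G :=
      Submodule.finrank_lt_finrank_of_lt (lt_of_le_not_ge hHG hGH)
    rcases hx with ⟨h1, -⟩ | ⟨h1, h2⟩
    · omega
    have hH1 : finrank K H = 1 := by omega
    obtain ⟨⟨v, hv⟩, hv0, hspan⟩ := finrank_eq_one_iff'.1 hH1
    obtain ⟨f, hf, hfx⟩ := (h.mem_res_iff (Matrix.toLin bG bG x.2)).2 ⟨1, by simp⟩
    obtain ⟨c, hc⟩ := hspan ⟨f v, hH f hf v hv⟩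
    have h3 := h2 c (bG.repr ⟨v, hHG hv⟩) (by
      rw [← LinearMap.toMatrix_toLin bG bG x.2, LinearMap.toMatrix_mulVec_repr]
      have h4 : Matrix.toLin bG bG x.2 ⟨v, hHG hv⟩ = c • ⟨v, hHG hv⟩ :=
        Subtype.ext ((hfx _).trans (congrArg Subtype.val hc).symm)
      rw [h4, map_smul, Finsupp.coe_smul])
    have h4 := (LinearEquiv.map_eq_zero_iff bG.repr).1 (DFunLike.coe_injective h3)
    exact hv0 (Subtype.ext (congrArg (G.subtype) h4))
  · obtain ⟨w, hw, hwG⟩ := SetLike.not_le_iff_exists.1 hHG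
    intro v hv
    obtain ⟨φ, hφ, hφG⟩ := Submodule.exists_dual_map_eq_bot_of_notMem hwG inferInstance
    have hφ0 : ∀ y ∈ G, φ y = 0 := fun y hy => by
      have := Submodule.mem_map_of_mem (f := φ) hy
      rwa [hφG, Submodule.mem_bot] at this
    have h1 := hH _ (h.nilp_le (show φ.smulRight v ∈ nilp G from
      ⟨fun y hy => by simp [hφ0 y hy], fun y => G.smul_mem _ hv⟩)) w hw
    rw [LinearMap.smulRight_apply] at h1
    exact (H.smul_mem_iff hφ).1 h1

end IsHead

theorem simScalar_of_isHead {V : Submodule K (End K E)} {x y : Σ m : ℕ, Matrix (Fin m) (Fin m) K}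
    {xs ys : List (Σ m : ℕ, Matrix (Fin m) (Fin m) K)} {G : Submodule K E}
    {bG : Basis (Fin x.1) K G} {bQ : Basis (Fin (sigSum xs)) K (E ⧸ G)}
    {bG' : Basis (Fin y.1) K G} {bQ' : Basis (Fin (sigSum ys)) K (E ⧸ G)}
    (h : IsHead V x xs G bG bQ) (h' : IsHead V y ys G bG' bQ') (hx : IsBlock x)
    (hy : IsBlock y) : simScalar x y := by
  have hxy : x.1 = y.1 := by
    rw [← Fintype.card_fin x.1, ← Fintype.card_fin y.1, ← finrank_eq_card_basis bG,
      ← finrank_eq_card_basis bG']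
  obtain ⟨m, A⟩ := x
  obtain ⟨m', B⟩ := y
  dsimp only at hxy
  subst hxy
  refine ⟨rfl, ?_⟩
  by_cases hB : B = 0
  · have hA : A = 0 := by
      rcases hx with ⟨-, hA⟩ | ⟨h1, -⟩
      · exact hA
      · exfalso
        rcases hy with ⟨h2, -⟩ | ⟨-, h2⟩
        · dsimp only at h1 h2
          omega
        · dsimp only at h1 h2
          subst h1
          have := h2 0 (Pi.single 0 1) (by rw [hB, zero_mulVec, zero_smul])
          simp at this
    refine ⟨1, one_ne_zero, 1, isUnit_one, ?_⟩
    simp [hA, hB]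
  · obtain ⟨c, hc⟩ := (h.mem_res_iff _).1 ((h'.mem_res_iff (Matrix.toLin bG' bG' B)).2 ⟨1, by simp⟩)
    dsimp only at hc
    have h1 := basis_toMatrix_mul_linearMap_toMatrix_mul_basis_toMatrix bG' bG bG' bG
      (Matrix.toLin bG' bG' B)
    rw [← hc, LinearMap.toMatrix_toLin] at h1
    have h2 := Basis.toMatrix_mul_toMatrix_flip bG' bG
    have h3 := Basis.toMatrix_mul_toMatrix_flip bG bG'
    refine ⟨c, ?_, bG'.toMatrix bG, ⟨⟨_, _, h2, h3⟩, rfl⟩, ?_⟩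
    · rintro rfl
      apply hB
      rw [← h1]
      simp
    · rw [Matrix.inv_eq_right_inv h2]
      rw [Matrix.mul_smul, Matrix.smul_mul] at h1
      rw [h1]
      rfl

theorem Rep.forall₂_simScalar {V : Submodule K (End K E)}
    {l l' : List (Σ m : ℕ, Matrix (Fin m) (Fin m) K)} (hl : ∀ x ∈ l, IsBlock x)
    (hl' : ∀ x ∈ l', IsBlock x) (h : Rep V l) (h' : Rep V l') : List.Forall₂ simScalar l l' := by
  have hcard : sigSum l = sigSum l' := by
    obtain ⟨b, -⟩ := h
    obtain ⟨b', -⟩ := h'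
    rw [← Fintype.card_fin (sigSum l), ← Fintype.card_fin (sigSum l'), ← finrank_eq_card_basis b,
      ← finrank_eq_card_basis b']
  have hpos : ∀ x : Σ m : ℕ, Matrix (Fin m) (Fin m) K, IsBlock x → 0 < x.1 := by
    rintro x (⟨h, -⟩ | ⟨h, -⟩) <;> omega
  induction l generalizing E l' with
  | nil =>
    cases l' with
    | nil => exact List.Forall₂.nil
    | cons y ys =>
      have := hpos y (hl' y (by simp))
      simp only [sigSum] at hcard
      omega
  | cons x xs ih =>
    cases l' with
    | nil =>
      have := hpos x (hl x (by simp))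
      simp only [sigSum] at hcard
      omega
    | cons y ys =>
      obtain ⟨G, bG, bQ, hG⟩ := rep_cons_iff.1 h
      obtain ⟨G', bG', bQ', hG'⟩ := rep_cons_iff.1 h'
      replace hG : IsHead V x xs G bG bQ := ⟨hG⟩
      replace hG' : IsHead V y ys G' bG' bQ' := ⟨hG'⟩
      have hx := hl x (by simp)
      have hy := hl' y (by simp)
      have hne : ∀ (z : Σ m : ℕ, Matrix (Fin m) (Fin m) K) (H : Submodule K E), IsBlock z →
          Basis (Fin z.1) K H → H ≠ ⊥ := by
        rintro z H hz b rfl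
        exact b.ne_zero ⟨0, hpos z hz⟩ (Subsingleton.elim _ _)
      obtain rfl : G = G' := le_antisymm (hG.le hx hG'.invariant (hne y G' hy bG'))
        (hG'.le hy hG.invariant (hne x G hx bG))
      have hsim := simScalar_of_isHead hG hG' hx hy
      refine List.Forall₂.cons hsim (ih (V := quo V G) (fun z hz => hl z (by simp [hz]))
        (fun z hz => hl' z (by simp [hz])) ⟨bQ, hG.mem_quo_iff⟩ ⟨bQ', hG'.mem_quo_iff⟩ ?_)
      have := hsim.1
      simp only [sigSum] at hcard
      omega

end Uniqueness

section Bridge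

variable {K : Type*} [Field K] {n : ℕ}

/-- A space of matrices viewed as a space of endomorphisms. -/
def toEnd (V : Submodule K (Matrix (Fin n) (Fin n) K)) : Submodule K (End K (Fin n → K)) :=
  V.map (Matrix.toLin' : Matrix (Fin n) (Fin n) K ≃ₗ[K] End K (Fin n → K)).toLinearMap

theorem toLin'_mem_toEnd {V : Submodule K (Matrix (Fin n) (Fin n) K)}
    {M : Matrix (Fin n) (Fin n) K} : Matrix.toLin' M ∈ toEnd V ↔ M ∈ V :=
  ⟨fun ⟨_, hN, h⟩ => Matrix.toLin'.injective h ▸ hN, fun h => ⟨M, h, rfl⟩⟩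

theorem isMax_toEnd {V : Submodule K (Matrix (Fin n) (Fin n) K)}
    (htriv : TrivialSpectrum (V : Set (Matrix (Fin n) (Fin n) K)))
    (hdim : finrank K V = n * (n - 1) / 2) : IsMax (toEnd V) := by
  constructor
  · rintro _ ⟨M, hM, rfl⟩ x hx
    exact htriv M hM x hx
  · rw [toEnd, LinearEquiv.finrank_map_eq, hdim, finrank_fin_fun, Nat.choose_two_right]

theorem toMatrix_toLin'_eq (b : Basis (Fin n) K (Fin n → K)) (M : Matrix (Fin n) (Fin n) K) :
    LinearMap.toMatrix b b (Matrix.toLin' M) =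
      ((Pi.basisFun K (Fin n)).toMatrix b)⁻¹ * M * (Pi.basisFun K (Fin n)).toMatrix b := by
  have h := basis_toMatrix_mul_linearMap_toMatrix_mul_basis_toMatrix b (Pi.basisFun K (Fin n)) b
    (Pi.basisFun K (Fin n)) (Matrix.toLin' M)
  rw [← h, ← Matrix.toLin_eq_toLin', LinearMap.toMatrix_toLin,
    Matrix.inv_eq_right_inv (Basis.toMatrix_mul_toMatrix_flip _ b)]

theorem similarSets_iff {S T : Set (Matrix (Fin n) (Fin n) K)} :
    SimilarSets S T ↔ ∃ P : Matrix (Fin n) (Fin n) K, IsUnit P ∧ ∀ M, M ∈ T ↔ P⁻¹ * M * P ∈ S := by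
  refine exists_congr fun P => and_congr_right fun hP => ?_
  have h1 := Matrix.mul_nonsing_inv P ((Matrix.isUnit_iff_isUnit_det P).1 hP)
  have h2 := Matrix.nonsing_inv_mul P ((Matrix.isUnit_iff_isUnit_det P).1 hP)
  rw [Set.ext_iff]
  refine forall_congr' fun M => iff_congr Iff.rfl ?_
  constructor
  · rintro ⟨N, hN, rfl⟩
    simpa only [mul_assoc, h2, ← mul_assoc P⁻¹ P, one_mul, mul_one] using hN
  · intro h
    refine ⟨_, h, ?_⟩
    simp only [mul_assoc, h1, ← mul_assoc P P⁻¹, one_mul, mul_one]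

theorem spanRepresents_iff {V : Submodule K (Matrix (Fin n) (Fin n) K)}
    {l : List (Σ m : ℕ, Matrix (Fin m) (Fin m) K)} :
    SpanRepresents V l ↔ (∀ x ∈ l, IsBlock x) ∧ Rep (toEnd V) l := by
  refine and_congr_right fun _ => ?_
  have key : ∀ b : Basis (Fin (sigSum l)) K (Fin n → K), sigSum l = n := fun b => by
    rw [← Fintype.card_fin (sigSum l), ← finrank_eq_card_basis b, finrank_fin_fun]
  constructor
  · rintro ⟨rfl, h⟩
    obtain ⟨P, hP, h⟩ := similarSets_iff.1 h
    let b : Basis (Fin (sigSum l)) K (Fin (sigSum l) → K) :=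
      (Pi.basisFun K _).map (P.toLinearEquiv' hP.invertible)
    have hb : (Pi.basisFun K _).toMatrix b = P := by
      ext i j
      rw [Basis.toMatrix_apply, Basis.map_apply, Pi.basisFun_apply, Pi.basisFun_repr]
      exact congrFun (mulVec_single_one P j) i
    refine ⟨b, fun f => ?_⟩
    obtain ⟨M, rfl⟩ := Matrix.toLin'.surjective f
    rw [toLin'_mem_toEnd, toMatrix_toLin'_eq, hb, ← SetLike.mem_coe, h]
    simp
  · rintro ⟨b, h⟩
    obtain rfl := key b
    refine ⟨rfl, similarSets_iff.2 ⟨(Pi.basisFun K _).toMatrix b, ?_, fun M => ?_⟩⟩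
    · exact ⟨⟨_, _, Basis.toMatrix_mul_toMatrix_flip _ b,
        Basis.toMatrix_mul_toMatrix_flip b _⟩, rfl⟩
    · rw [SetLike.mem_coe, ← toLin'_mem_toEnd, h, toMatrix_toLin'_eq]
      simp

end Bridge
end TrivSpec

/-- Let `K` be a finite field with at least three elements and `V` a maximal linear
subspace of `M_n(K)` with a trivial spectrum.  Then `V` is similar to
`K·M_1 ∨ ⋯ ∨ K·M_p` where each `M_k` is either the zero matrix of `M_1(K)` or a `2 × 2`
matrix with no eigenvalue in `K`; moreover the list `(M_1, …, M_p)` is unique up to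
blockwise similarity and multiplication by non-zero scalars. -/
theorem classification_trivialSpectrum_finite_field (K : Type*) [Field K] [Finite K]
    (hK : 3 ≤ Nat.card K) (n : ℕ) (V : Submodule K (Matrix (Fin n) (Fin n) K))
    (htriv : TrivialSpectrum (V : Set (Matrix (Fin n) (Fin n) K)))
    (hdim : Module.finrank K V = n * (n - 1) / 2) :
    (∃ l : List (Σ m : ℕ, Matrix (Fin m) (Fin m) K), SpanRepresents V l) ∧
    (∀ l l' : List (Σ m : ℕ, Matrix (Fin m) (Fin m) K),
      SpanRepresents V l → SpanRepresents V l' → List.Forall₂ simScalar l l') := by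
  constructor
  · obtain ⟨l, hl⟩ := (TrivSpec.isMax_toEnd htriv hdim).exists_rep hK
    exact ⟨l, TrivSpec.spanRepresents_iff.2 hl⟩
  · intro l l' h h'
    obtain ⟨h1, h2⟩ := TrivSpec.spanRepresents_iff.1 h
    obtain ⟨h3, h4⟩ := TrivSpec.spanRepresents_iff.1 h'
    exact h2.forall₂_simScalar h1 h3 h4
end

section
/- Let 𝒱 be an affine subspace of M_n(ℝ) included in GL_n(ℝ) with dimension n(n-1)/2. Then there is a unique list (n_1,…,n_p) of positive integers with n_1+⋯+n_p = n such that 𝒱 is equivalent to I_n + (Alt_{n_1}(ℝ) ∨ ⋯ ∨ Alt_{n_p}(ℝ)). -/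
open Matrix

/-- The set of alternate matrices: those `A` with `Xᵀ A X = 0` for all `X`. -/
def altSet (K : Type*) [Field K] (n : ℕ) : Set (Matrix (Fin n) (Fin n) K) :=
  {A | ∀ X : Fin n → K, X ⬝ᵥ A.mulVec X = 0}

/-- Sum of a list of naturals (with definitional unfolding on `::`). -/
def natSum : List ℕ → ℕ
  | [] => 0
  | x :: xs => x + natSum xs

/-- `Alt_{n_1}(ℝ) ∨ ⋯ ∨ Alt_{n_p}(ℝ)` for a list `(n_1, …, n_p)`. -/
def bdSetAlt : (l : List ℕ) → Set (Matrix (Fin (natSum l)) (Fin (natSum l)) ℝ)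
  | [] => Set.univ
  | x :: xs => blockJoin (altSet ℝ x) (bdSetAlt xs)

/-- Two subsets of `M_n(K)` are equivalent if `W = P V Q` for invertible `P, Q`. -/
def EquivSets {K : Type*} [Field K] {n : ℕ}
    (V W : Set (Matrix (Fin n) (Fin n) K)) : Prop :=
  ∃ P Q : Matrix (Fin n) (Fin n) K, IsUnit P ∧ IsUnit Q ∧ W = (fun M => P * M * Q) '' V

namespace AffineNonsingular

open Module

variable {E : Type*} [AddCommGroup E] [Module ℝ E]

/-- A space of endomorphisms has trivial spectrum when no element has a nonzero fixed vector
(equivalently, no element has a nonzero real eigenvalue). -/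
def TrivialSpectrum (V : Submodule ℝ (End ℝ E)) : Prop :=
  ∀ f ∈ V, ∀ x, f x = x → x = 0

/-- Trivial spectrum spaces of the maximal possible dimension. -/
def IsMaxTrivialSpectrum (V : Submodule ℝ (End ℝ E)) : Prop :=
  TrivialSpectrum V ∧ finrank ℝ V = (finrank ℝ E).choose 2

/-- The endomorphisms that vanish on `U` and take their values in `U`. -/
def strictJoin (U : Submodule ℝ E) : Submodule ℝ (End ℝ E) where
  carrier := {h | (∀ y, h y ∈ U) ∧ ∀ u ∈ U, h u = 0}
  add_mem' := fun {a b} ha hb =>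
    ⟨fun y => U.add_mem (ha.1 y) (hb.1 y), fun u hu => by simp [ha.2 u hu, hb.2 u hu]⟩
  zero_mem' := ⟨fun y => by simp, fun u _ => by simp⟩
  smul_mem' := fun c a ha => ⟨fun y => U.smul_mem c (ha.1 y), fun u hu => by simp [ha.2 u hu]⟩

theorem finrank_le_choose_two_of_skew {W : Type*} [AddCommGroup W] [Module ℝ W] {n : ℕ}
    (Φ : W →ₗ[ℝ] Matrix (Fin n) (Fin n) ℝ) (hinj : ∀ w, Φ w = 0 → w = 0)
    (hskew : ∀ w, (Φ w)ᵀ = -Φ w) : finrank ℝ W ≤ n.choose 2 := by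
  let L : W →ₗ[ℝ] ((Σ i : Fin n, Fin i) → ℝ) :=
    { toFun := fun w p => Φ w p.1 ⟨p.2, p.2.2.trans p.1.2⟩
      map_add' := fun a b => by ext p; simp
      map_smul' := fun c a => by ext p; simp }
  have hL : Function.Injective L := by
    rw [injective_iff_map_eq_zero]
    intro w hw
    apply hinj
    have hlt : ∀ i j : Fin n, j < i → Φ w i j = 0 := fun i j hij =>
      congrFun hw ⟨i, ⟨j, hij⟩⟩
    have hsk : ∀ i j, Φ w j i = -Φ w i j := fun i j => congrFun (congrFun (hskew w) i) j
    ext i j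
    rcases lt_trichotomy i j with h | h | h
    · rw [hsk, hlt _ _ h]; simp
    · subst h
      have := hsk i i
      simp only [Matrix.zero_apply]
      linarith
    · exact hlt _ _ h
  have h := LinearMap.finrank_le_finrank_of_injective hL
  rw [finrank_fintype_fun_eq_card, Fintype.card_sigma] at h
  simp only [Fintype.card_fin] at h
  rwa [Fin.sum_univ_eq_sum_range (fun i => i), Finset.sum_range_id, ← Nat.choose_two_right] at h

/-- Evaluation of the elements of `V` at `x`. -/
def evalAt (V : Submodule ℝ (End ℝ E)) (x : E) : V →ₗ[ℝ] E :=
  LinearMap.applyₗ x ∘ₗ V.subtype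

/-- The elements of `V` that vanish at `x`, together with the rank one endomorphisms with
image spanned by `x` that vanish at `x`. -/
def vertexSpace (V : Submodule ℝ (End ℝ E)) (x : E) : Submodule ℝ (End ℝ E) :=
  (V ⊓ LinearMap.ker (LinearMap.applyₗ x)) ⊔ strictJoin (ℝ ∙ x)

theorem mem_vertexSpace {V : Submodule ℝ (End ℝ E)} {x : E} {g : End ℝ E} :
    g ∈ vertexSpace V x ↔ ∃ f ∈ V, f x = 0 ∧ ∃ χ : Dual ℝ E, χ x = 0 ∧
      g = f + χ.smulRight x := by
  by_cases hx : x = 0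
  · subst hx
    have : strictJoin (ℝ ∙ (0 : E)) = ⊥ := by
      rw [eq_bot_iff]
      intro h hh
      ext y
      simpa using hh.1 y
    rw [vertexSpace, this, sup_bot_eq]
    constructor
    · intro h
      exact ⟨g, h.1, map_zero g, 0, rfl, by ext; simp⟩
    · rintro ⟨f, hf, -, χ, -, rfl⟩
      have : χ.smulRight (0 : E) = 0 := by ext; simp
      rw [this, add_zero]
      exact ⟨hf, map_zero f⟩
  obtain ⟨ξ, hξ⟩ := Projective.exists_dual_eq_one ℝ hx
  constructor
  · intro hg
    obtain ⟨f, hf, h, hh, rfl⟩ := Submodule.mem_sup.mp hg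
    refine ⟨f, hf.1, hf.2, ξ ∘ₗ h, ?_, ?_⟩
    · simp [hh.2 x (Submodule.mem_span_singleton_self x)]
    · congr 1
      ext y
      obtain ⟨c, hc⟩ := Submodule.mem_span_singleton.mp (hh.1 y)
      simp [← hc, hξ]
  · rintro ⟨f, hf, hfx, χ, hχ, rfl⟩
    refine Submodule.add_mem_sup ⟨hf, hfx⟩ ⟨fun y => ?_, fun u hu => ?_⟩
    · exact Submodule.smul_mem _ _ (Submodule.mem_span_singleton_self x)
    · obtain ⟨c, rfl⟩ := Submodule.mem_span_singleton.mp hu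
      simp [hχ]

variable [FiniteDimensional ℝ E]

theorem TrivialSpectrum.finrank_le {V : Submodule ℝ (End ℝ E)} (hV : TrivialSpectrum V) :
    finrank ℝ V ≤ (finrank ℝ E).choose 2 := by
  let b := finBasis ℝ E
  let T : V →ₗ[ℝ] Matrix (Fin (finrank ℝ E)) (Fin (finrank ℝ E)) ℝ :=
    (LinearMap.toMatrix b b).toLinearMap ∘ₗ V.subtype
  refine finrank_le_choose_two_of_skew
    (T - (Matrix.transposeLinearEquiv _ _ ℝ ℝ).toLinearMap ∘ₗ T) ?_ ?_
  · intro f hf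
    have hsymm : (T f).IsHermitian := by
      simp only [LinearMap.sub_apply, sub_eq_zero] at hf
      rw [Matrix.IsHermitian, Matrix.conjTranspose_eq_transpose_of_trivial]
      exact hf.symm
    have h0 : T f = 0 := by
      rw [← hsymm.eigenvalues_eq_zero_iff]
      funext j
      by_contra hj
      simp only [Pi.zero_apply] at hj
      have hv := hsymm.mulVec_eigenvectorBasis j
      set v := (hsymm.eigenvectorBasis j).ofLp with hv'
      have hfix := hV ((hsymm.eigenvalues j)⁻¹ • f.1) (V.smul_mem _ f.2)
        (b.equivFun.symm v) (by
          apply b.equivFun.injective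
          have h1 := LinearMap.toMatrix_mulVec_repr b b f.1 (b.equivFun.symm v)
          have h2 : (b.repr (b.equivFun.symm v) : Fin _ → ℝ) = v :=
            b.equivFun.apply_symm_apply v
          rw [h2] at h1
          have h3 : b.equivFun (f.1 (b.equivFun.symm v)) = hsymm.eigenvalues j • v := by
            rw [← hv]; exact h1.symm
          rw [LinearMap.smul_apply, map_smul, h3, smul_smul, inv_mul_cancel₀ hj, one_smul,
            LinearEquiv.apply_symm_apply])
      have hv0 : v = 0 := b.equivFun.symm.map_eq_zero_iff.mp hfix
      exact hsymm.eigenvectorBasis.orthonormal.ne_zero j ((WithLp.ofLp_eq_zero 2).mp hv0)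
    exact Subtype.ext ((LinearMap.toMatrix b b).map_eq_zero_iff.mp h0)
  · intro f
    simp [Matrix.transpose_sub]

theorem IsMaxTrivialSpectrum.eq_of_le {V V' : Submodule ℝ (End ℝ E)}
    (hV : IsMaxTrivialSpectrum V) (hV' : TrivialSpectrum V') (hle : V ≤ V') : V = V' :=
  Submodule.eq_of_le_of_finrank_le hle (hV.2 ▸ hV'.finrank_le)

theorem TrivialSpectrum.sup_strictJoin {V : Submodule ℝ (End ℝ E)} (hV : TrivialSpectrum V)
    {U : Submodule ℝ E} (hU : ∀ f ∈ V, ∀ u ∈ U, f u ∈ U) :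
    TrivialSpectrum (V ⊔ strictJoin U) := by
  intro f hf x hx
  obtain ⟨g, hg, h, hh, rfl⟩ := Submodule.mem_sup.mp hf
  have hsurj : ∃ u ∈ U, u - g u = x - g x := by
    have hmem : x - g x ∈ U := by
      have : x - g x = h x := by
        rw [LinearMap.add_apply] at hx
        rw [sub_eq_iff_eq_add, add_comm, hx]
      rw [this]; exact hh.1 x
    let r : U →ₗ[ℝ] U := (LinearMap.id - g).restrict (p := U) (q := U)
      (fun u hu => U.sub_mem hu (hU g hg u hu))
    have hinj : Function.Injective r := by
      rw [injective_iff_map_eq_zero]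
      intro y hy
      exact Subtype.ext (hV g hg y (sub_eq_zero.mp (congrArg Subtype.val hy)).symm)
    obtain ⟨u, hu⟩ := LinearMap.injective_iff_surjective.mp hinj ⟨_, hmem⟩
    exact ⟨u, u.2, congrArg Subtype.val hu⟩
  obtain ⟨u, hu, hux⟩ := hsurj
  have hxu : x - u = 0 := hV g hg _ (by
    rw [map_sub]
    have : g x - g u = (x - u) - ((x - g x) - (u - g u)) := by abel
    rw [this, hux, sub_self, sub_zero])
  rw [sub_eq_zero] at hxu
  subst hxu
  exact hV g hg x (by simpa [hh.2 x hu] using hx)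

theorem IsMaxTrivialSpectrum.strictJoin_le {V : Submodule ℝ (End ℝ E)}
    (hV : IsMaxTrivialSpectrum V) {U : Submodule ℝ E} (hU : ∀ f ∈ V, ∀ u ∈ U, f u ∈ U) :
    strictJoin U ≤ V := by
  rw [hV.eq_of_le (hV.1.sup_strictJoin hU) le_sup_left]
  exact le_sup_right

/-- If `φ` kills all the vectors `(1 - s f)⁻¹ x` with `s ≠ 0` then it kills `x`. -/
theorem apply_eq_zero_of_resolvent {f : End ℝ E} (hf : ∀ s : ℝ, ∀ y, s • f y = y → y = 0)
    {φ : Dual ℝ E} {x : E} (h : ∀ s : ℝ, s ≠ 0 → ∀ y, y - s • f y = x → φ y = 0) : φ x = 0 := by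
  let b := finBasis ℝ E
  let A := LinearMap.toMatrix b b f
  let ψ : (Fin (finrank ℝ E) → ℝ) →ₗ[ℝ] ℝ := φ ∘ₗ b.equivFun.symm.toLinearMap
  let F : ℝ → ℝ := fun s => ψ ((1 - s • A).adjugate *ᵥ b.equivFun x)
  have hcont : Continuous F := by
    have h1 : Continuous ψ := LinearMap.continuous_of_finiteDimensional ψ
    have h2 : Continuous fun s : ℝ => (1 - s • A).adjugate := by
      apply Continuous.matrix_adjugate
      fun_prop
    exact h1.comp (h2.matrix_mulVec continuous_const)
  have hzero : ∀ s : ℝ, s ≠ 0 → F s = 0 := by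
    intro s hs
    have key : ∀ y : E, b.equivFun (y - s • f y) = (1 - s • A) *ᵥ b.equivFun y := by
      intro y
      have h1 : A *ᵥ b.equivFun y = b.equivFun (f y) := LinearMap.toMatrix_mulVec_repr b b f y
      rw [Matrix.sub_mulVec, Matrix.one_mulVec, Matrix.smul_mulVec, h1, map_sub, map_smul]
    have hsurj : ∃ y, y - s • f y = x := by
      have hinj : Function.Injective (LinearMap.id - s • f : E →ₗ[ℝ] E) := by
        rw [injective_iff_map_eq_zero]
        intro y hy
        exact hf s y (sub_eq_zero.mp hy).symm
      exact LinearMap.injective_iff_surjective.mp hinj x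
    obtain ⟨y, hy⟩ := hsurj
    have h0 := h s hs y hy
    change ψ ((1 - s • A).adjugate *ᵥ b.equivFun x) = 0
    rw [← hy, key, Matrix.mulVec_mulVec, Matrix.adjugate_mul, Matrix.smul_mulVec,
      Matrix.one_mulVec, map_smul]
    simp [ψ, h0]
  have hF0 : F 0 = φ x := by
    change φ (b.equivFun.symm ((1 - (0 : ℝ) • A).adjugate *ᵥ b.equivFun x)) = φ x
    rw [zero_smul, sub_zero, Matrix.adjugate_one, Matrix.one_mulVec, LinearEquiv.symm_apply_apply]
  rw [← hF0]
  have : Set.EqOn F 0 (closure {0}ᶜ) :=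
    Set.EqOn.closure (fun s hs => hzero s hs) hcont continuous_const
  exact this (by rw [(dense_compl_singleton (0 : ℝ)).closure_eq]; trivial)

theorem apply_pow_eq_zero_of_resolvent {f : End ℝ E}
    (hf : ∀ s : ℝ, ∀ y, s • f y = y → y = 0) {x : E} (k : ℕ) :
    ∀ φ : Dual ℝ E, (∀ s : ℝ, s ≠ 0 → ∀ y, y - s • f y = x → φ y = 0) →
      φ ((f ^ k) x) = 0 := by
  induction k with
  | zero => intro φ h; simpa using apply_eq_zero_of_resolvent hf h
  | succ k ih =>
    intro φ h
    have h0 := apply_eq_zero_of_resolvent hf h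
    have := ih (φ ∘ₗ f) (fun s hs y hy => by
      have h1 := h s hs y hy
      have h2 : y = x + s • f y := by rw [← hy]; abel
      rw [h2, map_add, h0, map_smul, zero_add, smul_eq_mul] at h1
      exact (mul_eq_zero.mp h1).resolve_left hs)
    rw [pow_succ', Module.End.mul_apply]
    exact this

theorem TrivialSpectrum.apply_pow_eq_zero {V : Submodule ℝ (End ℝ E)} (hV : TrivialSpectrum V)
    {g : End ℝ E} (hg : g ∈ V) {χ : Dual ℝ E} {x : E}
    (h : ∀ f ∈ V, ∀ z, z - f z = x → g z = χ z • x) {f : End ℝ E} (hf : f ∈ V) (k : ℕ) :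
    (∀ z, z - f z = x → χ z = 0) ∧ χ ((f ^ k) x) = 0 := by
  have key : ∀ f ∈ V, ∀ z, z - f z = x → χ z = 0 := by
    intro f hf z hz
    by_contra hne
    have hz0 := hV (f + (χ z)⁻¹ • g) (V.add_mem hf (V.smul_mem _ hg)) z (by
      rw [LinearMap.add_apply, LinearMap.smul_apply, h f hf z hz, smul_smul, inv_mul_cancel₀ hne,
        one_smul, ← hz]
      abel)
    simp [hz0] at hne
  refine ⟨key f hf, apply_pow_eq_zero_of_resolvent (fun s y hy => ?_) k χ fun s _ y hy => ?_⟩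
  · exact hV (s • f) (V.smul_mem s hf) y hy
  · exact key (s • f) (V.smul_mem s hf) y hy

theorem TrivialSpectrum.apply_pow_eq_zero_of_smulRight {V : Submodule ℝ (End ℝ E)}
    (hV : TrivialSpectrum V) {φ : Dual ℝ E} {x : E} (hφ : φ.smulRight x ∈ V)
    {f : End ℝ E} (hf : f ∈ V) (k : ℕ) :
    (∀ z, z - f z = x → φ z = 0) ∧ φ ((f ^ k) x) = 0 :=
  hV.apply_pow_eq_zero hφ (fun _ _ _ _ => rfl) hf k

/-- The rank one endomorphisms of a maximal trivial spectrum space are determined by the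
vectors `f x`, and `vertexSpace V x` is again maximal. -/
theorem IsMaxTrivialSpectrum.smulRight_mem_and_vertexSpace {V : Submodule ℝ (End ℝ E)}
    (hV : IsMaxTrivialSpectrum V) {x : E} (hx : x ≠ 0) :
    (∀ φ : Dual ℝ E, φ x = 0 → (∀ f ∈ V, φ (f x) = 0) → φ.smulRight x ∈ V) ∧
      IsMaxTrivialSpectrum (vertexSpace V x) := by
  set T : Dual ℝ E →ₗ[ℝ] End ℝ E :=
    { toFun := fun φ => φ.smulRight x
      map_add' := fun a b => by ext; simp [add_smul]
      map_smul' := fun c a => by ext; simp [mul_smul] } with hT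
  have hTinj : Function.Injective T := by
    rw [injective_iff_map_eq_zero]
    intro φ hφ
    ext y
    have : φ y • x = 0 := LinearMap.congr_fun hφ y
    simpa [hx] using this
  set K := V ⊓ LinearMap.ker (LinearMap.applyₗ x : End ℝ E →ₗ[ℝ] E) with hK
  set R := LinearMap.range (evalAt V x) with hR
  set A := ((ℝ ∙ x) ⊔ R).dualAnnihilator with hA
  set L := V.comap T with hL
  have hmemA : ∀ φ : Dual ℝ E, φ ∈ A ↔ φ x = 0 ∧ ∀ f ∈ V, φ (f x) = 0 := by
    intro φ
    rw [hA, Submodule.dualAnnihilator_sup_eq, Submodule.mem_inf, Submodule.mem_dualAnnihilator,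
      Submodule.mem_dualAnnihilator]
    constructor
    · rintro ⟨h1, h2⟩
      exact ⟨h1 x (Submodule.mem_span_singleton_self x), fun f hf => h2 _ ⟨⟨f, hf⟩, rfl⟩⟩
    · rintro ⟨h1, h2⟩
      refine ⟨fun w hw => ?_, ?_⟩
      · obtain ⟨c, rfl⟩ := Submodule.mem_span_singleton.mp hw
        simp [h1]
      · rintro _ ⟨f, rfl⟩
        exact h2 f.1 f.2
  have hLA : L ≤ A := by
    intro φ hφ
    rw [hmemA]
    refine ⟨?_, fun f hf => ?_⟩
    · simpa using (hV.1.apply_pow_eq_zero_of_smulRight hφ V.zero_mem 0).2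
    · simpa using (hV.1.apply_pow_eq_zero_of_smulRight hφ hf 1).2
  have hJ : strictJoin (ℝ ∙ x) = (ℝ ∙ x).dualAnnihilator.map T := by
    obtain ⟨ξ, hξ⟩ := Projective.exists_dual_eq_one ℝ hx
    ext h
    constructor
    · intro hh
      refine ⟨ξ ∘ₗ h, ?_, ?_⟩
      · rw [SetLike.mem_coe, Submodule.mem_dualAnnihilator]
        intro w hw
        simp [hh.2 w hw]
      · ext y
        obtain ⟨c, hc⟩ := Submodule.mem_span_singleton.mp (hh.1 y)
        simp [T, ← hc, hξ]
    · rintro ⟨χ, hχ, rfl⟩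
      rw [SetLike.mem_coe, Submodule.mem_dualAnnihilator] at hχ
      refine ⟨fun y => ?_, fun u hu => ?_⟩
      · exact Submodule.smul_mem _ _ (Submodule.mem_span_singleton_self x)
      · simp [T, hχ u hu]
  have hKJ : K ⊓ strictJoin (ℝ ∙ x) = L.map T := by
    rw [hJ]
    ext g
    constructor
    · rintro ⟨hg, φ, hφ, rfl⟩
      exact ⟨φ, hg.1, rfl⟩
    · rintro ⟨φ, hφ, rfl⟩
      have hφx := ((hmemA φ).mp (hLA hφ)).1
      refine ⟨⟨hφ, by simp [T, hφx]⟩, φ, ?_, rfl⟩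
      rw [SetLike.mem_coe, Submodule.mem_dualAnnihilator]
      intro w hw
      obtain ⟨c, rfl⟩ := Submodule.mem_span_singleton.mp hw
      simp [hφx]
  have hts : TrivialSpectrum (vertexSpace V x) := by
    refine TrivialSpectrum.sup_strictJoin (hV := fun f (hf : f ∈ K) => hV.1 f hf.1) ?_
    intro f hf u hu
    obtain ⟨c, rfl⟩ := Submodule.mem_span_singleton.mp hu
    have : f x = 0 := hf.2
    simp [this]
  have e1 := Submodule.finrank_sup_add_finrank_inf_eq K (strictJoin (ℝ ∙ x))
  have e2 : finrank ℝ (strictJoin (ℝ ∙ x) : Submodule ℝ (End ℝ E)) + 1 = finrank ℝ E := by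
    rw [hJ, ← (Submodule.equivMapOfInjective T hTinj _).finrank_eq,
      ← Subspace.finrank_add_finrank_dualAnnihilator_eq (ℝ ∙ x), finrank_span_singleton hx,
      add_comm]
  have e3 : finrank ℝ (K ⊓ strictJoin (ℝ ∙ x) : Submodule ℝ (End ℝ E)) = finrank ℝ L := by
    rw [hKJ, ← (Submodule.equivMapOfInjective T hTinj _).finrank_eq]
  have e4 := LinearMap.finrank_range_add_finrank_ker (evalAt V x)
  have e5 : finrank ℝ (LinearMap.ker (evalAt V x)) = finrank ℝ K := by
    rw [hK, ← Submodule.map_comap_subtype,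
      ← (Submodule.equivMapOfInjective V.subtype V.subtype_injective _).finrank_eq]
    rfl
  have e6 : finrank ℝ ((ℝ ∙ x) ⊔ R : Submodule ℝ E) = 1 + finrank ℝ R := by
    have hd : Disjoint (ℝ ∙ x) R := by
      rw [Submodule.disjoint_def]
      rintro w hw ⟨f, hf⟩
      obtain ⟨c, rfl⟩ := Submodule.mem_span_singleton.mp hw
      by_contra hc
      have hc : c ≠ 0 := fun h => hc (by simp [h])
      refine hx (hV.1 (c⁻¹ • f.1) (V.smul_mem _ f.2) x ?_)
      have hf : f.1 x = c • x := hf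
      rw [LinearMap.smul_apply, hf, smul_smul, inv_mul_cancel₀ hc, one_smul]
    have := Submodule.finrank_sup_add_finrank_inf_eq (ℝ ∙ x) R
    rw [hd.eq_bot, finrank_bot, finrank_span_singleton hx] at this
    simpa using this
  have e7 := Subspace.finrank_add_finrank_dualAnnihilator_eq ((ℝ ∙ x) ⊔ R)
  have e8 : finrank ℝ L ≤ finrank ℝ A := Submodule.finrank_mono hLA
  have e9 := hts.finrank_le
  have e10 := hV.2
  rw [← hA, e6] at e7
  rw [e5, ← hR] at e4
  rw [e3] at e1
  have e11 : finrank ℝ (vertexSpace V x)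
    = finrank ℝ (K ⊔ strictJoin (ℝ ∙ x) : Submodule ℝ (End ℝ E)) := rfl
  refine ⟨fun φ h1 h2 => ?_, hts, by omega⟩
  have hLA' : L = A := Submodule.eq_of_le_of_finrank_le hLA (by omega)
  have : φ ∈ L := hLA' ▸ (hmemA φ).mpr ⟨h1, h2⟩
  exact this

/-- A maximal trivial spectrum space that contains a rank one element has a nontrivial
invariant subspace. -/
theorem IsMaxTrivialSpectrum.exists_invariant {V : Submodule ℝ (End ℝ E)}
    (hV : IsMaxTrivialSpectrum V) {x : E} (hx : x ≠ 0) {φ : Dual ℝ E} (hφ : φ ≠ 0)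
    (hmem : φ.smulRight x ∈ V) :
    ∃ U : Submodule ℝ E, U ≠ ⊥ ∧ U ≠ ⊤ ∧ ∀ f ∈ V, ∀ u ∈ U, f u ∈ U := by
  let U : Submodule ℝ E := (ℝ ∙ x) ⊔ LinearMap.range (evalAt V x)
  have hU : ∀ w, w ∈ U ↔ ∀ ψ : Dual ℝ E, ψ.smulRight x ∈ V → ψ w = 0 := by
    intro w
    constructor
    · intro hw ψ hψ
      obtain ⟨a, ha, b, ⟨f, rfl⟩, rfl⟩ := Submodule.mem_sup.mp hw
      obtain ⟨c, rfl⟩ := Submodule.mem_span_singleton.mp ha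
      have h0 := (hV.1.apply_pow_eq_zero_of_smulRight hψ f.2 0).2
      have h1 := (hV.1.apply_pow_eq_zero_of_smulRight hψ f.2 1).2
      rw [pow_zero, Module.End.one_apply] at h0
      rw [pow_one] at h1
      rw [map_add, map_smul, h0, smul_zero, zero_add]
      exact h1
    · intro h
      rw [← Subspace.forall_mem_dualAnnihilator_apply_eq_zero_iff]
      intro ψ hψ
      rw [Submodule.mem_dualAnnihilator] at hψ
      refine h ψ ((hV.smulRight_mem_and_vertexSpace hx).1 ψ ?_ ?_)
      · exact hψ x (Submodule.mem_sup_left (Submodule.mem_span_singleton_self x))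
      · exact fun f hf => hψ _ (Submodule.mem_sup_right ⟨⟨f, hf⟩, rfl⟩)
  have hxU : x ∈ U := Submodule.mem_sup_left (Submodule.mem_span_singleton_self x)
  have hinv : ∀ g ∈ vertexSpace V x, ∀ u ∈ U, g u ∈ U := by
    intro g hg u hu
    obtain ⟨f, hf, hfx, χ, hχ, rfl⟩ := mem_vertexSpace.mp hg
    refine U.add_mem ?_ (U.smul_mem _ hxU)
    obtain ⟨a, ha, b, ⟨N, rfl⟩, rfl⟩ := Submodule.mem_sup.mp hu
    obtain ⟨c, rfl⟩ := Submodule.mem_span_singleton.mp ha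
    rw [map_add, map_smul, hfx, smul_zero, zero_add, hU]
    intro ψ hψ
    have h1 := (hV.1.apply_pow_eq_zero_of_smulRight hψ (V.add_mem hf N.2) 2).2
    have h2 := (hV.1.apply_pow_eq_zero_of_smulRight hψ N.2 2).2
    simp only [pow_two, Module.End.mul_apply, LinearMap.add_apply, hfx, map_add,
      zero_add] at h1 h2
    rw [h2, add_zero] at h1
    exact h1
  have hJ := (hV.smulRight_mem_and_vertexSpace hx).2.strictJoin_le hinv
  refine ⟨U, fun h => hx (by simpa [h] using hxU), fun h => hφ ?_, fun f hf u hu => ?_⟩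
  · ext w
    exact (hU w).mp (h ▸ Submodule.mem_top) φ hmem
  rw [hU]
  intro ψ hψ
  have hmemJ : ψ.smulRight u ∈ strictJoin U :=
    ⟨fun y => U.smul_mem _ hu, fun w hw => by simp [(hU w).mp hw ψ hψ]⟩
  obtain ⟨g, hg, hgx, χ, hχ, hsum⟩ := mem_vertexSpace.mp (hJ hmemJ)
  have hχmem : χ.smulRight x ∈ V := by
    have key : ∀ f ∈ V, ∀ z, z - f z = x → g z = (-χ) z • x := by
      intro f hf z hz
      have h1 := (hV.1.apply_pow_eq_zero_of_smulRight hψ hf 0).1 z hz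
      have h2 := LinearMap.congr_fun hsum z
      simp only [LinearMap.smulRight_apply, LinearMap.add_apply, h1, zero_smul] at h2
      rw [LinearMap.neg_apply, neg_smul]
      exact eq_neg_of_add_eq_zero_left h2.symm
    refine (hV.smulRight_mem_and_vertexSpace hx).1 χ hχ fun f hf => ?_
    simpa using (hV.1.apply_pow_eq_zero hg key hf 1).2
  have hmemV : ψ.smulRight u ∈ V := hsum ▸ V.add_mem hg hχmem
  simpa using (hV.1.apply_pow_eq_zero_of_smulRight hmemV hf 1).2

/-- The linear form `ψ` kills all the vectors `f x` with `f ∈ V`. -/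
def IsPolar (V : Submodule ℝ (End ℝ E)) (x : E) (ψ : Dual ℝ E) : Prop :=
  ∀ f ∈ V, ψ (f x) = 0

/-- A space of endomorphisms without rank one elements. -/
def RankOneFree (V : Submodule ℝ (End ℝ E)) : Prop :=
  ∀ (φ : Dual ℝ E) (x : E), φ.smulRight x ∈ V → x = 0 ∨ φ = 0

section Irreducible

variable {V : Submodule ℝ (End ℝ E)}

omit [FiniteDimensional ℝ E] in
theorem notMem_span_symm {x h : E} (hx : x ≠ 0) (hh : h ∉ ℝ ∙ x) : x ∉ ℝ ∙ h := by
  intro hmem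
  obtain ⟨c, rfl⟩ := Submodule.mem_span_singleton.mp hmem
  have hc : c ≠ 0 := fun h0 => hx (by simp [h0])
  exact hh (Submodule.mem_span_singleton.mpr ⟨c⁻¹, by rw [smul_smul, inv_mul_cancel₀ hc, one_smul]⟩)

omit [FiniteDimensional ℝ E] in
theorem ne_zero_of_notMem_span {x h : E} (hh : h ∉ ℝ ∙ x) : h ≠ 0 :=
  fun h0 => hh (h0 ▸ Submodule.zero_mem _)

theorem IsPolar.eq_zero (hV : IsMaxTrivialSpectrum V) (hR : RankOneFree V) {x : E}
    {ψ : Dual ℝ E} (hψ : IsPolar V x ψ) (h0 : ψ x = 0) : x = 0 ∨ ψ = 0 := by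
  by_cases hx : x = 0
  · exact Or.inl hx
  · exact hR ψ x ((hV.smulRight_mem_and_vertexSpace hx).1 ψ h0 hψ)

omit [FiniteDimensional ℝ E] in
theorem exists_isPolar (hV : TrivialSpectrum V) {x : E} (hx : x ≠ 0) :
    ∃ ψ : Dual ℝ E, ψ ≠ 0 ∧ IsPolar V x ψ := by
  have hnot : x ∉ LinearMap.range (evalAt V x) := by
    rintro ⟨f, hf⟩
    exact hx (hV f.1 f.2 x hf)
  obtain ⟨ψ, hψ, hmap⟩ := Submodule.exists_dual_map_eq_bot_of_notMem hnot inferInstance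
  refine ⟨ψ, fun h => hψ (by simp [h]), fun f hf => ?_⟩
  have : ψ (f x) ∈ (LinearMap.range (evalAt V x)).map ψ :=
    Submodule.mem_map_of_mem ⟨⟨f, hf⟩, rfl⟩
  rwa [hmap, Submodule.mem_bot] at this

theorem IsPolar.exists_eq_smul (hV : IsMaxTrivialSpectrum V) (hR : RankOneFree V) {x : E}
    (hx : x ≠ 0) {ψ φ : Dual ℝ E} (hψ : IsPolar V x ψ) (hψ0 : ψ ≠ 0) (hφ : IsPolar V x φ) :
    ∃ c : ℝ, φ = c • ψ := by
  have hψx : ψ x ≠ 0 := fun h => (hψ.eq_zero hV hR h).elim hx hψ0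
  refine ⟨φ x / ψ x, ?_⟩
  have hp : IsPolar V x (φ - (φ x / ψ x) • ψ) := fun f hf => by simp [hψ f hf, hφ f hf]
  refine sub_eq_zero.mp ((hp.eq_zero hV hR ?_).resolve_left hx)
  simp [hψx]

theorem IsPolar.mem_span (hV : IsMaxTrivialSpectrum V) (hR : RankOneFree V) {x y : E}
    (hx : x ≠ 0) {ψ : Dual ℝ E} (hψ0 : ψ ≠ 0) (hψ : IsPolar V x ψ) (hψy : IsPolar V y ψ) :
    y ∈ ℝ ∙ x := by
  have hψx : ψ x ≠ 0 := fun h => (hψ.eq_zero hV hR h).elim hx hψ0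
  have hp : IsPolar V (y - (ψ y / ψ x) • x) ψ := fun f hf => by simp [hψ f hf, hψy f hf]
  have h0 := (hp.eq_zero hV hR (by simp [hψx])).resolve_right hψ0
  exact Submodule.mem_span_singleton.mpr ⟨_, (sub_eq_zero.mp h0).symm⟩

/-- An element of `V` vanishing at `x` takes its values in `V x`. -/
theorem IsPolar.apply_eq_zero (hV : IsMaxTrivialSpectrum V) (hR : RankOneFree V) {x : E}
    (hx : x ≠ 0) {ψ : Dual ℝ E} (hψ : IsPolar V x ψ) {f : End ℝ E} (hf : f ∈ V)
    (hfx : f x = 0) (h : E) : ψ (f h) = 0 := by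
  by_cases hψ0 : ψ = 0
  · simp [hψ0]
  have hψx : ψ x ≠ 0 := fun h => (hψ.eq_zero hV hR h).elim hx hψ0
  by_contra hne
  let π : Dual ℝ E := (ψ x)⁻¹ • ψ
  have hπx : π x = 1 := by simp [π, hψx]
  have hrange : ∀ w, ψ w = 0 → w ∈ LinearMap.range (evalAt V x) := by
    intro w hw
    rw [← Subspace.forall_mem_dualAnnihilator_apply_eq_zero_iff]
    intro φ hφ
    rw [Submodule.mem_dualAnnihilator] at hφ
    obtain ⟨c, rfl⟩ := hψ.exists_eq_smul hV hR hx hψ0 (φ := φ) fun g hg => hφ _ ⟨⟨g, hg⟩, rfl⟩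
    simp [hw]
  obtain ⟨S, hS⟩ : ∃ S : E →ₗ[ℝ] V, ∀ w, (S w).1 x = w - π w • x := by
    obtain ⟨s, hs⟩ := LinearMap.exists_rightInverse_of_surjective (evalAt V x).rangeRestrict
      (LinearMap.range_rangeRestrict _)
    let p : E →ₗ[ℝ] LinearMap.range (evalAt V x) :=
      (LinearMap.id - π.smulRight x : E →ₗ[ℝ] E).codRestrict _ fun w => hrange _ (by
        simp only [π, LinearMap.sub_apply, LinearMap.id_apply, LinearMap.smulRight_apply,
          LinearMap.smul_apply, smul_eq_mul, map_sub, map_smul]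
        field_simp
        ring)
    exact ⟨s ∘ₗ p, fun w => congrArg Subtype.val (LinearMap.congr_fun hs (p w))⟩
  let e₀ : End ℝ E := LinearMap.id - π.smulRight x + π.smulRight (f h)
  have he₀ : ∀ w, e₀ w = w - π w • x + π w • f h := fun w => rfl
  have hinj : Function.Injective e₀ := by
    rw [injective_iff_map_eq_zero]
    intro w hw
    have h1 : π (e₀ w) = π w * π (f h) := by simp [he₀, hπx]
    have h2 : π (f h) ≠ 0 := by simp [π, hψx, hne]
    rw [hw, map_zero, eq_comm, mul_eq_zero] at h1
    have h3 := h1.resolve_right h2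
    simpa [he₀, h3] using hw
  let e := LinearEquiv.ofInjectiveEndo e₀ hinj
  have hee : ∀ w, e w = e₀ w := fun w => rfl
  let F : End ℝ E :=
    { toFun := fun w => (S w).1 h
      map_add' := fun a b => by simp
      map_smul' := fun c a => by simp }
  let G : End ℝ E := e.symm.toLinearMap ∘ₗ F
  obtain ⟨μ, hμ⟩ := ((Module.End.finite_spectrum G).infinite_compl).nonempty
  rw [Set.mem_compl_iff, spectrum.notMem_iff, Module.End.isUnit_iff] at hμ
  obtain ⟨w, hw⟩ := hμ.2 (e.symm (μ • x - h))
  have hw' : μ • e₀ w - (S w).1 h = μ • x - h := by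
    have h1 := congrArg e hw
    rw [LinearEquiv.apply_symm_apply] at h1
    rw [← h1, LinearMap.sub_apply, map_sub]
    congr 1
    · rw [← hee, ← map_smul]
      rfl
    · exact (e.apply_symm_apply _).symm
  have hfix := hV.1 ((S w).1 - (μ * π w) • f) (V.sub_mem (S w).2 (V.smul_mem _ hf))
    (μ • x - h) (by
      refine Eq.trans ?_ hw'
      simp only [he₀, LinearMap.sub_apply, map_sub, map_smul, LinearMap.smul_apply, hS, hfx]
      module)
  rw [sub_eq_zero] at hfix
  apply hne
  rw [← hfix, map_smul, hfx, smul_zero, map_zero]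

theorem exists_eq_smul_add_smul (hV : IsMaxTrivialSpectrum V) (hR : RankOneFree V) {x h : E}
    (hh0 : h ≠ 0) (hxh : x ∉ ℝ ∙ h) {ψ θ φ : Dual ℝ E} (hψ : IsPolar V x ψ) (hψ0 : ψ ≠ 0)
    (hθ : IsPolar V h θ) (hθ0 : θ ≠ 0) (hφ : ∀ f ∈ V, f h = 0 → φ (f x) = 0) :
    ∃ a b : ℝ, φ = a • ψ + b • θ := by
  have hθh : θ h ≠ 0 := fun h => (hθ.eq_zero hV hR h).elim hh0 hθ0
  set x' := x - (θ x / θ h) • h with hx'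
  have hθx' : θ x' = 0 := by simp [hx', hθh]
  have hx'0 : x' ≠ 0 := fun h0 =>
    hxh (Submodule.mem_span_singleton.mpr ⟨_, (sub_eq_zero.mp h0).symm⟩)
  have key : ∀ ξ : Dual ℝ E, ξ h = 0 → ξ x' = 0 → (∀ f ∈ V, f h = 0 → ξ (f x) = 0) → ξ = 0 := by
    intro ξ hξh hξx' hξ
    have hvert := (hV.smulRight_mem_and_vertexSpace hh0).2
    have hmem := (hvert.smulRight_mem_and_vertexSpace hx'0).1 ξ hξx' (by
      intro g hg
      obtain ⟨f, hf, hfh, χ, hχ, rfl⟩ := mem_vertexSpace.mp hg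
      simp [hx', hfh, hξh, hξ f hf hfh])
    obtain ⟨f, hf, hfh, χ, hχ, hsum⟩ := mem_vertexSpace.mp hmem
    have hχ0 : χ = 0 := by
      ext y
      have h1 := congrArg θ (LinearMap.congr_fun hsum y)
      simp only [LinearMap.smulRight_apply, LinearMap.add_apply, map_add, map_smul, hθx',
        hθ.apply_eq_zero hV hR hh0 hf hfh y, mul_zero, zero_add, smul_eq_mul] at h1
      exact (mul_eq_zero.mp h1.symm).resolve_right hθh
    have : ξ.smulRight x' ∈ V := by
      rw [hsum, hχ0]
      convert hf using 1
      ext; simp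
    exact (hR _ _ this).resolve_left hx'0
  have hθk : ∀ f ∈ V, f h = 0 → θ (f x) = 0 := fun f hf hfh =>
    hθ.apply_eq_zero hV hR hh0 hf hfh x
  set F := ψ - (ψ h / θ h) • θ with hF
  have hFh : F h = 0 := by simp [hF, hθh]
  have hFk : ∀ f ∈ V, f h = 0 → F (f x) = 0 := fun f hf hfh => by
    simp [hF, hψ f hf, hθk f hf hfh]
  have hFx' : F x' ≠ 0 := by
    intro h0
    have hF0 := key F hFh h0 hFk
    rw [hF, sub_eq_zero] at hF0
    have hψh : IsPolar V h ψ := fun f hf => by rw [hF0]; simp [hθ f hf]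
    exact hxh (hψh.mem_span hV hR hh0 hψ0 hψ)
  have hz := key (φ - (φ h / θ h) • θ - ((φ x' / F x') • F)) (by simp [hFh, hθh])
    (by simp [hθx', hFx']) (fun f hf hfh => by simp [hφ f hf hfh, hθk f hf hfh, hFk f hf hfh])
  obtain ⟨c, hc⟩ : ∃ c, φ x' / F x' = c := ⟨_, rfl⟩
  rw [hc, sub_eq_zero, sub_eq_iff_eq_add, hF] at hz
  refine ⟨c, φ h / θ h - c * (ψ h / θ h), hz.trans ?_⟩
  module

/-- The polar forms at two independent vectors are related by a skew-symmetry up to scaling. -/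
theorem IsPolar.exists_skew (hV : IsMaxTrivialSpectrum V) (hR : RankOneFree V) {x h : E}
    (hx : x ≠ 0) (hhx : h ∉ ℝ ∙ x) {ψ θ : Dual ℝ E} (hψ : IsPolar V x ψ) (hψ0 : ψ ≠ 0)
    (hθ : IsPolar V h θ) (hθ0 : θ ≠ 0) :
    ∃ a : ℝ, a ≠ 0 ∧ ∀ f ∈ V, θ (f x) = a * ψ (f h) := by
  have hh0 := ne_zero_of_notMem_span hhx
  have hxh := notMem_span_symm hx hhx
  obtain ⟨φ, hφ⟩ : ∃ φ : Dual ℝ E, (evalAt V h).dualMap φ = θ ∘ₗ evalAt V x := by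
    rw [← LinearMap.mem_range, LinearMap.range_dualMap_eq_dualAnnihilator_ker,
      Submodule.mem_dualAnnihilator]
    exact fun f hf => hθ.apply_eq_zero hV hR hh0 f.2 hf x
  have hφ' : ∀ f ∈ V, φ (f h) = θ (f x) := fun f hf => LinearMap.congr_fun hφ ⟨f, hf⟩
  obtain ⟨b, a, hab⟩ := exists_eq_smul_add_smul hV hR hx hhx hθ hθ0 hψ hψ0 (φ := φ)
    (fun f hf hfx => by rw [hφ' f hf, hfx, map_zero])
  have hfin : ∀ f ∈ V, θ (f x) = a * ψ (f h) := fun f hf => by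
    rw [← hφ' f hf, hab]
    simp [hθ f hf]
  refine ⟨a, fun ha => ?_, hfin⟩
  have hθx : IsPolar V x θ := fun f hf => by rw [hfin f hf, ha, zero_mul]
  exact hxh (hθ.mem_span hV hR hh0 hθ0 hθx)

theorem IsMaxTrivialSpectrum.exists_form (hV : IsMaxTrivialSpectrum V) (hR : RankOneFree V) :
    ∃ b : E →ₗ[ℝ] Dual ℝ E, (∀ h, b h = 0 → h = 0) ∧ ∀ f ∈ V, ∀ h, b h (f h) = 0 := by
  by_cases hE : ∀ x : E, x = 0
  · exact ⟨0, fun h _ => hE h, fun _ _ _ => rfl⟩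
  push Not at hE
  obtain ⟨x, hx⟩ := hE
  by_cases hdim : ∀ l : E, l ∈ ℝ ∙ x
  · obtain ⟨ξ, hξ⟩ := Projective.exists_dual_eq_one ℝ hx
    refine ⟨ξ.smulRight ξ, fun h hh => ?_, fun f hf h => ?_⟩
    · obtain ⟨c, rfl⟩ := Submodule.mem_span_singleton.mp (hdim h)
      have := LinearMap.congr_fun hh x
      have hc : c = 0 := by simpa [hξ] using this
      simp [hc]
    · obtain ⟨c, rfl⟩ := Submodule.mem_span_singleton.mp (hdim h)
      obtain ⟨d, hd⟩ := Submodule.mem_span_singleton.mp (hdim (f x))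
      have hd0 : d = 0 := by
        by_contra hd0
        refine hx (hV.1 (d⁻¹ • f) (V.smul_mem _ hf) x ?_)
        rw [LinearMap.smul_apply, ← hd, smul_smul, inv_mul_cancel₀ hd0, one_smul]
      simp [← hd, hd0]
  push Not at hdim
  obtain ⟨l, hl⟩ := hdim
  have hl0 := ne_zero_of_notMem_span hl
  have hxl := notMem_span_symm hx hl
  obtain ⟨ψ, hψ0, hψ⟩ := exists_isPolar hV.1 hx
  obtain ⟨θ, hθ0, hθ, hskew⟩ : ∃ θ : Dual ℝ E, θ ≠ 0 ∧ IsPolar V l θ ∧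
      ∀ f ∈ V, θ (f x) = - ψ (f l) := by
    obtain ⟨θ, hθ0, hθ⟩ := exists_isPolar hV.1 hl0
    obtain ⟨a, ha, h⟩ := hψ.exists_skew hV hR hx hl hψ0 hθ hθ0
    refine ⟨-a⁻¹ • θ, by simp [ha, hθ0], fun f hf => by simp [hθ f hf], fun f hf => ?_⟩
    simp [h f hf, ha]
  have hindep : ∀ α β : ℝ, α • ψ + β • θ = 0 → α = 0 ∧ β = 0 := by
    intro α β h0
    have hα : α = 0 := by
      by_contra hα
      refine hl (hψ.mem_span hV hR hx hψ0 fun f hf => ?_)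
      have := LinearMap.congr_fun h0 (f l)
      simpa [hθ f hf, hα] using this
    subst hα
    exact ⟨rfl, by simpa [hθ0] using h0⟩
  have hsum : ∀ α β : ℝ, IsPolar V (α • x + β • l) (α • ψ + β • θ) := by
    intro α β f hf
    simp only [map_add, map_smul, LinearMap.add_apply, LinearMap.smul_apply, hψ f hf, hθ f hf,
      hskew f hf, smul_eq_mul]
    ring
  have hex : ∀ h : E, ∃ η : Dual ℝ E, (∀ f ∈ V, η (f x) = -ψ (f h)) ∧
      (∀ f ∈ V, η (f l) = -θ (f h)) ∧ IsPolar V h η := by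
    intro h
    by_cases hspan : ∃ α β : ℝ, h = α • x + β • l
    · obtain ⟨α, β, rfl⟩ := hspan
      refine ⟨α • ψ + β • θ, fun f hf => ?_, fun f hf => ?_, hsum α β⟩
      · simp [hψ f hf, hskew f hf]
      · simp [hθ f hf, hskew f hf]
    · push Not at hspan
      have hhx : h ∉ ℝ ∙ x := fun hm => by
        obtain ⟨c, rfl⟩ := Submodule.mem_span_singleton.mp hm
        exact hspan c 0 (by simp)
      have hhl : h ∉ ℝ ∙ l := fun hm => by
        obtain ⟨c, rfl⟩ := Submodule.mem_span_singleton.mp hm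
        exact hspan 0 c (by simp)
      have hhs : h ∉ ℝ ∙ (x + l) := fun hm => by
        obtain ⟨c, rfl⟩ := Submodule.mem_span_singleton.mp hm
        exact hspan c c (by simp)
      have hs0 : x + l ≠ 0 := fun h0 =>
        hxl (Submodule.mem_span_singleton.mpr ⟨-1, by
          rw [neg_one_smul]
          exact (eq_neg_of_add_eq_zero_left h0).symm⟩)
      obtain ⟨η, hη0, hη, hηx⟩ : ∃ η : Dual ℝ E, η ≠ 0 ∧ IsPolar V h η ∧
          ∀ f ∈ V, η (f x) = - ψ (f h) := by
        obtain ⟨η, hη0, hη⟩ := exists_isPolar hV.1 (ne_zero_of_notMem_span hhx)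
        obtain ⟨a, ha, h⟩ := hψ.exists_skew hV hR hx hhx hψ0 hη hη0
        refine ⟨-a⁻¹ • η, by simp [ha, hη0], fun f hf => by simp [hη f hf], fun f hf => ?_⟩
        simp [h f hf, ha]
      obtain ⟨c, -, hc⟩ := hθ.exists_skew hV hR hl0 hhl hθ0 hη hη0
      have hs : IsPolar V (x + l) (ψ + θ) := by simpa using hsum 1 1
      have hs0' : ψ + θ ≠ 0 := fun h0 => by
        have := hindep 1 1 (by simpa using h0)
        norm_num at this
      obtain ⟨e, -, he⟩ := hs.exists_skew hV hR hs0 hhs hs0' hη hη0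
      have hpol : IsPolar V h ((-1 - e) • ψ + (c - e) • θ) := fun f hf => by
        have h1 := he f hf
        simp only [map_add, LinearMap.add_apply, hηx f hf, hc f hf] at h1
        simp only [LinearMap.add_apply, LinearMap.smul_apply, smul_eq_mul]
        linarith
      have hzero : (-1 - e) • ψ + (c - e) • θ = 0 := by
        by_contra hne
        by_cases hv : (-1 - e) • x + (c - e) • l = 0
        · have hα : -1 - e = 0 := by
            by_contra hα
            refine hxl (Submodule.mem_span_singleton.mpr ⟨-((-1 - e)⁻¹ * (c - e)), ?_⟩)
            have := congrArg ((-1 - e)⁻¹ • ·) hv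
            simp only [smul_add, smul_smul, inv_mul_cancel₀ hα, one_smul, smul_zero] at this
            rw [neg_smul]
            exact (eq_neg_of_add_eq_zero_left this).symm
          rw [hα, zero_smul, zero_add, smul_eq_zero] at hv
          exact hne (by rw [hα, hv.resolve_right hl0]; simp)
        · obtain ⟨d, hd⟩ := Submodule.mem_span_singleton.mp
            ((hsum (-1 - e) (c - e)).mem_span hV hR hv hne hpol)
          exact hspan (d * (-1 - e)) (d * (c - e)) (by
            rw [← hd, smul_add, smul_smul, smul_smul])
      obtain ⟨h1, h2⟩ := hindep _ _ hzero
      refine ⟨η, hηx, fun f hf => ?_, hη⟩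
      rw [hc f hf, show c = -1 by linarith, neg_one_mul]
  have huniq : ∀ η η' : Dual ℝ E, (∀ f ∈ V, η (f x) = η' (f x)) →
      (∀ f ∈ V, η (f l) = η' (f l)) → η = η' := by
    intro η η' h1 h2
    by_contra hne
    have hp : IsPolar V x (η - η') := fun f hf => by simp [h1 f hf]
    exact hl (hp.mem_span hV hR hx (sub_ne_zero.mpr hne) fun f hf => by simp [h2 f hf])
  choose b hbx hbl hb using hex
  refine ⟨{ toFun := b, map_add' := ?_, map_smul' := ?_ }, fun h hh => ?_, fun f hf h => hb h f hf⟩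
  · intro u v
    refine huniq _ _ (fun f hf => ?_) (fun f hf => ?_)
    · rw [LinearMap.add_apply, hbx _ f hf, hbx _ f hf, hbx _ f hf, map_add, map_add]; ring
    · rw [LinearMap.add_apply, hbl _ f hf, hbl _ f hf, hbl _ f hf, map_add, map_add]; ring
  · intro c v
    refine huniq _ _ (fun f hf => ?_) (fun f hf => ?_)
    · simp [hbx _ f hf]
    · simp [hbl _ f hf]
  · have hh : b h = 0 := hh
    by_contra hne
    have h1 : IsPolar V h ψ := fun f hf => by
      have := hbx h f hf
      rw [hh, LinearMap.zero_apply] at this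
      linarith
    have h2 : IsPolar V h θ := fun f hf => by
      have := hbl h f hf
      rw [hh, LinearMap.zero_apply] at this
      linarith
    obtain ⟨c, hc⟩ := Submodule.mem_span_singleton.mp (h1.mem_span hV hR hne hψ0 hψ)
    obtain ⟨d, rfl⟩ := Submodule.mem_span_singleton.mp (hθ.mem_span hV hR hl0 hθ0 h2)
    exact hxl (Submodule.mem_span_singleton.mpr ⟨c * d, by rw [← hc, smul_smul]⟩)

end Irreducible

/-- Up to equivalence, the affine space `id + V` is the space `1 + S` of matrices. -/
def IsModelledOn {n : ℕ} (V : Submodule ℝ (End ℝ E)) (S : Set (Matrix (Fin n) (Fin n) ℝ)) : Prop :=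
  ∃ p q : E ≃ₗ[ℝ] (Fin n → ℝ), ∀ f : End ℝ E, f ∈ V ↔
    ∃ M ∈ S, ∀ e, p (e + f e) = q e + M *ᵥ q e

/-- An anisotropic real quadratic form is a scaled sum of squares. -/
theorem exists_eq_smul_dotProduct_of_anisotropic (Q : QuadraticForm ℝ E) (hQ : Q.Anisotropic) :
    ∃ (ε : ℝ) (q : E ≃ₗ[ℝ] (Fin (finrank ℝ E) → ℝ)), ε ≠ 0 ∧
      ∀ h, Q h = ε * (q h ⬝ᵥ q h) := by
  obtain ⟨w, hw, ⟨q⟩⟩ := QuadraticForm.equivalent_one_neg_one_weighted_sum_squared Q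
    (QuadraticMap.separatingLeft_of_anisotropic Q hQ)
  have hq : ∀ h, Q h = ∑ i, w i * (q h i * q h i) := fun h => by
    rw [← q.map_app h, QuadraticMap.weightedSumSquares_apply]
    rfl
  have hconst : ∀ i j, w i = w j := by
    by_contra! hne
    obtain ⟨i, j, hij⟩ := hne
    have hsum : w i + w j = 0 := by
      rcases hw i with h | h <;> rcases hw j with h' | h' <;> simp_all
    have hne' : i ≠ j := fun h => hij (h ▸ rfl)
    let v : Fin (finrank ℝ E) → ℝ := Pi.single i 1 + Pi.single j 1
    have hv : Q (q.symm v) = 0 := by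
      have hqv : q (q.symm v) = v := q.toLinearEquiv.apply_symm_apply v
      rw [hq, hqv, ← hsum, ← Finset.sum_subset (Finset.subset_univ {i, j}),
        Finset.sum_pair hne']
      · simp [v, hne', hne'.symm]
      · intro k _ hk
        simp only [Finset.mem_insert, Finset.mem_singleton, not_or] at hk
        simp [v, hk.1, hk.2]
    have hv0 : v = 0 := by
      have h0 := congrArg q (hQ _ hv)
      rwa [show q (q.symm v) = v from q.toLinearEquiv.apply_symm_apply v,
        show q 0 = 0 from map_zero q.toLinearEquiv] at h0
    have := congrFun hv0 i
    simp [v, hne'] at this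
  obtain ⟨ε, hε, hwε⟩ : ∃ ε : ℝ, ε ≠ 0 ∧ ∀ i, w i = ε := by
    rcases isEmpty_or_nonempty (Fin (finrank ℝ E)) with h | ⟨⟨i⟩⟩
    · exact ⟨1, one_ne_zero, fun i => h.elim i⟩
    · refine ⟨w i, ?_, fun j => hconst j i⟩
      rcases hw i with h | h <;> simp [h]
  refine ⟨ε, q.toLinearEquiv, hε, fun h => ?_⟩
  rw [hq, dotProduct, Finset.mul_sum]
  exact Finset.sum_congr rfl fun i _ => by rw [hwε]; rfl

theorem IsMaxTrivialSpectrum.isModelledOn_altSet {V : Submodule ℝ (End ℝ E)}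
    (hV : IsMaxTrivialSpectrum V) (hR : RankOneFree V) :
    IsModelledOn V (altSet ℝ (finrank ℝ E)) := by
  obtain ⟨b, hb, hbV⟩ := hV.exists_form hR
  have haniso : ∀ h, b h h = 0 → h = 0 := fun h hh =>
    (IsPolar.eq_zero hV hR (fun f hf => hbV f hf h) hh).elim id (hb h)
  let K : Submodule ℝ (End ℝ E) :=
    { carrier := {f | ∀ h, b h (f h) = 0}
      add_mem' := fun {f g} hf hg h => by simp [hf h, hg h]
      zero_mem' := fun h => by simp
      smul_mem' := fun c f hf h => by simp [hf h] }
  have hVK : V = K := hV.eq_of_le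
    (fun f hf x hx => haniso x (by simpa [hx] using hf x)) (fun f hf h => hbV f hf h)
  have hmem : ∀ f, f ∈ V ↔ ∀ h, b h (f h) = 0 := fun f => by rw [hVK]; rfl
  obtain ⟨ε, q, hε, hq⟩ := exists_eq_smul_dotProduct_of_anisotropic
    (LinearMap.BilinMap.toQuadraticMap b) (fun h hh => haniso h hh)
  replace hq : ∀ h, b h h = ε * (q h ⬝ᵥ q h) := hq
  let p₀ : E →ₗ[ℝ] (Fin (finrank ℝ E) → ℝ) :=
    LinearMap.pi fun i => ε⁻¹ • b (q.symm (fun j => if i = j then 1 else 0))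
  have hp₀ : ∀ h y, q h ⬝ᵥ p₀ y = ε⁻¹ * b h y := by
    intro h y
    have h1 := LinearMap.pi_apply_eq_sum_univ ((b.flip y) ∘ₗ q.symm.toLinearMap) (q h)
    simp only [LinearMap.comp_apply, LinearEquiv.coe_coe, LinearEquiv.symm_apply_apply,
      LinearMap.flip_apply, smul_eq_mul] at h1
    rw [h1, dotProduct, Finset.mul_sum]
    refine Finset.sum_congr rfl fun i _ => ?_
    simp only [p₀, LinearMap.pi_apply, LinearMap.smul_apply, smul_eq_mul]
    ring
  have hinj : Function.Injective p₀ := by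
    rw [injective_iff_map_eq_zero]
    intro y hy
    have := hp₀ y y
    rw [hy, dotProduct_zero, eq_comm, mul_eq_zero] at this
    exact haniso y (this.resolve_left (inv_ne_zero hε))
  let p : E ≃ₗ[ℝ] (Fin (finrank ℝ E) → ℝ) := LinearEquiv.ofInjectiveOfFinrankEq p₀ hinj (by simp)
  have hp : ∀ h y, q h ⬝ᵥ p y = ε⁻¹ * b h y := hp₀
  refine ⟨p, q, fun f => ⟨fun hf => ?_, ?_⟩⟩
  · let A := LinearMap.toMatrix' (p.toLinearMap ∘ₗ (1 + f) ∘ₗ q.symm.toLinearMap) - 1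
    have hA : ∀ e, A *ᵥ q e = p (e + f e) - q e := fun e => by
      simp [A, Matrix.sub_mulVec, LinearMap.toMatrix'_mulVec]
    refine ⟨A, fun X => ?_, fun e => by rw [hA]; abel⟩
    obtain ⟨h, rfl⟩ := q.surjective X
    rw [hA, dotProduct_sub, hp, map_add, (hmem f).1 hf, hq]
    field_simp
    ring
  · rintro ⟨A, hA, hAf⟩
    refine (hmem f).2 fun h => ?_
    have h1 := congrArg (q h ⬝ᵥ ·) (hAf h)
    simp only [hp, dotProduct_add, hA (q h), map_add, hq h] at h1
    field_simp at h1
    linarith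

theorem choose_two_add (k m : ℕ) : (k + m).choose 2 = k.choose 2 + m.choose 2 + k * m := by
  induction m with
  | zero => simp
  | succ m ih =>
    rw [← add_assoc, Nat.choose_succ_succ' (k + m) 1, Nat.choose_succ_succ' m 1, ih,
      Nat.choose_one_right, Nat.choose_one_right]
    ring

section Blocks

variable {U C : Type*} [AddCommGroup U] [Module ℝ U] [AddCommGroup C] [Module ℝ C]

/-- The upper left block of an endomorphism of `U × C`. -/
def topBlock : End ℝ (U × C) →ₗ[ℝ] End ℝ U where
  toFun f := LinearMap.fst ℝ U C ∘ₗ f ∘ₗ LinearMap.inl ℝ U C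
  map_add' _ _ := rfl
  map_smul' _ _ := rfl

/-- The lower right block of an endomorphism of `U × C`. -/
def bottomBlock : End ℝ (U × C) →ₗ[ℝ] End ℝ C where
  toFun f := LinearMap.snd ℝ U C ∘ₗ f ∘ₗ LinearMap.inr ℝ U C
  map_add' _ _ := rfl
  map_smul' _ _ := rfl

/-- The upper right block of an endomorphism of `U × C`. -/
def cornerBlock : End ℝ (U × C) →ₗ[ℝ] (C →ₗ[ℝ] U) where
  toFun f := LinearMap.fst ℝ U C ∘ₗ f ∘ₗ LinearMap.inr ℝ U C
  map_add' _ _ := rfl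
  map_smul' _ _ := rfl

theorem apply_eq_blocks {f : End ℝ (U × C)} (hf : ∀ u, (f (u, 0)).2 = 0) (u : U) (c : C) :
    f (u, c) = (topBlock f u + cornerBlock f c, bottomBlock f c) := by
  have h : f (u, c) = f (u, 0) + f (0, c) := by rw [← map_add]; simp
  rw [h]
  refine Prod.ext rfl ?_
  rw [Prod.snd_add, hf, zero_add]
  rfl

theorem ext_blocks {f : End ℝ (U × C)} (hf : ∀ u, (f (u, 0)).2 = 0) (h1 : topBlock f = 0)
    (h2 : bottomBlock f = 0) (h3 : cornerBlock f = 0) : f = 0 := by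
  refine LinearMap.ext fun ⟨u, c⟩ => ?_
  rw [apply_eq_blocks hf, h1, h2, h3]
  simp

variable [FiniteDimensional ℝ U] [FiniteDimensional ℝ C] {V : Submodule ℝ (End ℝ (U × C))}

theorem IsMaxTrivialSpectrum.blocks (hV : IsMaxTrivialSpectrum V)
    (hinv : ∀ f ∈ V, ∀ u, (f (u, 0)).2 = 0) :
    IsMaxTrivialSpectrum (V.map topBlock) ∧ IsMaxTrivialSpectrum (V.map bottomBlock) ∧
      ∀ f, f ∈ V ↔ (∀ u, (f (u, 0)).2 = 0) ∧ topBlock f ∈ V.map topBlock ∧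
        bottomBlock f ∈ V.map bottomBlock := by
  have h1 : TrivialSpectrum (V.map topBlock) := by
    rintro _ ⟨f, hf, rfl⟩ u hu
    have := hV.1 f hf (u, 0) (by rw [apply_eq_blocks (hinv f hf), hu]; simp)
    exact congrArg Prod.fst this
  have h2 : TrivialSpectrum (V.map bottomBlock) := by
    rintro _ ⟨f, hf, rfl⟩ c hc
    have hinj : Function.Injective (1 - topBlock f : End ℝ U) := by
      rw [injective_iff_map_eq_zero]
      intro u hu
      exact h1 _ ⟨f, hf, rfl⟩ u (sub_eq_zero.mp hu).symm
    obtain ⟨u, hu⟩ := LinearMap.injective_iff_surjective.mp hinj (cornerBlock f c)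
    have hu : u - topBlock f u = cornerBlock f c := hu
    have := hV.1 f hf (u, c) (by rw [apply_eq_blocks (hinv f hf), hc, ← hu]; simp)
    exact congrArg Prod.snd this
  let Ψ : V →ₗ[ℝ] (V.map topBlock) × (V.map bottomBlock) × (C →ₗ[ℝ] U) :=
    (topBlock.submoduleMap V).prod ((bottomBlock.submoduleMap V).prod (cornerBlock ∘ₗ V.subtype))
  have hΨ : Function.Injective Ψ := by
    rw [injective_iff_map_eq_zero]
    intro f hf
    exact Subtype.ext (ext_blocks (hinv f f.2) (congrArg (fun z => z.1.1) hf)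
      (congrArg (fun z => z.2.1.1) hf) (congrArg (fun z => z.2.2) hf))
  have hdim := LinearMap.finrank_le_finrank_of_injective hΨ
  rw [hV.2, finrank_prod, finrank_prod, finrank_prod, finrank_linearMap, choose_two_add,
    mul_comm (finrank ℝ C)] at hdim
  have hd1 := h1.finrank_le
  have hd2 := h2.finrank_le
  refine ⟨⟨h1, by omega⟩, ⟨h2, by omega⟩, fun f =>
    ⟨fun hf => ⟨hinv f hf, ⟨f, hf, rfl⟩, f, hf, rfl⟩, ?_⟩⟩
  let W : Submodule ℝ (End ℝ (U × C)) :=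
    { carrier := {f | (∀ u, (f (u, 0)).2 = 0) ∧ topBlock f ∈ V.map topBlock ∧
        bottomBlock f ∈ V.map bottomBlock}
      add_mem' := fun {f g} hf hg => ⟨fun u => by simp [hf.1 u, hg.1 u],
        by rw [map_add]; exact Submodule.add_mem _ hf.2.1 hg.2.1,
        by rw [map_add]; exact Submodule.add_mem _ hf.2.2 hg.2.2⟩
      zero_mem' := ⟨fun u => rfl, by rw [map_zero]; exact Submodule.zero_mem _,
        by rw [map_zero]; exact Submodule.zero_mem _⟩
      smul_mem' := fun c f hf => ⟨fun u => by simp [hf.1 u],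
        by rw [map_smul]; exact Submodule.smul_mem _ _ hf.2.1,
        by rw [map_smul]; exact Submodule.smul_mem _ _ hf.2.2⟩ }
  have hVW : V = W := hV.eq_of_le (V' := W) (by
    rintro f ⟨hf, hf1, hf2⟩ ⟨u, c⟩ hfix
    rw [apply_eq_blocks hf, Prod.mk.injEq] at hfix
    have hc := h2 _ hf2 c hfix.2
    subst hc
    rw [map_zero, add_zero] at hfix
    rw [h1 _ hf1 u hfix.1]
    rfl) (fun f hf => ⟨hinv f hf, ⟨f, hf, rfl⟩, f, hf, rfl⟩)
  intro hf
  rw [hVW]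
  exact hf

end Blocks

/-- Concatenation of two vectors. -/
def joinVec (k m : ℕ) : ((Fin k → ℝ) × (Fin m → ℝ)) ≃ₗ[ℝ] (Fin (k + m) → ℝ) :=
  (LinearEquiv.sumArrowLequivProdArrow (Fin k) (Fin m) ℝ ℝ).symm ≪≫ₗ
    LinearEquiv.funCongrLeft ℝ ℝ finSumFinEquiv.symm

theorem reindex_fromBlocks_mulVec_joinVec {k m : ℕ} (A : Matrix (Fin k) (Fin k) ℝ)
    (B : Matrix (Fin k) (Fin m) ℝ) (D : Matrix (Fin m) (Fin m) ℝ) (a : Fin k → ℝ)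
    (c : Fin m → ℝ) :
    Matrix.reindex finSumFinEquiv finSumFinEquiv (Matrix.fromBlocks A B 0 D) *ᵥ joinVec k m (a, c) =
      joinVec k m (A *ᵥ a + B *ᵥ c, D *ᵥ c) := by
  have h : ∀ x : (Fin k → ℝ) × (Fin m → ℝ),
      joinVec k m x = Sum.elim x.1 x.2 ∘ finSumFinEquiv.symm := fun x => rfl
  rw [h, h, Matrix.reindex_apply, Matrix.submatrix_mulVec_equiv, Equiv.symm_symm,
    Function.comp_assoc, Equiv.symm_comp_self, Function.comp_id, Matrix.fromBlocks_mulVec]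
  simp

theorem isModelledOn_blockJoin {U C : Type*} [AddCommGroup U] [Module ℝ U] [AddCommGroup C]
    [Module ℝ C] {V : Submodule ℝ (End ℝ (U × C))} {V₁ : Submodule ℝ (End ℝ U)}
    {V₂ : Submodule ℝ (End ℝ C)} {k m : ℕ} {S : Set (Matrix (Fin k) (Fin k) ℝ)}
    {T : Set (Matrix (Fin m) (Fin m) ℝ)}
    (hV : ∀ f, f ∈ V ↔ (∀ u, (f (u, 0)).2 = 0) ∧ topBlock f ∈ V₁ ∧ bottomBlock f ∈ V₂)
    (h₁ : IsModelledOn V₁ S) (h₂ : IsModelledOn V₂ T) : IsModelledOn V (blockJoin S T) := by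
  obtain ⟨p₁, q₁, h₁⟩ := h₁
  obtain ⟨p₂, q₂, h₂⟩ := h₂
  refine ⟨(p₁.prodCongr p₂) ≪≫ₗ joinVec k m, (q₁.prodCongr q₂) ≪≫ₗ joinVec k m, fun f => ?_⟩
  simp only [LinearEquiv.trans_apply]
  rw [hV]
  constructor
  · rintro ⟨hf, hf1, hf2⟩
    obtain ⟨A, hA, hAf⟩ := (h₁ _).1 hf1
    obtain ⟨D, hD, hDf⟩ := (h₂ _).1 hf2
    let B := LinearMap.toMatrix' (p₁.toLinearMap ∘ₗ cornerBlock f ∘ₗ q₂.symm.toLinearMap)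
    have hB : ∀ c, B *ᵥ q₂ c = p₁ (cornerBlock f c) := fun c => by
      simp [B, LinearMap.toMatrix'_mulVec]
    refine ⟨_, ⟨A, hA, D, hD, B, rfl⟩, fun ⟨u, c⟩ => ?_⟩
    rw [apply_eq_blocks hf, LinearEquiv.prodCongr_apply, LinearEquiv.prodCongr_apply,
      reindex_fromBlocks_mulVec_joinVec, ← map_add]
    congr 1
    simp only [Prod.mk_add_mk]
    rw [← add_assoc, map_add, hAf, hDf, hB, add_assoc]
  · rintro ⟨_, ⟨A, hA, D, hD, B, rfl⟩, hM⟩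
    have key : ∀ u c, p₁ (u + (f (u, c)).1) = q₁ u + (A *ᵥ q₁ u + B *ᵥ q₂ c) ∧
        p₂ (c + (f (u, c)).2) = q₂ c + D *ᵥ q₂ c := fun u c => by
      have h := hM (u, c)
      rw [LinearEquiv.prodCongr_apply, LinearEquiv.prodCongr_apply,
        reindex_fromBlocks_mulVec_joinVec, ← map_add] at h
      exact Prod.ext_iff.mp ((joinVec k m).injective h)
    have hf : ∀ u, (f (u, 0)).2 = 0 := fun u => by
      have := (key u 0).2
      simpa using this
    refine ⟨hf, (h₁ _).2 ⟨A, hA, fun u => ?_⟩, (h₂ _).2 ⟨D, hD, fun c => (key 0 c).2⟩⟩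
    have := (key u 0).1
    rw [map_zero, Matrix.mulVec_zero, add_zero] at this
    exact this

section Transport

variable {E' : Type*} [AddCommGroup E'] [Module ℝ E']

omit [FiniteDimensional ℝ E] in
theorem IsMaxTrivialSpectrum.map_conj {V : Submodule ℝ (End ℝ E)} (hV : IsMaxTrivialSpectrum V)
    (φ : E ≃ₗ[ℝ] E') : IsMaxTrivialSpectrum (V.map φ.conj.toLinearMap) := by
  refine ⟨?_, ?_⟩
  · rintro _ ⟨f, hf, rfl⟩ x hx
    have : f (φ.symm x) = φ.symm x := by
      apply φ.injective
      simpa [LinearEquiv.conj_apply] using hx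
    simpa using hV.1 f hf _ this
  · rw [LinearEquiv.finrank_map_eq, hV.2, φ.finrank_eq]

omit [FiniteDimensional ℝ E] in
theorem IsModelledOn.of_map_conj {V : Submodule ℝ (End ℝ E)} (φ : E ≃ₗ[ℝ] E') {n : ℕ}
    {S : Set (Matrix (Fin n) (Fin n) ℝ)} (h : IsModelledOn (V.map φ.conj.toLinearMap) S) :
    IsModelledOn V S := by
  obtain ⟨p, q, h⟩ := h
  refine ⟨φ ≪≫ₗ p, φ ≪≫ₗ q, fun f => ?_⟩
  have hf : f ∈ V ↔ φ.conj f ∈ V.map φ.conj.toLinearMap :=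
    ⟨fun h => ⟨f, h, rfl⟩, fun ⟨_, hg, h⟩ => φ.conj.injective h ▸ hg⟩
  rw [hf, h]
  refine exists_congr fun M => and_congr_right fun _ => ⟨fun hM e => ?_, fun hM e => ?_⟩
  · simpa [LinearEquiv.conj_apply] using hM (φ e)
  · simpa [LinearEquiv.conj_apply] using hM (φ.symm e)

end Transport

theorem IsMaxTrivialSpectrum.exists_isModelledOn_bdSetAlt {V : Submodule ℝ (End ℝ E)}
    (hV : IsMaxTrivialSpectrum V) :
    ∃ l : List ℕ, (∀ m ∈ l, 0 < m) ∧ IsModelledOn V (bdSetAlt l) := by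
  induction hn : finrank ℝ E using Nat.strong_induction_on generalizing E with
  | _ n ih =>
  rcases subsingleton_or_nontrivial E with hE | hE
  · let e₀ : E ≃ₗ[ℝ] (Fin (natSum []) → ℝ) := LinearEquiv.ofFinrankEq _ _ (by
      rw [finrank_zero_of_subsingleton, finrank_fin_fun]
      rfl)
    refine ⟨[], by simp, e₀, e₀, fun f => ⟨fun _ => ⟨0, trivial, fun e => ?_⟩, fun _ => ?_⟩⟩
    · exact Subsingleton.elim (α := Fin 0 → ℝ) _ _
    · rw [show f = 0 from LinearMap.ext fun x => Subsingleton.elim _ _]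
      exact V.zero_mem
  obtain ⟨U, ⟨hU0, hU⟩, hmin⟩ := wellFounded_lt.has_min
    {U : Submodule ℝ E | U ≠ ⊥ ∧ ∀ f ∈ V, ∀ u ∈ U, f u ∈ U} ⟨⊤, top_ne_bot, fun _ _ _ _ => trivial⟩
  obtain ⟨C, hC⟩ := U.exists_isCompl
  let φ := (Submodule.prodEquivOfIsCompl U C hC).symm
  have hφ : ∀ u : U, φ u = (u, 0) := fun u => Submodule.prodEquivOfIsCompl_symm_apply_left _ _ hC u
  have hφsymm : ∀ u : U, φ.symm (u, 0) = u := fun u => by rw [← hφ, φ.symm_apply_apply]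
  have happ : ∀ f ∈ V, ∀ u : U, ∀ hu : f u ∈ U, φ.conj f (u, 0) = (⟨f u, hu⟩, 0) := by
    intro f hf u hu
    rw [LinearEquiv.conj_apply_apply, hφsymm, ← hφ]
  have hmax := hV.map_conj φ
  obtain ⟨h1, h2, h⟩ := hmax.blocks (by
    rintro _ ⟨f, hf, rfl⟩ u
    exact congrArg Prod.snd (happ f hf u (hU f hf u u.2)))
  have hR : RankOneFree ((V.map φ.conj.toLinearMap).map topBlock) := by
    intro χ x hmem
    by_contra! hne
    obtain ⟨W, hW0, hW1, hW⟩ := h1.exists_invariant hne.1 hne.2 hmem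
    refine hmin (W.map U.subtype) ⟨?_, ?_⟩ ?_
    · refine fun h => hW0 (Submodule.map_injective_of_injective U.injective_subtype ?_)
      rw [h, Submodule.map_bot]
    · rintro f hf _ ⟨w, hw, rfl⟩
      have := hW _ ⟨_, ⟨f, hf, rfl⟩, rfl⟩ w hw
      refine ⟨_, this, ?_⟩
      exact congrArg (fun z => (z.1 : E)) (happ f hf w (hU f hf w w.2))
    · refine lt_of_le_of_ne (Submodule.map_subtype_le _ _) fun heq => hW1 ?_
      refine Submodule.map_injective_of_injective U.injective_subtype ?_
      rw [heq, Submodule.map_subtype_top]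
  have hdim := Submodule.finrank_add_eq_of_isCompl hC
  have hpos : 0 < finrank ℝ U := Nat.pos_of_ne_zero fun h0 => hU0 (Submodule.finrank_eq_zero.mp h0)
  obtain ⟨l, hl, hlm⟩ := ih (finrank ℝ C) (by omega) h2 rfl
  refine ⟨finrank ℝ U :: l, ?_,
    (isModelledOn_blockJoin h (h1.isModelledOn_altSet hR) hlm).of_map_conj φ⟩
  intro m hm
  rcases List.mem_cons.mp hm with rfl | hm
  exacts [hpos, hl m hm]

section Matrices

variable {n k m : ℕ}

theorem isUnit_toMatrix' (e : (Fin n → ℝ) ≃ₗ[ℝ] (Fin n → ℝ)) :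
    IsUnit (LinearMap.toMatrix' e.toLinearMap) := by
  refine IsUnit.of_mul_eq_one (LinearMap.toMatrix' e.symm.toLinearMap) ?_
  rw [← LinearMap.toMatrix'_comp, LinearEquiv.comp_symm, LinearMap.toMatrix'_id]

theorem finrank_map_eq_of_injective {M N : Type*} [AddCommGroup M] [Module ℝ M] [AddCommGroup N]
    [Module ℝ N] {f : M →ₗ[ℝ] N} (hf : Function.Injective f) (p : Submodule ℝ M) :
    finrank ℝ (p.map f) = finrank ℝ p :=
  (Submodule.equivMapOfInjective f hf p).finrank_eq.symm

theorem finrank_top_prod {M N : Type*} [AddCommGroup M] [Module ℝ M] [FiniteDimensional ℝ M]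
    [AddCommGroup N] [Module ℝ N] [FiniteDimensional ℝ N] (p : Submodule ℝ N) :
    finrank ℝ ((⊤ : Submodule ℝ M).prod p) = finrank ℝ M + finrank ℝ p := by
  have h : (⊤ : Submodule ℝ M).prod p = LinearMap.range (LinearMap.id.prodMap p.subtype) := by
    rw [LinearMap.range_prodMap, LinearMap.range_id, Submodule.range_subtype]
  rw [h, LinearMap.finrank_range_of_inj (Function.injective_id.prodMap p.injective_subtype),
    finrank_prod]

/-- The space of endomorphisms `M₀⁻¹ V₀`. -/
noncomputable def normalizedSpace (M₀ : Matrix (Fin n) (Fin n) ℝ)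
    (V₀ : Submodule ℝ (Matrix (Fin n) (Fin n) ℝ)) : Submodule ℝ (End ℝ (Fin n → ℝ)) :=
  V₀.map (Matrix.toLin'.toLinearMap ∘ₗ LinearMap.mulLeft ℝ M₀⁻¹)

theorem mem_normalizedSpace {M₀ : Matrix (Fin n) (Fin n) ℝ} (hM₀ : IsUnit M₀)
    {V₀ : Submodule ℝ (Matrix (Fin n) (Fin n) ℝ)} {f : End ℝ (Fin n → ℝ)} :
    f ∈ normalizedSpace M₀ V₀ ↔ ∃ M ∈ V₀, ∀ x, M₀ *ᵥ f x = M *ᵥ x := by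
  have hdet := (Matrix.isUnit_iff_isUnit_det _).mp hM₀
  refine exists_congr fun M => and_congr_right fun _ => ⟨?_, fun h => LinearMap.ext fun x => ?_⟩
  · rintro rfl x
    simp [Matrix.toLin'_apply, Matrix.mul_nonsing_inv_cancel_left _ _ hdet]
  · change (M₀⁻¹ * M) *ᵥ x = f x
    rw [← Matrix.mulVec_mulVec, ← h, Matrix.mulVec_mulVec, Matrix.nonsing_inv_mul _ hdet,
      Matrix.one_mulVec]

theorem isMaxTrivialSpectrum_normalizedSpace {M₀ : Matrix (Fin n) (Fin n) ℝ}
    {V₀ : Submodule ℝ (Matrix (Fin n) (Fin n) ℝ)} (hdim : finrank ℝ V₀ = n * (n - 1) / 2)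
    (hunit : ∀ M ∈ V₀, IsUnit (M₀ + M)) : IsMaxTrivialSpectrum (normalizedSpace M₀ V₀) := by
  have hM₀ : IsUnit M₀ := by simpa using hunit 0 V₀.zero_mem
  have hdet := (Matrix.isUnit_iff_isUnit_det _).mp hM₀
  constructor
  · intro f hf x hx
    obtain ⟨M, hM, hMf⟩ := (mem_normalizedSpace hM₀).mp hf
    have h := hMf x
    rw [hx] at h
    refine Matrix.mulVec_injective_of_isUnit (hunit (-M) (V₀.neg_mem hM)) ?_
    rw [Matrix.add_mulVec, Matrix.neg_mulVec, h, Matrix.mulVec_zero, add_neg_cancel]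
  · rw [normalizedSpace, finrank_map_eq_of_injective, hdim, finrank_fin_fun,
      Nat.choose_two_right]
    refine Matrix.toLin'.injective.comp fun A B hAB => ?_
    have := congrArg (M₀ * ·) hAB
    simpa [Matrix.mul_nonsing_inv_cancel_left _ _ hdet] using this

theorem IsModelledOn.equivSets {M₀ : Matrix (Fin n) (Fin n) ℝ} (hM₀ : IsUnit M₀)
    {V₀ : Submodule ℝ (Matrix (Fin n) (Fin n) ℝ)} {S : Set (Matrix (Fin n) (Fin n) ℝ)}
    (h : IsModelledOn (normalizedSpace M₀ V₀) S) :
    EquivSets ((fun M => 1 + M) '' S)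
      ((fun M => M₀ + M) '' (V₀ : Set (Matrix (Fin n) (Fin n) ℝ))) := by
  obtain ⟨p, q, h⟩ := h
  refine ⟨M₀ * LinearMap.toMatrix' p.symm.toLinearMap, LinearMap.toMatrix' q.toLinearMap,
    hM₀.mul (isUnit_toMatrix' p.symm), isUnit_toMatrix' q, ?_⟩
  have key : ∀ (f : End ℝ (Fin n → ℝ)) (M N : Matrix (Fin n) (Fin n) ℝ),
      (∀ x, M₀ *ᵥ f x = M *ᵥ x) → (∀ e, p (e + f e) = q e + N *ᵥ q e) →
      M₀ * LinearMap.toMatrix' p.symm.toLinearMap * (1 + N) * LinearMap.toMatrix' q.toLinearMap =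
        M₀ + M := by
    intro f M N hM hN
    refine Matrix.mulVec_injective (funext fun x => ?_)
    simp only [← Matrix.mulVec_mulVec, LinearMap.toMatrix'_mulVec, Matrix.add_mulVec,
      Matrix.one_mulVec, LinearEquiv.coe_coe]
    rw [← hN, LinearEquiv.symm_apply_apply, Matrix.mulVec_add, hM]
  ext X
  constructor
  · rintro ⟨M, hM, rfl⟩
    have hf : Matrix.toLin' (M₀⁻¹ * M) ∈ normalizedSpace M₀ V₀ := ⟨M, hM, rfl⟩
    obtain ⟨N, hN, hNf⟩ := (h _).mp hf
    refine ⟨_, ⟨N, hN, rfl⟩, key _ M N (fun x => ?_) hNf⟩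
    simp [Matrix.toLin'_apply,
      Matrix.mul_nonsing_inv_cancel_left _ _ ((Matrix.isUnit_iff_isUnit_det _).mp hM₀)]
  · rintro ⟨_, ⟨N, hN, rfl⟩, rfl⟩
    let f : End ℝ (Fin n → ℝ) :=
      p.symm.toLinearMap ∘ₗ (LinearMap.id + Matrix.toLin' N) ∘ₗ q.toLinearMap - LinearMap.id
    have hNf : ∀ e, p (e + f e) = q e + N *ᵥ q e := fun e => by simp [f]
    obtain ⟨M, hM, hMf⟩ := (mem_normalizedSpace hM₀).mp ((h f).mpr ⟨N, hN, hNf⟩)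
    exact ⟨M, hM, (key f M N hMf hNf).symm⟩

/-- The span of the vectors `M x` with `M ∈ S`. -/
def orbitSpan (S : Set (Matrix (Fin n) (Fin n) ℝ)) (x : Fin n → ℝ) : Submodule ℝ (Fin n → ℝ) :=
  Submodule.span ℝ ((fun M => M *ᵥ x) '' S)

/-- The dimensions of the spans of the orbits `S x` with `x ≠ 0`. -/
def orbitDims (S : Set (Matrix (Fin n) (Fin n) ℝ)) : Set ℕ :=
  {d | ∃ x ≠ 0, finrank ℝ (orbitSpan S x) = d}

theorem EquivSets.orbitDims_eq {S T : Set (Matrix (Fin n) (Fin n) ℝ)} (h : EquivSets S T) :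
    orbitDims T = orbitDims S := by
  obtain ⟨P, Q, hP, hQ, rfl⟩ := h
  have hfin : ∀ x, finrank ℝ (orbitSpan ((fun M => P * M * Q) '' S) x) =
      finrank ℝ (orbitSpan S (Q *ᵥ x)) := by
    intro x
    have hfun : ∀ M, Matrix.toLin' P (M *ᵥ Q *ᵥ x) = (P * M * Q) *ᵥ x := fun M => by
      rw [Matrix.toLin'_apply, Matrix.mulVec_mulVec, Matrix.mulVec_mulVec, Matrix.mul_assoc]
    rw [← finrank_map_eq_of_injective (f := Matrix.toLin' P)
      (Matrix.mulVec_injective_of_isUnit hP) (orbitSpan S _), orbitSpan, orbitSpan, Submodule.map_span,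
      Set.image_image, Set.image_image]
    exact congrArg (fun g => finrank ℝ (Submodule.span ℝ (g '' S)))
      (funext fun M => (hfun M).symm)
  have hQinj := Matrix.mulVec_injective_of_isUnit hQ
  ext d
  constructor
  · rintro ⟨x, hx, rfl⟩
    refine ⟨Q *ᵥ x, fun h0 => hx (hQinj ?_), (hfin x).symm⟩
    rw [h0, Matrix.mulVec_zero]
  · rintro ⟨x, hx, rfl⟩
    obtain ⟨y, rfl⟩ := (Matrix.mulVec_surjective_iff_isUnit.mpr hQ) x
    refine ⟨y, ?_, hfin y⟩
    rintro rfl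
    exact hx (Matrix.mulVec_zero _)

theorem zero_mem_altSet : (0 : Matrix (Fin k) (Fin k) ℝ) ∈ altSet ℝ k := fun X => by simp

theorem bdSetAlt_nonempty : ∀ l : List ℕ, (bdSetAlt l).Nonempty
  | [] => ⟨0, trivial⟩
  | _ :: xs => (bdSetAlt_nonempty xs).elim fun D hD => ⟨_, 0, zero_mem_altSet, D, hD, 0, rfl⟩

theorem span_add_altSet_mulVec {a : Fin k → ℝ} (ha : a ≠ 0) :
    Submodule.span ℝ ((fun A => a + A *ᵥ a) '' altSet ℝ k) = ⊤ := by
  rw [eq_top_iff]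
  intro v _
  have haa : a ⬝ᵥ a ≠ 0 := fun h => ha (dotProduct_self_eq_zero.mp h)
  let w := v - ((a ⬝ᵥ v) / (a ⬝ᵥ a)) • a
  have hw : a ⬝ᵥ w = 0 := by
    simp [w, dotProduct_sub, haa]
  let A := (a ⬝ᵥ a)⁻¹ • (Matrix.vecMulVec w a - Matrix.vecMulVec a w)
  have hA : ∀ X, A *ᵥ X = (a ⬝ᵥ a)⁻¹ • ((a ⬝ᵥ X) • w - (w ⬝ᵥ X) • a) := fun X => by
    simp [A, Matrix.smul_mulVec, Matrix.sub_mulVec, Matrix.vecMulVec_mulVec]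
  have hAalt : A ∈ altSet ℝ k := fun X => by
    show X ⬝ᵥ A *ᵥ X = 0
    rw [hA, dotProduct_smul, dotProduct_sub, dotProduct_smul, dotProduct_smul, dotProduct_comm X w,
      dotProduct_comm X a, smul_eq_mul, smul_eq_mul, smul_eq_mul]
    ring
  have hAa : A *ᵥ a = w := by
    rw [hA, dotProduct_comm w, hw, zero_smul, sub_zero, smul_smul, inv_mul_cancel₀ haa, one_smul]
  have h0 : a ∈ Submodule.span ℝ ((fun A => a + A *ᵥ a) '' altSet ℝ k) :=
    Submodule.subset_span ⟨0, zero_mem_altSet, by simp⟩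
  have h1 : a + w ∈ Submodule.span ℝ ((fun A => a + A *ᵥ a) '' altSet ℝ k) :=
    Submodule.subset_span ⟨A, hAalt, by simp only [hAa]⟩
  have hv : v = (a + w) - a + ((a ⬝ᵥ v) / (a ⬝ᵥ a)) • a := by simp [w]
  rw [hv]
  exact Submodule.add_mem _ (Submodule.sub_mem _ h1 h0) (Submodule.smul_mem _ _ h0)

theorem span_univ_prod {M N : Type*} [AddCommGroup M] [Module ℝ M] [AddCommGroup N] [Module ℝ N]
    {t : Set N} (ht : t.Nonempty) :
    Submodule.span ℝ ((Set.univ : Set M) ×ˢ t) = (⊤ : Submodule ℝ M).prod (Submodule.span ℝ t) := by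
  refine le_antisymm (Submodule.span_le.mpr fun z hz => ⟨trivial, Submodule.subset_span hz.2⟩) ?_
  obtain ⟨w, hw⟩ := ht
  rintro ⟨u, v⟩ ⟨-, hv⟩
  have h0 : ∀ v ∈ Submodule.span ℝ t, ((0 : M), v) ∈ Submodule.span ℝ ((Set.univ : Set M) ×ˢ t) := by
    have : Submodule.span ℝ t ≤
        (Submodule.span ℝ ((Set.univ : Set M) ×ˢ t)).comap (LinearMap.inr ℝ M N) :=
      Submodule.span_le.mpr fun v hv => Submodule.subset_span ⟨trivial, hv⟩
    exact this
  have h1 : (u, w) ∈ Submodule.span ℝ ((Set.univ : Set M) ×ˢ t) :=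
    Submodule.subset_span ⟨trivial, hw⟩
  have := Submodule.add_mem _ (Submodule.sub_mem _ h1 (h0 w (Submodule.subset_span hw))) (h0 v hv)
  simpa using this

theorem orbitSpan_one_add_blockJoin (S : Set (Matrix (Fin k) (Fin k) ℝ))
    (T : Set (Matrix (Fin m) (Fin m) ℝ)) (a : Fin k → ℝ) (c : Fin m → ℝ) :
    orbitSpan ((fun M => 1 + M) '' blockJoin S T) (joinVec k m (a, c)) =
      (Submodule.span ℝ {z | ∃ A ∈ S, ∃ D ∈ T, ∃ B : Matrix (Fin k) (Fin m) ℝ,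
        z = (a + (A *ᵥ a + B *ᵥ c), c + D *ᵥ c)}).map (joinVec k m).toLinearMap := by
  rw [orbitSpan, Submodule.map_span]
  congr 1
  have hM : ∀ A B D, (1 + Matrix.reindex finSumFinEquiv finSumFinEquiv
      (Matrix.fromBlocks A B 0 D)) *ᵥ joinVec k m (a, c) =
      joinVec k m (a + (A *ᵥ a + B *ᵥ c), c + D *ᵥ c) := fun A B D => by
    rw [Matrix.add_mulVec, Matrix.one_mulVec, reindex_fromBlocks_mulVec_joinVec, ← map_add,
      Prod.mk_add_mk]
  ext z
  constructor
  · rintro ⟨_, ⟨_, ⟨A, hA, D, hD, B, rfl⟩, rfl⟩, rfl⟩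
    exact ⟨_, ⟨A, hA, D, hD, B, rfl⟩, (hM A B D).symm⟩
  · rintro ⟨_, ⟨A, hA, D, hD, B, rfl⟩, rfl⟩
    exact ⟨_, ⟨_, ⟨A, hA, D, hD, B, rfl⟩, rfl⟩, hM A B D⟩

theorem finrank_orbitSpan_blockJoin_of_ne_zero {S : Set (Matrix (Fin k) (Fin k) ℝ)}
    (hS : S.Nonempty) {T : Set (Matrix (Fin m) (Fin m) ℝ)} (hT : T.Nonempty) (a : Fin k → ℝ)
    {c : Fin m → ℝ} (hc : c ≠ 0) :
    finrank ℝ (orbitSpan ((fun M => 1 + M) '' blockJoin S T) (joinVec k m (a, c))) =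
      k + finrank ℝ (orbitSpan ((fun M => 1 + M) '' T) c) := by
  have hset : {z | ∃ A ∈ S, ∃ D ∈ T, ∃ B : Matrix (Fin k) (Fin m) ℝ,
      z = (a + (A *ᵥ a + B *ᵥ c), c + D *ᵥ c)} =
      Set.univ ×ˢ ((fun M => M *ᵥ c) '' ((fun M => 1 + M) '' T)) := by
    ext ⟨u, v⟩
    constructor
    · rintro ⟨A, hA, D, hD, B, h⟩
      refine ⟨trivial, _, ⟨D, hD, rfl⟩, ?_⟩
      rw [h]
      simp only [Matrix.add_mulVec, Matrix.one_mulVec]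
    · rintro ⟨-, _, ⟨D, hD, rfl⟩, h⟩
      obtain ⟨A, hA⟩ := hS
      have hcc : c ⬝ᵥ c ≠ 0 := fun h => hc (dotProduct_self_eq_zero.mp h)
      refine ⟨A, hA, D, hD, (c ⬝ᵥ c)⁻¹ • Matrix.vecMulVec (u - a - A *ᵥ a) c, ?_⟩
      rw [Matrix.smul_mulVec, Matrix.vecMulVec_mulVec]
      refine Prod.ext ?_ ?_
      · simp [smul_smul, inv_mul_cancel₀ hcc]
      · simpa [Matrix.add_mulVec] using h.symm
  rw [orbitSpan_one_add_blockJoin, LinearEquiv.finrank_map_eq, hset,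
    span_univ_prod ((hT.image _).image _), finrank_top_prod, finrank_fin_fun, orbitSpan]

theorem finrank_orbitSpan_blockJoin_of_eq_zero {T : Set (Matrix (Fin m) (Fin m) ℝ)}
    (hT : T.Nonempty) {a : Fin k → ℝ} (ha : a ≠ 0) :
    finrank ℝ (orbitSpan ((fun M => 1 + M) '' blockJoin (altSet ℝ k) T) (joinVec k m (a, 0))) =
      k := by
  have hset : {z | ∃ A ∈ altSet ℝ k, ∃ D ∈ T, ∃ B : Matrix (Fin k) (Fin m) ℝ,
      z = (a + (A *ᵥ a + B *ᵥ 0), 0 + D *ᵥ 0)} =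
      LinearMap.inl ℝ (Fin k → ℝ) (Fin m → ℝ) '' ((fun A => a + A *ᵥ a) '' altSet ℝ k) := by
    ext z
    constructor
    · rintro ⟨A, hA, D, -, B, rfl⟩
      exact ⟨_, ⟨A, hA, rfl⟩, by simp⟩
    · rintro ⟨_, ⟨A, hA, rfl⟩, rfl⟩
      obtain ⟨D, hD⟩ := hT
      exact ⟨A, hA, D, hD, 0, by simp⟩
  rw [orbitSpan_one_add_blockJoin, LinearEquiv.finrank_map_eq, hset, ← Submodule.map_span,
    finrank_map_eq_of_injective LinearMap.inl_injective, span_add_altSet_mulVec ha,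
    finrank_top, finrank_fin_fun]

/-- The set of the sums of the nonempty initial segments of a list. -/
def partialSums : List ℕ → Set ℕ
  | [] => ∅
  | x :: xs => {x} ∪ (x + ·) '' partialSums xs

theorem orbitDims_one_add_bdSetAlt : ∀ l : List ℕ, (∀ x ∈ l, 0 < x) →
    orbitDims ((fun M => 1 + M) '' bdSetAlt l) = partialSums l
  | [], _ => by
    refine Set.eq_empty_of_forall_notMem ?_
    rintro d ⟨x, hx, -⟩
    exact hx (Subsingleton.elim (α := Fin 0 → ℝ) _ _)
  | k :: l, hl => by
    have ih := orbitDims_one_add_bdSetAlt l fun x hx => hl x (List.mem_cons_of_mem _ hx)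
    have hT := bdSetAlt_nonempty l
    have hk : 0 < k := hl k List.mem_cons_self
    rw [partialSums, ← ih]
    ext d
    constructor
    · rintro ⟨X, hX, rfl⟩
      obtain ⟨⟨a, c⟩, rfl⟩ := (joinVec k (natSum l)).surjective X
      by_cases hc : c = 0
      · subst hc
        have ha : a ≠ 0 := by
          rintro rfl
          exact hX (map_zero (joinVec k (natSum l)))
        exact Or.inl (finrank_orbitSpan_blockJoin_of_eq_zero hT ha)
      · exact Or.inr ⟨_, ⟨c, hc, rfl⟩,
          (finrank_orbitSpan_blockJoin_of_ne_zero ⟨0, zero_mem_altSet⟩ hT a hc).symm⟩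
    · rintro (rfl | ⟨_, ⟨c, hc, rfl⟩, rfl⟩)
      · have ha : (Pi.single ⟨0, hk⟩ 1 : Fin d → ℝ) ≠ 0 := by simp
        refine ⟨joinVec d (natSum l) (_, 0), fun h0 => ha ?_,
          finrank_orbitSpan_blockJoin_of_eq_zero hT ha⟩
        exact congrArg Prod.fst ((joinVec d (natSum l)).map_eq_zero_iff.mp h0)
      · refine ⟨joinVec k (natSum l) (0, c), fun h0 => hc ?_,
          finrank_orbitSpan_blockJoin_of_ne_zero ⟨0, zero_mem_altSet⟩ hT 0 hc⟩
        exact congrArg Prod.snd ((joinVec k (natSum l)).map_eq_zero_iff.mp h0)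

theorem head_le_of_mem_partialSums {x d : ℕ} {l : List ℕ} (h : d ∈ partialSums (x :: l)) :
    x ≤ d := by
  rcases h with rfl | ⟨e, -, rfl⟩
  exacts [le_rfl, Nat.le_add_right _ _]

theorem pos_of_mem_partialSums {d : ℕ} {l : List ℕ} (hl : ∀ x ∈ l, 0 < x)
    (h : d ∈ partialSums l) : 0 < d := by
  cases l with
  | nil => exact h.elim
  | cons x l => exact (hl x List.mem_cons_self).trans_le (head_le_of_mem_partialSums h)

theorem partialSums_subset_of_cons {x : ℕ} {l l' : List ℕ} (hl : ∀ x ∈ l, 0 < x)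
    (h : partialSums (x :: l) ⊆ partialSums (x :: l')) : partialSums l ⊆ partialSums l' := by
  intro d hd
  have hpos := pos_of_mem_partialSums hl hd
  rcases h (Or.inr ⟨d, hd, rfl⟩) with h1 | ⟨e, he, h1⟩
  · have : x + d = x := h1
    omega
  · exact Nat.add_left_cancel h1 ▸ he

theorem eq_of_partialSums_eq : ∀ {l l' : List ℕ}, (∀ x ∈ l, 0 < x) → (∀ x ∈ l', 0 < x) →
    partialSums l = partialSums l' → l = l'
  | [], [], _, _, _ => rfl
  | [], y :: l', _, _, h => by
    have : y ∈ partialSums [] := h ▸ Or.inl rfl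
    exact this.elim
  | x :: l, [], _, _, h => by
    have : x ∈ partialSums [] := h ▸ Or.inl rfl
    exact this.elim
  | x :: l, y :: l', hl, hl', h => by
    have hxy : x = y := le_antisymm (head_le_of_mem_partialSums (h.symm.subset (Or.inl rfl)))
      (head_le_of_mem_partialSums (h.subset (Or.inl rfl)))
    subst hxy
    have h1 : ∀ z ∈ l, 0 < z := fun z hz => hl z (List.mem_cons_of_mem _ hz)
    have h2 : ∀ z ∈ l', 0 < z := fun z hz => hl' z (List.mem_cons_of_mem _ hz)
    rw [eq_of_partialSums_eq h1 h2 ((partialSums_subset_of_cons h1 h.subset).antisymm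
      (partialSums_subset_of_cons h2 h.symm.subset))]

theorem reindex_finCongr_rfl_image (S : Set (Matrix (Fin n) (Fin n) ℝ)) :
    Matrix.reindex (finCongr rfl) (finCongr rfl) '' S = S := by
  have : ⇑(Matrix.reindex (finCongr (rfl : n = n)) (finCongr rfl)) =
      (id : Matrix (Fin n) (Fin n) ℝ → _) := rfl
  rw [this, Set.image_id]

theorem partialSums_eq_orbitDims {l : List ℕ} (hl : ∀ x ∈ l, 0 < x) (h : natSum l = n)
    {T : Set (Matrix (Fin n) (Fin n) ℝ)}
    (hT : EquivSets ((fun M => 1 + M) ''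
      ((Matrix.reindex (finCongr h) (finCongr h)) '' bdSetAlt l)) T) :
    partialSums l = orbitDims T := by
  subst h
  rw [reindex_finCongr_rfl_image] at hT
  rw [EquivSets.orbitDims_eq hT, orbitDims_one_add_bdSetAlt l hl]

theorem exists_equivSets_bdSetAlt {M₀ : Matrix (Fin n) (Fin n) ℝ}
    {V₀ : Submodule ℝ (Matrix (Fin n) (Fin n) ℝ)} (hdim : finrank ℝ V₀ = n * (n - 1) / 2)
    (hunit : ∀ M ∈ V₀, IsUnit (M₀ + M)) :
    ∃ l : List ℕ, (∀ m ∈ l, 0 < m) ∧ ∃ h : natSum l = n,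
      EquivSets ((fun M => 1 + M) ''
        ((Matrix.reindex (finCongr h) (finCongr h)) '' bdSetAlt l))
        ((fun M => M₀ + M) '' (V₀ : Set (Matrix (Fin n) (Fin n) ℝ))) := by
  have hM₀ : IsUnit M₀ := by simpa using hunit 0 V₀.zero_mem
  obtain ⟨l, hl, hmod⟩ :=
    (isMaxTrivialSpectrum_normalizedSpace hdim hunit).exists_isModelledOn_bdSetAlt
  have h : natSum l = n := by
    obtain ⟨p, -⟩ := hmod
    have := p.finrank_eq
    rw [finrank_fin_fun, finrank_fin_fun] at this
    exact this.symm
  refine ⟨l, hl, h, ?_⟩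
  subst h
  rw [reindex_finCongr_rfl_image]
  exact hmod.equivSets hM₀

end Matrices

end AffineNonsingular

/-- Let `𝒱` be an affine subspace of `M_n(ℝ)` of dimension `n(n-1)/2` consisting of
invertible matrices.  Then there is a unique list `(n_1, …, n_p)` of positive integers
with `n_1 + ⋯ + n_p = n` such that `𝒱` is equivalent to
`I_n + (Alt_{n_1}(ℝ) ∨ ⋯ ∨ Alt_{n_p}(ℝ))`. -/
theorem classification_affine_nonsingular_real (n : ℕ)
    (𝒱 : Set (Matrix (Fin n) (Fin n) ℝ))
    (haff : ∃ (M₀ : Matrix (Fin n) (Fin n) ℝ) (V₀ : Submodule ℝ (Matrix (Fin n) (Fin n) ℝ)),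
      Module.finrank ℝ V₀ = n * (n - 1) / 2 ∧
      𝒱 = (fun M => M₀ + M) '' (V₀ : Set (Matrix (Fin n) (Fin n) ℝ)))
    (hGL : ∀ M ∈ 𝒱, IsUnit M) :
    ∃! l : List ℕ, (∀ m ∈ l, 0 < m) ∧
      ∃ h : natSum l = n,
        EquivSets ((fun M => 1 + M) ''
          ((Matrix.reindex (finCongr h) (finCongr h)) '' bdSetAlt l)) 𝒱 := by
  obtain ⟨M₀, V₀, hdim, rfl⟩ := haff
  obtain ⟨l, hl, hlV⟩ := AffineNonsingular.exists_equivSets_bdSetAlt hdim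
    fun M hM => hGL _ ⟨M, hM, rfl⟩
  refine ⟨l, ⟨hl, hlV⟩, fun l' ⟨hl', h', hlV'⟩ => ?_⟩
  obtain ⟨h, hlV⟩ := hlV
  refine AffineNonsingular.eq_of_partialSums_eq hl' hl ?_
  rw [AffineNonsingular.partialSums_eq_orbitDims hl h hlV,
    AffineNonsingular.partialSums_eq_orbitDims hl' h' hlV']
end
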